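/- Cordes–Nirenberg estimate in non-divergence form (Theorem A / Theorem 6.1). Let s ∈ (0,1), β ∈ (0,2s), ε > 0, and 0 < λ ≤ Λ. Then there exist η₀ > 0 and C > 0, depending only on n, s, β, ε, λ, Λ, such that the following holds. Let (K_x)_{x∈ℝⁿ} be a family of symmetric Lévy measures, uniformly elliptic of order 2s with constants λ, Λ, and suppose that for some η ≤ η₀ one has: for all x, x' ∈ ℝⁿ, all ρ > 0, and every φ : ℝⁿ → ℝ with [φ]_{C^β(ℝⁿ)} ≤ 1 and φ(0) = 0, |∫_{B_{2ρ}∖B_ρ} φ d(K_x − K_{x'})| ≤ η ρ^{β−2s}. Let f ∈ L^∞(B₁) and let u be such that u ∈ C^{2s+ε'} on compact subsets of B₁ for some ε' > 0, ‖u‖_{L^∞_{2s−ε}(ℝⁿ)} < ∞, and L(u,x) = f(x) for every x ∈ B₁. Then ‖u‖_{C^β(B_{1/2})} ≤ C (‖u‖_{L^∞_{2s−ε}(ℝⁿ)} + ‖f‖_{L^∞(B₁)}). -/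

import Mathlib

open MeasureTheory Metric Set
open scoped ENNReal Topology RealInnerProductSpace

noncomputable section

abbrev Euc (n : ℕ) := EuclideanSpace ℝ (Fin n)

variable {n : ℕ}

def hDeg (σ : ℝ) : ℕ := ⌈σ⌉₊ - 1

def hSemiOn (σ : ℝ) (Ω A : Set (Euc n)) (u : Euc n → ℝ) : ℝ≥0∞ :=
  ⨆ (x : A) (y : A),
    ENNReal.ofReal
      (‖iteratedFDerivWithin ℝ (hDeg σ) u Ω ↑x - iteratedFDerivWithin ℝ (hDeg σ) u Ω ↑y‖ /
        ‖(x : Euc n) - (y : Euc n)‖ ^ (σ - (hDeg σ : ℝ)))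

def hSemi (σ : ℝ) (Ω : Set (Euc n)) (u : Euc n → ℝ) : ℝ≥0∞ := hSemiOn σ Ω Ω u

def hNormOn (σ : ℝ) (Ω A : Set (Euc n)) (u : Euc n → ℝ) : ℝ≥0∞ :=
  (∑ j ∈ Finset.range (hDeg σ + 1), ⨆ x : A, ENNReal.ofReal ‖iteratedFDerivWithin ℝ j u Ω ↑x‖) +
    hSemiOn σ Ω A u

def hNorm (σ : ℝ) (Ω : Set (Euc n)) (u : Euc n → ℝ) : ℝ≥0∞ := hNormOn σ Ω Ω u

def HolderMem (σ : ℝ) (Ω : Set (Euc n)) (u : Euc n → ℝ) : Prop :=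
  ContDiffOn ℝ (hDeg σ) u Ω ∧ hNorm σ Ω u ≠ ⊤

def HolderMemLoc (σ : ℝ) (Ω : Set (Euc n)) (u : Euc n → ℝ) : Prop :=
  ContDiffOn ℝ (hDeg σ) u Ω ∧
    ∀ A : Set (Euc n), IsCompact A → A ⊆ Ω → hNormOn σ Ω A u ≠ ⊤

def supNorm (Ω : Set (Euc n)) (u : Euc n → ℝ) : ℝ≥0∞ :=
  ⨆ x : Ω, ENNReal.ofReal |u ↑x|

def supNormW (τ : ℝ) (u : Euc n → ℝ) : ℝ≥0∞ :=
  ⨆ x : Euc n, ENNReal.ofReal (|u x| / (1 + ‖x‖ ^ τ))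

def IsLevyMeasure (K : Measure (Euc n)) : Prop :=
  K {0} = 0 ∧ (∫⁻ y, ENNReal.ofReal (min 1 (‖y‖ ^ 2)) ∂K) ≠ ⊤ ∧
    Measure.map (fun y => -y) K = K

def UnifElliptic (s lam Lam : ℝ) (K : Measure (Euc n)) : Prop :=
  (∀ r : ℝ, 0 < r →
    ENNReal.ofReal (r ^ (2 * s)) * K (ball 0 (2 * r) \ ball 0 r) ≤ ENNReal.ofReal Lam) ∧
  (∀ r : ℝ, 0 < r → ∀ e : Euc n, ‖e‖ = 1 →
    ENNReal.ofReal lam ≤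
      ENNReal.ofReal (r ^ (2 * s - 2)) * ∫⁻ y in ball 0 r, ENNReal.ofReal (⟪e, y⟫ ^ 2) ∂K)

def Lop (K : Euc n → Measure (Euc n)) (u : Euc n → ℝ) (x : Euc n) : ℝ :=
  (1 / 2) * ∫ y, (2 * u x - u (x + y) - u (x - y)) ∂(K x)

def LopTI (K : Measure (Euc n)) (u : Euc n → ℝ) (x : Euc n) : ℝ :=
  (1 / 2) * ∫ y, (2 * u x - u (x + y) - u (x - y)) ∂K

def SolvesPtwise (K : Euc n → Measure (Euc n)) (u f : Euc n → ℝ) (Ω : Set (Euc n)) : Prop :=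
  ∀ x ∈ Ω, Integrable (fun y => 2 * u x - u (x + y) - u (x - y)) (K x) ∧ Lop K u x = f x

def tvDiff (μ ν : Measure (Euc n)) (A : Set (Euc n)) : ℝ≥0∞ :=
  (μ.restrict A - ν.restrict A) Set.univ + (ν.restrict A - μ.restrict A) Set.univ

def kernelHolder (s θ : ℝ) (K : Measure (Euc n)) : ℝ≥0∞ :=
  ⨆ (ρ : ℝ) (_ : 0 < ρ) (x : Euc n) (x' : Euc n)
      (_ : x ∈ ball 0 (ρ / 2)) (_ : x' ∈ ball 0 (ρ / 2)) (_ : x ≠ x'),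
    ENNReal.ofReal (ρ ^ (2 * s + θ) / ‖x - x'‖ ^ θ) *
      tvDiff (Measure.map (fun y => x - y) K) (Measure.map (fun y => x' - y) K)
        (ball 0 (2 * ρ) \ ball 0 ρ)

def KantCond (s γ : ℝ) (μ ν : Measure (Euc n)) (c : ℝ) : Prop :=
  ∀ ρ : ℝ, 0 < ρ → ∀ φ : Euc n → ℝ, ContDiff ℝ (hDeg γ) φ →
    hSemi γ Set.univ φ ≤ 1 → φ 0 = 0 →
    |(∫ y in ball 0 (2 * ρ) \ ball 0 ρ, φ y ∂μ) -
        ∫ y in ball 0 (2 * ρ) \ ball 0 ρ, φ y ∂ν| ≤ c * ρ ^ (γ - 2 * s)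

/-- The symmetric second difference of `f` at `x` with step `h`. -/
def d2 (f : Euc n → ℝ) (x h : Euc n) : ℝ := f (x + h) + f (x - h) - 2 * f x

/-- Symmetric measures with the two-sided scale-invariant bounds of order `2s`. -/
structure Adm (s lam Lam : ℝ) (K : Measure (Euc n)) : Prop where
  zero : K {0} = 0
  symm : Measure.map (fun y => -y) K = K
  upper : ∀ r : ℝ, 0 < r →
    K (ball 0 (2 * r) \ ball 0 r) ≤ ENNReal.ofReal (Lam * r ^ (-(2 * s)))
  lower : ∀ r : ℝ, 0 < r → ∀ e : Euc n, ‖e‖ = 1 →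
    ENNReal.ofReal (lam * r ^ (2 - 2 * s)) ≤
      ∫⁻ y in ball 0 r, ENNReal.ofReal (⟪e, y⟫ ^ 2) ∂K

lemma Adm.of_unifElliptic {s lam Lam : ℝ} {K : Measure (Euc n)}
    (h1 : IsLevyMeasure K) (h2 : UnifElliptic s lam Lam K) : Adm s lam Lam K := by
  refine ⟨h1.1, h1.2.2, fun r hr => ?_, fun r hr e he => ?_⟩
  · have h := h2.1 r hr
    have hp : 0 < r ^ (-(2 * s)) := Real.rpow_pos_of_pos hr _
    have h' := mul_le_mul_right h (ENNReal.ofReal (r ^ (-(2 * s))))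
    rw [← mul_assoc, ← ENNReal.ofReal_mul hp.le, ← Real.rpow_add hr, neg_add_cancel,
      Real.rpow_zero, ENNReal.ofReal_one, one_mul, ← ENNReal.ofReal_mul hp.le] at h'
    rwa [mul_comm Lam]
  · have h := h2.2 r hr e he
    have hp : 0 < r ^ (2 - 2 * s) := Real.rpow_pos_of_pos hr _
    have h' := mul_le_mul_right h (ENNReal.ofReal (r ^ (2 - 2 * s)))
    rw [← mul_assoc, ← ENNReal.ofReal_mul hp.le, ← ENNReal.ofReal_mul hp.le,
      ← Real.rpow_add hr, show 2 - 2 * s + (2 * s - 2) = 0 by ring,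
      Real.rpow_zero, ENNReal.ofReal_one, one_mul] at h'
    rwa [mul_comm lam]

lemma Adm.lintegral_annuli_le {s lam Lam p a c r : ℝ} {K : Measure (Euc n)} (hK : Adm s lam Lam K)
    (hLam : 0 < Lam) (hp : 0 ≤ p) (ha : 0 < a) (hc : 0 < c) (hq : a ^ (p - 2 * s) < 1) (hr : 0 < r)
    {S : Set (Euc n)}
    (hS : S ⊆ {0} ∪ ⋃ j : ℕ, (ball 0 (2 * (r * c * a ^ j)) \ ball 0 (r * c * a ^ j))) :
    ∫⁻ y in S, ENNReal.ofReal (‖y‖ ^ p) ∂K ≤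
      ENNReal.ofReal (2 ^ p * Lam * c ^ (p - 2 * s) * (1 - a ^ (p - 2 * s))⁻¹ *
        r ^ (p - 2 * s)) := by
  have hpos : ∀ j : ℕ, 0 < r * c * a ^ j := fun j => by positivity
  have hq0 : 0 ≤ a ^ (p - 2 * s) := by positivity
  have hterm : ∀ j : ℕ, ∫⁻ y in ball 0 (2 * (r * c * a ^ j)) \ ball 0 (r * c * a ^ j),
      ENNReal.ofReal (‖y‖ ^ p) ∂K ≤
      ENNReal.ofReal (2 ^ p * Lam * c ^ (p - 2 * s) * r ^ (p - 2 * s) *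
        (a ^ (p - 2 * s)) ^ j) := by
    intro j
    set t := r * c * a ^ j with ht
    have ht0 : 0 < t := hpos j
    calc _ ≤ ∫⁻ y in ball 0 (2 * t) \ ball (0 : Euc n) t, ENNReal.ofReal ((2 * t) ^ p) ∂K := by
          refine setLIntegral_mono' (measurableSet_ball.diff measurableSet_ball) fun y hy => ?_
          have : ‖y‖ < 2 * t := by simpa using hy.1
          gcongr
      _ = ENNReal.ofReal ((2 * t) ^ p) * K (ball 0 (2 * t) \ ball 0 t) := by
          rw [setLIntegral_const]
      _ ≤ ENNReal.ofReal ((2 * t) ^ p) * ENNReal.ofReal (Lam * t ^ (-(2 * s))) := by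
          gcongr; exact hK.upper t ht0
      _ = _ := by
          rw [← ENNReal.ofReal_mul (by positivity)]
          congr 1
          have e1 : t ^ (p - 2 * s) = r ^ (p - 2 * s) * c ^ (p - 2 * s) * (a ^ (p - 2 * s)) ^ j := by
            rw [ht, Real.mul_rpow (by positivity) (by positivity), Real.mul_rpow hr.le hc.le,
              ← Real.rpow_natCast, ← Real.rpow_natCast, ← Real.rpow_mul ha.le,
              ← Real.rpow_mul ha.le, mul_comm (j : ℝ)]
          have e2 : t ^ (p - 2 * s) = t ^ p * t ^ (-(2 * s)) := by
            rw [← Real.rpow_add ht0]; ring_nf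
          rw [Real.mul_rpow (by norm_num) ht0.le]
          calc _ = 2 ^ p * Lam * (t ^ p * t ^ (-(2 * s))) := by ring
            _ = _ := by rw [← e2, e1]; ring
  calc _ ≤ ∫⁻ y in {0} ∪ ⋃ j : ℕ, (ball 0 (2 * (r * c * a ^ j)) \ ball 0 (r * c * a ^ j)),
        ENNReal.ofReal (‖y‖ ^ p) ∂K := lintegral_mono_set hS
    _ ≤ ∫⁻ y in {0}, ENNReal.ofReal (‖y‖ ^ p) ∂K +
        ∫⁻ y in ⋃ j : ℕ, (ball 0 (2 * (r * c * a ^ j)) \ ball 0 (r * c * a ^ j)),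
        ENNReal.ofReal (‖y‖ ^ p) ∂K := lintegral_union_le _ _ _
    _ ≤ 0 + ∑' j : ℕ, ENNReal.ofReal (2 ^ p * Lam * c ^ (p - 2 * s) * r ^ (p - 2 * s) *
        (a ^ (p - 2 * s)) ^ j) := by
        gcongr
        · rw [Measure.restrict_eq_zero.2 hK.zero]; simp
        · exact (lintegral_iUnion_le _ _).trans (ENNReal.tsum_le_tsum hterm)
    _ = _ := by
        rw [zero_add, ← ENNReal.ofReal_tsum_of_nonneg (fun j => by positivity)
          ((summable_geometric_of_lt_one hq0 hq).mul_left _), tsum_mul_left,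
          tsum_geometric_of_lt_one hq0 hq]
        congr 1; ring

lemma exists_dyadic {t r : ℝ} (hr : 0 < r) (hrt : r ≤ t) :
    ∃ j : ℕ, r * 2 ^ j ≤ t ∧ t < 2 * (r * 2 ^ j) := by
  obtain ⟨j, h1, h2⟩ := exists_nat_pow_near (x := t / r) (y := 2) (by rwa [le_div_iff₀ hr, one_mul])
    (by norm_num)
  refine ⟨j, ?_, ?_⟩
  · rw [le_div_iff₀ hr] at h1; linarith
  · rw [div_lt_iff₀ hr, pow_succ] at h2; linarith

lemma exists_dyadic_inv {t r : ℝ} (ht : 0 < t) (hrt : t < r) :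
    ∃ j : ℕ, r * (1 / 2) * (1 / 2) ^ j ≤ t ∧ t < 2 * (r * (1 / 2) * (1 / 2) ^ j) := by
  have hr : 0 < r := ht.trans hrt
  obtain ⟨j, h1, h2⟩ := exists_nat_pow_near_of_lt_one (x := t / r) (y := 1 / 2) (by positivity)
    (by rw [div_le_one hr]; exact hrt.le) (by norm_num) (by norm_num)
  rw [lt_div_iff₀ hr, pow_succ] at h1
  rw [div_le_iff₀ hr] at h2
  rcases h2.lt_or_eq with h2 | h2
  · exact ⟨j, by linarith, by linarith⟩
  · cases j with
    | zero => simp at h2; linarith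
    | succ j => exact ⟨j, by rw [h2, pow_succ]; linarith, by
        rw [h2, pow_succ]; have : 0 < (1 / 2 : ℝ) ^ j * r := by positivity
        linarith⟩

/-- Second moments near the origin. -/
lemma exists_lintegral_ball_le (n : ℕ) {s lam Lam : ℝ} (hs : s ∈ Ioo (0 : ℝ) 1) (hLam : 0 < Lam) :
    ∃ C > 0, ∀ K : Measure (Euc n), Adm s lam Lam K → ∀ r : ℝ, 0 < r →
      ∫⁻ y in ball 0 r, ENNReal.ofReal (‖y‖ ^ 2) ∂K ≤ ENNReal.ofReal (C * r ^ (2 - 2 * s)) := by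
  have hq : (1 / 2 : ℝ) ^ (2 - 2 * s) < 1 :=
    Real.rpow_lt_one (by norm_num) (by norm_num) (by linarith [hs.2])
  refine ⟨2 ^ (2 : ℝ) * Lam * (1 / 2) ^ (2 - 2 * s) * (1 - (1 / 2) ^ (2 - 2 * s))⁻¹, ?_, ?_⟩
  · have : 0 < 1 - (1 / 2 : ℝ) ^ (2 - 2 * s) := by linarith
    positivity
  · intro K hK r hr
    have := hK.lintegral_annuli_le hLam (p := 2) (a := 1 / 2) (c := 1 / 2) (by norm_num)
      (by norm_num) (by norm_num) hq hr (S := ball 0 r) (by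
        intro y hy
        rcases eq_or_ne y 0 with rfl | h0
        · simp
        · right
          obtain ⟨j, h1, h2⟩ := exists_dyadic_inv (norm_pos_iff.2 h0) (by simpa using hy)
          exact mem_iUnion.2 ⟨j, by simpa using h2, by simpa using h1⟩)
    simpa using this

/-- Moments of order `p < 2s` away from the origin. -/
lemma exists_lintegral_compl_ball_le (n : ℕ) {s lam Lam p : ℝ} (hLam : 0 < Lam) (hp : 0 ≤ p)
    (hps : p < 2 * s) :
    ∃ C > 0, ∀ K : Measure (Euc n), Adm s lam Lam K → ∀ r : ℝ, 0 < r →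
      ∫⁻ y in (ball 0 r)ᶜ, ENNReal.ofReal (‖y‖ ^ p) ∂K ≤ ENNReal.ofReal (C * r ^ (p - 2 * s)) := by
  have hq : (2 : ℝ) ^ (p - 2 * s) < 1 :=
    Real.rpow_lt_one_of_one_lt_of_neg (by norm_num) (by linarith)
  refine ⟨2 ^ p * Lam * 1 ^ (p - 2 * s) * (1 - 2 ^ (p - 2 * s))⁻¹, ?_, ?_⟩
  · have : 0 < 1 - (2 : ℝ) ^ (p - 2 * s) := by linarith
    positivity
  · intro K hK r hr
    exact hK.lintegral_annuli_le hLam (p := p) (a := 2) (c := 1) hp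
      (by norm_num) (by norm_num) hq hr (S := (ball 0 r)ᶜ) (by
        intro y hy
        right
        obtain ⟨j, h1, h2⟩ := exists_dyadic hr (by simpa using hy : r ≤ ‖y‖)
        exact mem_iUnion.2 ⟨j, by simpa using h2, by simpa using h1⟩)

/-- Functions whose top-order `β`-Hölder seminorm is at most one. -/
def HE (β : ℝ) (φ : Euc n → ℝ) : Prop :=
  (β ≤ 1 ∧ ∀ y y', |φ y - φ y'| ≤ ‖y - y'‖ ^ β) ∨
  (1 < β ∧ ContDiff ℝ 1 φ ∧ ∀ y y', ‖fderiv ℝ φ y - fderiv ℝ φ y'‖ ≤ ‖y - y'‖ ^ (β - 1))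

/-- The scale-invariant comparison condition tested on `HE` functions. -/
def KC (s β η : ℝ) (μ ν : Measure (Euc n)) : Prop :=
  ∀ ρ : ℝ, 0 < ρ → ∀ φ : Euc n → ℝ, HE β φ → φ 0 = 0 →
    |(∫ y in ball 0 (2 * ρ) \ ball 0 ρ, φ y ∂μ) - ∫ y in ball 0 (2 * ρ) \ ball 0 ρ, φ y ∂ν| ≤
      η * ρ ^ (β - 2 * s)

lemma hDeg_of_le_one {β : ℝ} (h1 : β ≤ 1) : hDeg β = 0 := by
  have : ⌈β⌉₊ ≤ 1 := Nat.ceil_le.2 (by simpa using h1)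
  unfold hDeg; omega

lemma hDeg_of_lt_two {β : ℝ} (h0 : 1 < β) (h1 : β ≤ 2) : hDeg β = 1 := by
  have h2 : ⌈β⌉₊ ≤ 2 := Nat.ceil_le.2 (by simpa using h1)
  have h3 : 1 < ⌈β⌉₊ := Nat.lt_ceil.2 (by simpa using h0)
  unfold hDeg; omega

lemma norm_iteratedFDeriv_one_sub (f : Euc n → ℝ) (x y : Euc n) :
    ‖iteratedFDeriv ℝ 1 f x - iteratedFDeriv ℝ 1 f y‖ = ‖fderiv ℝ f x - fderiv ℝ f y‖ := by
  have h : ∀ z, iteratedFDeriv ℝ 1 f z =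
      (continuousMultilinearCurryFin1 ℝ (Euc n) ℝ).symm (fderiv ℝ f z) := by
    intro z
    ext m
    rw [iteratedFDeriv_one_apply]
    rfl
  rw [h, h, ← map_sub, LinearIsometryEquiv.norm_map]

lemma norm_iteratedFDeriv_zero_sub (f : Euc n → ℝ) (x y : Euc n) :
    ‖iteratedFDeriv ℝ 0 f x - iteratedFDeriv ℝ 0 f y‖ = |f x - f y| := by
  rw [iteratedFDeriv_zero_eq_comp, Function.comp_apply, Function.comp_apply, ← map_sub,
    LinearIsometryEquiv.norm_map, Real.norm_eq_abs]

lemma hSemiOn_le {σ C : ℝ} {Ω A : Set (Euc n)} {u : Euc n → ℝ} (hC : 0 ≤ C)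
    (h : ∀ x ∈ A, ∀ y ∈ A, x ≠ y →
      ‖iteratedFDerivWithin ℝ (hDeg σ) u Ω x - iteratedFDerivWithin ℝ (hDeg σ) u Ω y‖ ≤
        C * ‖x - y‖ ^ (σ - (hDeg σ : ℝ))) :
    hSemiOn σ Ω A u ≤ ENNReal.ofReal C := by
  refine iSup_le fun x => iSup_le fun y => ENNReal.ofReal_le_ofReal ?_
  rcases eq_or_ne (x : Euc n) y with hxy | hxy
  · rw [hxy]; simpa using hC
  · rw [div_le_iff₀ (Real.rpow_pos_of_pos (norm_pos_iff.2 (sub_ne_zero.2 hxy)) _)]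
    exact h x x.2 y y.2 hxy

lemma continuous_of_abs_sub_le {C β : ℝ} (hβ : 0 < β) {φ : Euc n → ℝ}
    (h : ∀ y y', |φ y - φ y'| ≤ C * ‖y - y'‖ ^ β) : Continuous φ := by
  refine continuous_iff_continuousAt.2 fun x => tendsto_iff_dist_tendsto_zero.2 ?_
  refine squeeze_zero (g := fun y => C * ‖y - x‖ ^ β) (fun _ => dist_nonneg)
    (fun y => by rw [Real.dist_eq]; exact h y x) ?_
  have : Continuous fun y : Euc n => C * ‖y - x‖ ^ β :=
    continuous_const.mul ((continuous_id.sub continuous_const).norm.rpow_const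
      fun _ => Or.inr hβ.le)
  simpa [Real.zero_rpow hβ.ne'] using this.tendsto x

lemma KantCond.kc {s β η : ℝ} (hβ : 0 < β) (hβ2 : β < 2) {μ ν : Measure (Euc n)}
    (h : KantCond s β μ ν η) : KC s β η μ ν := by
  intro ρ hρ φ hφ h0
  rcases hφ with ⟨hb, hφ⟩ | ⟨hb, hc, hφ⟩
  · have hd := hDeg_of_le_one hb
    refine h ρ hρ φ ?_ ?_ h0
    · rw [hd]
      have : Continuous φ := continuous_of_abs_sub_le (C := 1) hβ (by simpa using hφ)
      simpa using this
    · rw [← ENNReal.ofReal_one]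
      refine hSemiOn_le zero_le_one fun x _ y _ _ => ?_
      rw [hd, iteratedFDerivWithin_univ, norm_iteratedFDeriv_zero_sub]
      simpa using hφ x y
  · have hd := hDeg_of_lt_two hb hβ2.le
    refine h ρ hρ φ ?_ ?_ h0
    · rw [hd]; exact_mod_cast hc
    · rw [← ENNReal.ofReal_one]
      refine hSemiOn_le zero_le_one fun x _ y _ _ => ?_
      rw [hd, iteratedFDerivWithin_univ, norm_iteratedFDeriv_one_sub]
      simpa using hφ x y

/-- First-order Taylor estimate from second-difference bounds. -/
lemma taylor_of_d2 {γ Φ : ℝ} (hγ : 1 < γ) {f : Euc n → ℝ} {x h : Euc n}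
    (hf : DifferentiableAt ℝ f x)
    (H : ∀ t : ℝ, 0 < t → t ≤ 1 / 2 → |d2 f (x + t • h) (t • h)| ≤ Φ * ‖t • h‖ ^ γ) :
    |f (x + h) - f x - fderiv ℝ f x h| ≤ Φ * (1 - 2 ^ (1 - γ))⁻¹ * ‖h‖ ^ γ := by
  set e : ℕ → ℝ := fun j => 2 ^ j * (f (x + (1 / 2 : ℝ) ^ j • h) - f x) with he
  set r : ℝ := 2 ^ (1 - γ) with hr
  have hr0 : 0 < r := by positivity
  have hr1 : r < 1 := Real.rpow_lt_one_of_one_lt_of_neg (by norm_num) (by linarith)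
  have hlim : Filter.Tendsto e Filter.atTop (𝓝 (fderiv ℝ f x h)) := by
    have h1 := hf.hasFDerivAt.lim h (l := Filter.atTop) (c := fun j : ℕ => (2 : ℝ) ^ j)
      (by simpa using tendsto_pow_atTop_atTop_of_one_lt (r := (2 : ℝ)) (by norm_num))
    simpa [he] using h1
  have hΦ : 0 ≤ Φ * ‖h‖ ^ γ := by
    have := (abs_nonneg _).trans (H (1 / 2) (by norm_num) le_rfl)
    rcases eq_or_ne h 0 with rfl | h0
    · rw [norm_zero, Real.zero_rpow (by linarith)]; simp
    have h3 : 0 < ‖(1 / 2 : ℝ) • h‖ ^ γ :=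
      Real.rpow_pos_of_pos (norm_pos_iff.2 (smul_ne_zero (by norm_num) h0)) _
    have : 0 ≤ Φ := nonneg_of_mul_nonneg_left this h3
    positivity
  have hstep : ∀ j, dist (e j) (e (j + 1)) ≤ Φ * ‖h‖ ^ γ * r ^ j := by
    intro j
    have h1 := H ((1 / 2) ^ (j + 1)) (by positivity) (by
      rw [pow_succ]
      have : (1 / 2 : ℝ) ^ j ≤ 1 := pow_le_one₀ (by norm_num) (by norm_num)
      linarith)
    have h2 : x + (1 / 2 : ℝ) ^ (j + 1) • h + (1 / 2 : ℝ) ^ (j + 1) • h =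
        x + (1 / 2 : ℝ) ^ j • h := by rw [add_assoc, ← add_smul]; congr 2; ring
    rw [d2, h2, add_sub_cancel_right] at h1
    have h3 : e j - e (j + 1) = 2 ^ j * (f (x + (1 / 2 : ℝ) ^ j • h) + f x -
        2 * f (x + (1 / 2 : ℝ) ^ (j + 1) • h)) := by
      simp only [he, pow_succ]; ring
    rw [Real.dist_eq, h3, abs_mul, abs_of_pos (by positivity : (0 : ℝ) < 2 ^ j)]
    have h4 : ‖(1 / 2 : ℝ) ^ (j + 1) • h‖ ^ γ ≤ (1 / 2) ^ j * r ^ j * ‖h‖ ^ γ := by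
      rw [norm_smul, Real.mul_rpow (by positivity) (by positivity)]
      gcongr
      rw [Real.norm_of_nonneg (by positivity), ← mul_pow, ← Real.rpow_natCast,
        ← Real.rpow_mul (by norm_num), mul_comm, Real.rpow_mul (by norm_num), Real.rpow_natCast]
      have h5 : (1 / 2 : ℝ) * r = (1 / 2) ^ γ := by
        rw [hr, Real.rpow_sub (by norm_num), Real.rpow_one, Real.div_rpow (by norm_num)
          (by norm_num), Real.one_rpow]
        field_simp
      rw [h5]
      apply pow_le_pow_of_le_one (by positivity) _ (by omega)
      exact Real.rpow_le_one (by norm_num) (by norm_num) (by linarith)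
    have hΦ' : 0 ≤ Φ ∨ ‖h‖ ^ γ = 0 := by
      rcases eq_or_ne (‖h‖ ^ γ) 0 with h6 | h6
      · exact Or.inr h6
      · exact Or.inl (nonneg_of_mul_nonneg_left hΦ (lt_of_le_of_ne (by positivity) h6.symm))
    calc _ ≤ 2 ^ j * (Φ * ((1 / 2) ^ j * r ^ j * ‖h‖ ^ γ)) := by
          gcongr
          refine h1.trans ?_
          rcases hΦ' with h7 | h7
          · gcongr
          · have h8 : ‖(1 / 2 : ℝ) ^ (j + 1) • h‖ ^ γ = 0 :=
              le_antisymm (h4.trans (by rw [h7]; simp)) (by positivity)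
            rw [h8, h7]; simp
      _ = (2 * (1 / 2)) ^ j * (Φ * ‖h‖ ^ γ * r ^ j) := by rw [mul_pow]; ring
      _ = _ := by norm_num
  have := dist_le_of_le_geometric_of_tendsto₀ r _ hr1 hstep hlim
  rw [Real.dist_eq] at this
  calc _ = |e 0 - fderiv ℝ f x h| := by simp [he]
    _ ≤ _ := this
    _ = _ := by rw [div_eq_mul_inv]; ring

/-- Hölder continuity of the gradient from second-difference bounds. -/
lemma fderiv_holder_of_d2 {γ Φ : ℝ} (hγ : 1 < γ) (hΦ : 0 ≤ Φ) {f : Euc n → ℝ} {S : Set (Euc n)}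
    {p q : Euc n} (hp : DifferentiableAt ℝ f p) (hq : DifferentiableAt ℝ f q)
    (H : ∀ z ∈ S, ∀ k, |d2 f z k| ≤ Φ * ‖k‖ ^ γ) (hS : closedBall p (2 * ‖q - p‖) ⊆ S) :
    ‖fderiv ℝ f q - fderiv ℝ f p‖ ≤ Φ * (2 + 2 * (1 - 2 ^ (1 - γ))⁻¹) * ‖q - p‖ ^ (γ - 1) := by
  set δ := ‖q - p‖ with hδ
  set c : ℝ := (1 - 2 ^ (1 - γ))⁻¹ with hc
  have hc0 : 0 ≤ c := inv_nonneg.2 (by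
    have := Real.rpow_lt_one_of_one_lt_of_neg (x := 2) (z := 1 - γ) (by norm_num) (by linarith)
    linarith)
  rcases eq_or_ne p q with rfl | hpq
  · simp; positivity
  have hδ0 : 0 < δ := norm_pos_iff.2 (sub_ne_zero.2 hpq.symm)
  have key : ∀ h : Euc n, ‖h‖ = δ → |(fderiv ℝ f q - fderiv ℝ f p) h| ≤
      Φ * (2 + 2 * c) * δ ^ γ := by
    intro h hh
    have mem : ∀ z, ‖z - p‖ ≤ 2 * δ → z ∈ S := fun z hz => hS (by simpa [dist_eq_norm] using hz)
    have nt : ∀ t : ℝ, 0 < t → t ≤ 1 / 2 → ‖t • h‖ ≤ δ := fun t h0 h1 => by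
      rw [norm_smul, hh, Real.norm_of_nonneg h0.le]; nlinarith
    have t1 := taylor_of_d2 hγ hp (h := h) (Φ := Φ) fun t h0 h1 => H _ (mem _ (by
      rw [add_sub_cancel_left]; linarith [nt t h0 h1])) _
    have t2 := taylor_of_d2 hγ hq (h := h) (Φ := Φ) fun t h0 h1 => H _ (mem _ (by
      rw [show q + t • h - p = (q - p) + t • h by abel]
      exact (norm_add_le _ _).trans (by linarith [nt t h0 h1]))) _
    rw [hh] at t1 t2
    have half : ∀ z : Euc n, ‖(1 / 2 : ℝ) • z‖ = ‖z‖ / 2 := fun z => by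
      rw [norm_smul, Real.norm_of_nonneg (by norm_num)]; ring
    have hm : p + (1 / 2 : ℝ) • (h + (q - p)) ∈ S := mem _ (by
      rw [add_sub_cancel_left, half]
      have := norm_add_le h (q - p)
      linarith)
    have d1 := H _ hm ((1 / 2 : ℝ) • (h + (q - p)))
    have d2' := H _ hm ((1 / 2 : ℝ) • (h - (q - p)))
    have b1 : ‖(1 / 2 : ℝ) • (h + (q - p))‖ ^ γ ≤ δ ^ γ := by
      apply Real.rpow_le_rpow (norm_nonneg _) _ (by linarith)
      rw [half]; have := norm_add_le h (q - p); linarith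
    have b2 : ‖(1 / 2 : ℝ) • (h - (q - p))‖ ^ γ ≤ δ ^ γ := by
      apply Real.rpow_le_rpow (norm_nonneg _) _ (by linarith)
      rw [half]; have := norm_sub_le h (q - p); linarith
    have d1b := d1.trans (mul_le_mul_of_nonneg_left b1 hΦ)
    have d2b := d2'.trans (mul_le_mul_of_nonneg_left b2 hΦ)
    rw [d2, show p + (1 / 2 : ℝ) • (h + (q - p)) + (1 / 2 : ℝ) • (h + (q - p)) = q + h by
      module, add_sub_cancel_right] at d1b
    rw [d2, show p + (1 / 2 : ℝ) • (h + (q - p)) + (1 / 2 : ℝ) • (h - (q - p)) = p + h by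
      module, show p + (1 / 2 : ℝ) • (h + (q - p)) - (1 / 2 : ℝ) • (h - (q - p)) = q by
      module] at d2b
    rw [sub_apply]
    rw [abs_le] at *
    constructor <;> nlinarith [t1.1, t1.2, t2.1, t2.2, d1b.1, d1b.2, d2b.1, d2b.2]
  refine ContinuousLinearMap.opNorm_le_bound _ (by positivity) fun h => ?_
  rcases eq_or_ne h 0 with rfl | h0
  · simp
  have hn : 0 < ‖h‖ := norm_pos_iff.2 h0
  have k := key ((δ / ‖h‖) • h) (by
    rw [norm_smul, Real.norm_of_nonneg (by positivity)]; field_simp)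
  rw [map_smul, smul_eq_mul, abs_mul, abs_of_pos (by positivity)] at k
  rw [Real.norm_eq_abs]
  have e : δ ^ γ = δ ^ (γ - 1) * δ := by
    rw [Real.rpow_sub_one hδ0.ne']; field_simp
  rw [e, div_mul_eq_mul_div, div_le_iff₀ hn] at k
  refine le_of_mul_le_mul_left (a := δ) ?_ hδ0
  linarith

/-- Bounded continuous functions. -/
structure BC (F : Euc n → ℝ) : Prop where
  cont : Continuous F
  bdd : ∃ M, ∀ x, |F x| ≤ M

/-- Weighted translation average. -/
def wv (μ : Measure (Euc n)) (g F : Euc n → ℝ) (x : Euc n) : ℝ := ∫ y, F (x + y) * g y ∂μ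

/-- Translation average. -/
def cv (μ : Measure (Euc n)) (F : Euc n → ℝ) (x : Euc n) : ℝ := ∫ y, F (x + y) ∂μ

lemma wv_one (μ : Measure (Euc n)) (F : Euc n → ℝ) : wv μ (fun _ => 1) F = cv μ F := by
  funext x; simp [wv, cv]

namespace BC

variable {F G : Euc n → ℝ}

lemma exists_nonneg_bound (hF : BC F) : ∃ M, 0 ≤ M ∧ ∀ x, |F x| ≤ M := by
  obtain ⟨M, hM⟩ := hF.bdd
  exact ⟨M, (abs_nonneg _).trans (hM 0), hM⟩

lemma const (c : ℝ) : BC (fun _ : Euc n => c) := ⟨continuous_const, |c|, fun _ => le_rfl⟩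

lemma add (hF : BC F) (hG : BC G) : BC (fun x => F x + G x) := by
  obtain ⟨M, hM⟩ := hF.bdd
  obtain ⟨N, hN⟩ := hG.bdd
  exact ⟨hF.cont.add hG.cont, M + N, fun x => (abs_add_le _ _).trans (add_le_add (hM x) (hN x))⟩

lemma mul (hF : BC F) (hG : BC G) : BC (fun x => F x * G x) := by
  obtain ⟨M, hM0, hM⟩ := hF.exists_nonneg_bound
  obtain ⟨N, hN⟩ := hG.bdd
  exact ⟨hF.cont.mul hG.cont, M * N, fun x => by
    rw [abs_mul]; exact mul_le_mul (hM x) (hN x) (abs_nonneg _) hM0⟩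

lemma const_mul (c : ℝ) (hF : BC F) : BC (fun x => c * F x) := (BC.const c).mul hF

lemma neg (hF : BC F) : BC (fun x => -F x) := by simpa using hF.const_mul (-1)

lemma sub (hF : BC F) (hG : BC G) : BC (fun x => F x - G x) := by
  simpa [sub_eq_add_neg] using hF.add hG.neg

lemma pow_two (hF : BC F) : BC (fun x => F x ^ 2) := by simpa [sq] using hF.mul hF

lemma shift (hF : BC F) (h : Euc n) : BC (fun x => F (x + h)) := by
  obtain ⟨M, hM⟩ := hF.bdd
  exact ⟨hF.cont.comp (continuous_id.add continuous_const), M, fun x => hM _⟩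

lemma d2 (hF : BC F) (h : Euc n) : BC (fun x => d2 F x h) := by
  have := ((hF.shift h).add (hF.shift (-h))).sub (hF.const_mul 2)
  simpa [_root_.d2, sub_eq_add_neg] using this

lemma integrable {μ : Measure (Euc n)} [IsFiniteMeasure μ] (hF : BC F) (x : Euc n) :
    Integrable (fun y => F (x + y)) μ := by
  obtain ⟨M, hM⟩ := hF.bdd
  exact Integrable.of_bound (hF.cont.comp (continuous_const.add continuous_id)).aestronglyMeasurable
    M (Filter.Eventually.of_forall fun y => hM _)

lemma integrable_mul {μ : Measure (Euc n)} [IsFiniteMeasure μ] (hF : BC F) {g : Euc n → ℝ}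
    (hg : Measurable g) {B : ℝ} (hgB : ∀ y, |g y| ≤ B) (x : Euc n) :
    Integrable (fun y => F (x + y) * g y) μ := by
  obtain ⟨M, hM0, hM⟩ := hF.exists_nonneg_bound
  refine Integrable.of_bound ((hF.cont.comp (continuous_const.add
    continuous_id)).measurable.mul hg).aestronglyMeasurable
    (M * B) (Filter.Eventually.of_forall fun y => ?_)
  rw [Real.norm_eq_abs, abs_mul]
  exact mul_le_mul (hM _) (hgB y) (abs_nonneg _) hM0

lemma wv {μ : Measure (Euc n)} [IsFiniteMeasure μ] (hF : BC F) {g : Euc n → ℝ}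
    (hg : Measurable g) {B : ℝ} (hgB : ∀ y, |g y| ≤ B) : BC (wv μ g F) := by
  obtain ⟨M, hM0, hM⟩ := hF.exists_nonneg_bound
  have hb : ∀ x y, ‖F (x + y) * g y‖ ≤ M * B := fun x y => by
    rw [Real.norm_eq_abs, abs_mul]
    exact mul_le_mul (hM _) (hgB y) (abs_nonneg _) hM0
  refine ⟨?_, M * B * μ.real univ, fun x => ?_⟩
  · refine continuous_of_dominated (bound := fun _ => M * B)
      (fun x => (hF.integrable_mul hg hgB x).aestronglyMeasurable)
      (fun x => Filter.Eventually.of_forall (hb x)) (integrable_const _)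
      (Filter.Eventually.of_forall fun y => ?_)
    exact (hF.cont.comp (continuous_id.add continuous_const)).mul continuous_const
  · exact norm_integral_le_of_norm_le_const (Filter.Eventually.of_forall (hb x))

lemma cv {μ : Measure (Euc n)} [IsFiniteMeasure μ] (hF : BC F) : BC (cv μ F) := by
  rw [← wv_one]
  exact hF.wv measurable_const (B := 1) (by simp)

end BC

section averages

variable {μ ν : Measure (Euc n)} {F G : Euc n → ℝ}

lemma abs_cv_le [IsProbabilityMeasure ν] {M : ℝ} (hM : ∀ x, |F x| ≤ M) (x : Euc n) :
    |cv ν F x| ≤ M := by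
  simpa [cv] using norm_integral_le_of_norm_le_const (μ := ν)
    (f := fun y => F (x + y)) (Filter.Eventually.of_forall fun y => hM (x + y))

lemma cv_mono [IsFiniteMeasure ν] (hF : BC F) (hG : BC G) (h : ∀ x, F x ≤ G x) (x : Euc n) :
    cv ν F x ≤ cv ν G x :=
  integral_mono (hF.integrable x) (hG.integrable x) fun _ => h _

lemma cv_add [IsFiniteMeasure ν] (hF : BC F) (hG : BC G) (x : Euc n) :
    cv ν (fun z => F z + G z) x = cv ν F x + cv ν G x :=
  integral_add (hF.integrable x) (hG.integrable x)

lemma cv_sub [IsFiniteMeasure ν] (hF : BC F) (hG : BC G) (x : Euc n) :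
    cv ν (fun z => F z - G z) x = cv ν F x - cv ν G x :=
  integral_sub (hF.integrable x) (hG.integrable x)

lemma cv_const_mul (c : ℝ) (x : Euc n) :
    cv ν (fun z => c * F z) x = c * cv ν F x := integral_const_mul _ _

lemma cv_const [IsProbabilityMeasure ν] (c : ℝ) (x : Euc n) : cv ν (fun _ => c) x = c := by
  simp [cv]

lemma cv_shift (h x : Euc n) : cv ν (fun z => F (z + h)) x = cv ν F (x + h) := by
  simp only [cv, add_right_comm]

lemma d2_cv [IsFiniteMeasure ν] (hF : BC F) (x h : Euc n) :
    d2 (cv ν F) x h = cv ν (fun z => d2 F z h) x := by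
  have e : (fun z => d2 F z h) = fun z => (F (z + h) + F (z + -h)) - 2 * F z := by
    funext z; simp [d2, sub_eq_add_neg]
  rw [e, cv_sub ((hF.shift h).add (hF.shift (-h))) (hF.const_mul 2),
    cv_add (hF.shift h) (hF.shift (-h)), cv_const_mul, cv_shift, cv_shift, d2, sub_eq_add_neg x]

lemma wv_cv_comm [IsFiniteMeasure μ] [IsFiniteMeasure ν] (hF : BC F) {g : Euc n → ℝ}
    (hg : Measurable g) {B : ℝ} (hgB : ∀ y, |g y| ≤ B) (x : Euc n) :
    wv μ g (cv ν F) x = cv ν (wv μ g F) x := by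
  obtain ⟨M, hM0, hM⟩ := hF.exists_nonneg_bound
  simp only [wv, cv]
  simp_rw [← integral_mul_const]
  rw [integral_integral_swap]
  · simp_rw [add_right_comm]
  · refine Integrable.of_bound (C := M * B) ?_ (Filter.Eventually.of_forall fun p => ?_)
    · refine Measurable.aestronglyMeasurable ?_
      exact (hF.cont.measurable.comp (by fun_prop)).mul (hg.comp measurable_fst)
    · rw [Function.uncurry, Real.norm_eq_abs, abs_mul]
      exact mul_le_mul (hM _) (hgB _) (abs_nonneg _) hM0

lemma cv_comm [IsFiniteMeasure μ] [IsFiniteMeasure ν] (hF : BC F) (x : Euc n) :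
    cv μ (cv ν F) x = cv ν (cv μ F) x := by
  rw [← wv_one, wv_cv_comm hF measurable_const (B := 1) (by simp), wv_one]

end averages

/-- The resolvent of the generator `F ↦ ∫ (F(x+y) - F(x)) dμ(y)` is averaging against a
probability measure. -/
lemma exists_resolvent (μ : Measure (Euc n)) [IsFiniteMeasure μ] {θ : ℝ} (hθ : 0 < θ) :
    ∃ ν : Measure (Euc n), IsProbabilityMeasure ν ∧ ∀ F, BC F → ∀ x,
      cv ν F x + θ * (μ.real univ * cv ν F x - cv μ (cv ν F) x) = F x := by
  set c := μ.real univ with hc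
  have hc0 : 0 ≤ c := measureReal_nonneg
  set a : ℝ := (1 + θ * c)⁻¹ with ha
  have hpos : 0 < 1 + θ * c := by positivity
  have ha0 : 0 < a := by positivity
  obtain ⟨P, P0, PS⟩ : ∃ P : ℕ → Measure (Euc n), P 0 = Measure.dirac 0 ∧
      ∀ k, P (k + 1) = μ.conv (P k) :=
    ⟨fun k => Nat.rec (Measure.dirac 0) (fun _ m => μ.conv m) k, rfl, fun _ => rfl⟩
  have hPfin : ∀ k, IsFiniteMeasure (P k) := by
    intro k
    induction k with
    | zero => rw [P0]; infer_instance
    | succ k ih => rw [PS]; infer_instance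
  have hPmass : ∀ k, P k univ = ENNReal.ofReal (c ^ k) := by
    intro k
    induction k with
    | zero => simp [P0]
    | succ k ih =>
      rw [PS, Measure.conv, Measure.map_apply (by fun_prop) MeasurableSet.univ, preimage_univ,
        ← univ_prod_univ, Measure.prod_prod, ih, pow_succ', ENNReal.ofReal_mul hc0, hc,
        ofReal_measureReal]
  obtain ⟨ν, hν⟩ : ∃ ν : Measure (Euc n),
      ν = Measure.sum fun k => ENNReal.ofReal (a * (θ * a) ^ k) • P k := ⟨_, rfl⟩
  have hq : θ * a * c < 1 := by
    rw [ha, mul_right_comm, ← div_eq_mul_inv, div_lt_one hpos]; linarith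
  have hν1 : ν univ = 1 := by
    rw [hν, Measure.sum_apply _ MeasurableSet.univ]
    simp only [Measure.smul_apply, smul_eq_mul, hPmass]
    have : ∀ k : ℕ, ENNReal.ofReal (a * (θ * a) ^ k) * ENNReal.ofReal (c ^ k) =
        ENNReal.ofReal (a * (θ * a * c) ^ k) := fun k => by
      rw [← ENNReal.ofReal_mul (by positivity), mul_pow (θ * a)]; ring_nf
    simp_rw [this]
    rw [← ENNReal.ofReal_tsum_of_nonneg (fun k => by positivity)
      ((summable_geometric_of_lt_one (by positivity) hq).mul_left _), tsum_mul_left,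
      tsum_geometric_of_lt_one (by positivity) hq, ← ENNReal.ofReal_one]
    congr 1
    have : 1 - θ * a * c = a := by rw [ha]; field_simp; ring
    rw [this, mul_inv_cancel₀ ha0.ne']
  have hνP : IsProbabilityMeasure ν := ⟨hν1⟩
  have hid : ν = ENNReal.ofReal a • Measure.dirac 0 + ENNReal.ofReal (θ * a) • μ.conv ν := by
    have e1 : μ.conv ν = Measure.sum fun k => ENNReal.ofReal (a * (θ * a) ^ k) • P (k + 1) := by
      simp only [hν, Measure.conv]
      have : ∀ k, SFinite (ENNReal.ofReal (a * (θ * a) ^ k) • P k) := fun k => inferInstance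
      rw [Measure.prod_sum_right, Measure.map_sum (by fun_prop)]
      congr 1; funext k
      rw [Measure.prod_smul_right, Measure.map_smul, PS, Measure.conv]
    rw [e1]
    refine Measure.ext fun S hS => ?_
    rw [hν, Measure.add_apply, Measure.smul_apply, Measure.smul_apply, Measure.sum_apply _ hS,
      Measure.sum_apply _ hS, tsum_eq_zero_add' ENNReal.summable, smul_eq_mul, smul_eq_mul,
      ← ENNReal.tsum_mul_left]
    congr 1
    · simp [P0]
    · congr 1; funext k
      rw [Measure.smul_apply, Measure.smul_apply, smul_eq_mul, smul_eq_mul, ← mul_assoc,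
        ← ENNReal.ofReal_mul (by positivity)]
      congr 2; ring
  refine ⟨ν, hνP, fun F hF x => ?_⟩
  have key : cv ν F x = a * F x + θ * a * cv μ (cv ν F) x := by
    conv_lhs => rw [cv, hid]
    have i1 : Integrable (fun y => F (x + y)) (μ.conv ν) := hF.integrable x
    rw [integral_add_measure
      ((hF.integrable x).smul_measure ENNReal.ofReal_ne_top) (i1.smul_measure ENNReal.ofReal_ne_top),
      integral_smul_measure, integral_smul_measure, integral_dirac, integral_conv i1,
      ENNReal.toReal_ofReal ha0.le, ENNReal.toReal_ofReal (by positivity)]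
    simp [cv, add_assoc]
  have hac : a * (1 + θ * c) = 1 := inv_mul_cancel₀ hpos.ne'
  calc _ = (1 + θ * c) * cv ν F x - θ * cv μ (cv ν F) x := by ring
    _ = (a * (1 + θ * c)) * F x + (a * (1 + θ * c)) * θ * cv μ (cv ν F) x
        - θ * cv μ (cv ν F) x := by rw [key]; ring
    _ = _ := by rw [hac]; ring

/-- `ν` represents the resolvent of the generator with jump measure `μ`. -/
def IsRes (μ : Measure (Euc n)) (θ : ℝ) (ν : Measure (Euc n)) : Prop :=
  ∀ F, BC F → ∀ x, cv ν F x + θ * (μ.real univ * cv ν F x - cv μ (cv ν F) x) = F x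

section smoothing

variable {μ ν : Measure (Euc n)} [IsFiniteMeasure μ] [IsProbabilityMeasure ν] {θ : ℝ}

lemma IsRes.left_inverse (hν : IsRes μ θ ν) {F : Euc n → ℝ} (hF : BC F) (x : Euc n) :
    cv ν (fun z => F z + θ * (μ.real univ * F z - cv μ F z)) x = F x := by
  rw [cv_add hF (((hF.const_mul _).sub hF.cv).const_mul θ), cv_const_mul,
    cv_sub (hF.const_mul _) hF.cv, cv_const_mul, ← cv_comm hF, hν F hF]

lemma abs_cv_sub_mul_le (hθ : 0 < θ) (hν : IsRes μ θ ν) {E : Euc n → ℝ} (hE : BC E)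
    (hE1 : ∀ x, |E x| ≤ 1) {g : Euc n → ℝ} (hg : Measurable g) {B Q : ℝ} (hgB : ∀ y, |g y| ≤ B)
    (hQ : ∫ y, g y ^ 2 ∂μ ≤ Q) (x : Euc n) :
    |∫ y, (cv ν (cv ν E) (x + y) - cv ν (cv ν E) x) * g y ∂μ| ≤ (1 + Q) / (2 * √θ) := by
  set c := μ.real univ with hc
  set W := cv ν E with hWdef
  have hW : BC W := hE.cv
  have hB0 : 0 ≤ B := (abs_nonneg _).trans (hgB 0)
  have hgi : Integrable g μ := Integrable.of_bound hg.aestronglyMeasurable B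
    (Filter.Eventually.of_forall hgB)
  have hg2i : Integrable (fun y => g y ^ 2) μ := by
    refine Integrable.of_bound (hg.pow_const 2).aestronglyMeasurable (B ^ 2)
      (Filter.Eventually.of_forall fun y => ?_)
    rw [norm_pow]; exact pow_le_pow_left₀ (norm_nonneg _) (hgB y) 2
  set Γ : Euc n → ℝ := fun z => (cv μ (fun z => W z ^ 2) z - 2 * (W z * cv μ W z)) + c * W z ^ 2
    with hΓ
  have hΓBC : BC Γ := (hW.pow_two.cv.sub ((hW.mul hW.cv).const_mul 2)).add (hW.pow_two.const_mul c)
  have hsqi : ∀ z, Integrable (fun y => (W (z + y) - W z) ^ 2) μ := fun z => by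
    have : BC fun y => (W y - W z) ^ 2 := (hW.sub (BC.const _)).pow_two
    exact this.integrable z
  have hΓint : ∀ z, Γ z = ∫ y, (W (z + y) - W z) ^ 2 ∂μ := fun z => by
    have e : (fun y => (W (z + y) - W z) ^ 2) =
        fun y => (W (z + y) ^ 2 - 2 * W z * W (z + y)) + W z ^ 2 := by funext y; ring
    have i1 : Integrable (fun y => W (z + y) ^ 2) μ := hW.pow_two.integrable z
    have i2 : Integrable (fun y => 2 * W z * W (z + y)) μ := (hW.integrable z).const_mul _
    have i3 : Integrable (fun y => W (z + y) ^ 2 - 2 * W z * W (z + y)) μ := i1.sub i2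
    rw [e, integral_add i3 (integrable_const _), integral_sub i1 i2, integral_const_mul,
      integral_const, smul_eq_mul]
    simp only [hΓ, cv, hc]
    ring
  have step1 : θ * cv ν Γ x ≤ 1 := by
    have hw2 := hW.pow_two
    have hBW : BC (fun z => W z ^ 2 + θ * (c * W z ^ 2 - cv μ (fun z => W z ^ 2) z)) :=
      hw2.add (((hw2.const_mul _).sub hw2.cv).const_mul θ)
    have hle : ∀ z, θ * Γ z ≤
        1 - (W z ^ 2 + θ * (c * W z ^ 2 - cv μ (fun z => W z ^ 2) z)) := by
      intro z
      have h1 : W z + θ * (c * W z - cv μ W z) = E z := hν E hE z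
      have h2 : E z ^ 2 ≤ 1 := by
        rw [← sq_abs]; exact pow_le_one₀ (abs_nonneg _) (hE1 z)
      have h3 : 2 * W z * E z - W z ^ 2 ≤ E z ^ 2 := by nlinarith [sq_nonneg (W z - E z)]
      have h4 : θ * Γ z = 2 * W z * (W z + θ * (c * W z - cv μ W z)) - W z ^ 2 -
          (W z ^ 2 + θ * (c * W z ^ 2 - cv μ (fun z => W z ^ 2) z)) := by
        simp only [hΓ]; ring
      rw [h4, h1]; linarith
    have h5 := cv_mono (ν := ν) (hΓBC.const_mul θ) ((BC.const 1).sub hBW) hle x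
    rw [cv_const_mul, cv_sub (BC.const 1) hBW, cv_const, hν.left_inverse hw2] at h5
    nlinarith [sq_nonneg (W x)]
  set J : Euc n → ℝ := fun z => wv μ g W z - (∫ y, g y ∂μ) * W z with hJ
  have hJBC : BC J := (hW.wv hg hgB).sub (hW.const_mul _)
  have hJint : ∀ (V : Euc n → ℝ), BC V → ∀ z,
      ∫ y, (V (z + y) - V z) * g y ∂μ = wv μ g V z - (∫ y, g y ∂μ) * V z := fun V hV z => by
    simp_rw [sub_mul]
    rw [integral_sub (hV.integrable_mul hg hgB z) (hgi.const_mul _), integral_const_mul, wv,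
      mul_comm (V z)]
  set t := √θ with ht
  have ht0 : 0 < t := Real.sqrt_pos.2 hθ
  have hJle : ∀ z, |J z| ≤ t / 2 * Γ z + Q / (2 * t) := by
    intro z
    have hpt : ∀ y, |(W (z + y) - W z) * g y| ≤
        t / 2 * (W (z + y) - W z) ^ 2 + 1 / (2 * t) * g y ^ 2 := fun y => by
      rw [abs_le]
      set p := W (z + y) - W z
      set q := g y
      have h1 : 0 ≤ (t * p + q) ^ 2 / (2 * t) := by positivity
      have h2 : 0 ≤ (t * p - q) ^ 2 / (2 * t) := by positivity
      have e1 : (t * p + q) ^ 2 / (2 * t) = t / 2 * p ^ 2 + 1 / (2 * t) * q ^ 2 + p * q := by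
        field_simp; ring
      have e2 : (t * p - q) ^ 2 / (2 * t) = t / 2 * p ^ 2 + 1 / (2 * t) * q ^ 2 - p * q := by
        field_simp; ring
      constructor <;> linarith
    have h1 : |J z| ≤ ∫ y, (t / 2 * (W (z + y) - W z) ^ 2 + 1 / (2 * t) * g y ^ 2) ∂μ := by
      simp only [hJ]
      rw [← hJint W hW z]
      have i3 : Integrable (fun y => t / 2 * (W (z + y) - W z) ^ 2 + 1 / (2 * t) * g y ^ 2) μ :=
        ((hsqi z).const_mul _).add (hg2i.const_mul _)
      exact norm_integral_le_of_norm_le (f := fun y => (W (z + y) - W z) * g y) i3 (Filter.Eventually.of_forall hpt)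
    rw [integral_add ((hsqi z).const_mul _) (hg2i.const_mul _), integral_const_mul,
      integral_const_mul, ← hΓint] at h1
    refine h1.trans ?_
    gcongr
    calc _ ≤ 1 / (2 * t) * Q := by gcongr
      _ = _ := by ring
  have hcomm : ∫ y, (cv ν W (x + y) - cv ν W x) * g y ∂μ = cv ν J x := by
    rw [hJint _ hW.cv, wv_cv_comm hW hg hgB]
    simp only [hJ]
    rw [cv_sub (hW.wv hg hgB) (hW.const_mul _), cv_const_mul]
  have hMBC : BC (fun z => t / 2 * Γ z + Q / (2 * t)) := (hΓBC.const_mul _).add (BC.const _)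
  have hup := cv_mono (ν := ν) hJBC hMBC (fun z => (le_abs_self _).trans (hJle z)) x
  have hdn := cv_mono (ν := ν) hMBC.neg hJBC (fun z => by linarith [neg_abs_le (J z), hJle z]) x
  have hval : cv ν (fun z => t / 2 * Γ z + Q / (2 * t)) x ≤ (1 + Q) / (2 * t) := by
    rw [cv_add (hΓBC.const_mul _) (BC.const _), cv_const_mul, cv_const]
    have h1 : t / 2 * cv ν Γ x ≤ 1 / (2 * t) := by
      rw [le_div_iff₀ (by positivity)]
      have : θ = t * t := (Real.mul_self_sqrt hθ.le).symm
      rw [this] at step1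
      linarith
    rw [add_div]; linarith
  have hneg : cv ν (fun z => -(t / 2 * Γ z + Q / (2 * t))) x =
      -cv ν (fun z => t / 2 * Γ z + Q / (2 * t)) x := integral_neg _
  rw [hcomm, abs_le]
  constructor <;> linarith

end smoothing

lemma abs_d2_le_of_fderiv {f : Euc n → ℝ} {x k : Euc n} {L α : ℝ} (hL : 0 ≤ L) (hα : 0 ≤ α)
    (hα1 : α ≤ 1) (hf : ∀ p ∈ closedBall x ‖k‖, DifferentiableAt ℝ f p)
    (hD : ∀ p ∈ closedBall x ‖k‖, ∀ q ∈ closedBall x ‖k‖,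
      ‖fderiv ℝ f p - fderiv ℝ f q‖ ≤ L * ‖p - q‖ ^ α) :
    |d2 f x k| ≤ 2 * L * ‖k‖ ^ (1 + α) := by
  have hk : 0 ≤ ‖k‖ := norm_nonneg k
  have m1 : ∀ z ∈ closedBall (0 : Euc n) ‖k‖, x + z ∈ closedBall x ‖k‖ := fun z hz => by
    simpa [dist_eq_norm] using hz
  have m2 : ∀ z ∈ closedBall (0 : Euc n) ‖k‖, x - z ∈ closedBall x ‖k‖ := fun z hz => by
    simpa [dist_eq_norm] using hz
  have h1 : ∀ z ∈ closedBall (0 : Euc n) ‖k‖, HasFDerivWithinAt (fun z => f (x + z) + f (x - z))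
      (fderiv ℝ f (x + z) - fderiv ℝ f (x - z)) (closedBall 0 ‖k‖) z := by
    intro z hz
    have a1 := (hf _ (m1 z hz)).hasFDerivAt.comp z ((hasFDerivAt_id z).const_add x)
    have a2 := (hf _ (m2 z hz)).hasFDerivAt.comp z ((hasFDerivAt_id z).const_sub x)
    have := (a1.add a2).hasFDerivWithinAt (s := closedBall 0 ‖k‖)
    have e : fderiv ℝ f (x + z) - fderiv ℝ f (x - z) =
        (fderiv ℝ f (x + z)).comp (ContinuousLinearMap.id ℝ (Euc n)) +
        (fderiv ℝ f (x - z)).comp (-ContinuousLinearMap.id ℝ (Euc n)) := by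
      ext v; simp [sub_eq_add_neg]
    rw [e]
    exact this
  have h2 : ∀ z ∈ closedBall (0 : Euc n) ‖k‖,
      ‖fderiv ℝ f (x + z) - fderiv ℝ f (x - z)‖ ≤ 2 * L * ‖k‖ ^ α := by
    intro z hz
    refine (hD _ (m1 z hz) _ (m2 z hz)).trans ?_
    have hz' : ‖z‖ ≤ ‖k‖ := by simpa using hz
    have e : ‖x + z - (x - z)‖ ≤ 2 * ‖k‖ := by
      rw [show x + z - (x - z) = z + z by abel]
      exact (norm_add_le _ _).trans (by linarith)
    calc L * ‖x + z - (x - z)‖ ^ α ≤ L * (2 * ‖k‖) ^ α := by gcongr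
      _ ≤ L * (2 * ‖k‖ ^ α) := by
        rw [Real.mul_rpow (by norm_num) hk]
        gcongr
        calc (2 : ℝ) ^ α ≤ 2 ^ (1 : ℝ) := Real.rpow_le_rpow_of_exponent_le (by norm_num) hα1
          _ = 2 := by norm_num
      _ = _ := by ring
  have h3 := (convex_closedBall (0 : Euc n) ‖k‖).norm_image_sub_le_of_norm_hasFDerivWithin_le h1 h2
    (x := 0) (y := k) (by simp) (by simp)
  rw [Real.norm_eq_abs] at h3
  calc _ = |f (x + k) + f (x - k) - (f (x + 0) + f (x - 0))| := by
        rw [d2, add_zero, sub_zero, two_mul]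
    _ ≤ _ := h3
    _ = _ := by
      rw [sub_zero, Real.rpow_add_of_nonneg hk zero_le_one hα, Real.rpow_one]; ring

lemma exists_lipschitz_fderiv {f : Euc n → ℝ} (hf : ContDiff ℝ 2 f) (hs : HasCompactSupport f) :
    ∃ L, 0 < L ∧ ∀ p q, ‖fderiv ℝ f p - fderiv ℝ f q‖ ≤ L * ‖p - q‖ := by
  have h1 : ContDiff ℝ 1 (fderiv ℝ f) := hf.fderiv_right (by norm_num)
  obtain ⟨C, hC⟩ := h1.lipschitzWith_of_hasCompactSupport (hs.fderiv ℝ) one_ne_zero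
  refine ⟨C + 1, by positivity, fun p q => ?_⟩
  have := hC.dist_le_mul p q
  rw [dist_eq_norm, dist_eq_norm] at this
  nlinarith [norm_nonneg (p - q)]

lemma exists_d2_le_sq {f : Euc n → ℝ} (hf : ContDiff ℝ 2 f) (hs : HasCompactSupport f) :
    ∃ L, 0 < L ∧ ∀ x k, |d2 f x k| ≤ L * ‖k‖ ^ 2 := by
  obtain ⟨L, hL, h⟩ := exists_lipschitz_fderiv hf hs
  refine ⟨2 * L, by positivity, fun x k => ?_⟩
  have := abs_d2_le_of_fderiv (f := f) (x := x) (k := k) hL.le zero_le_one le_rfl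
    (fun p _ => (hf.differentiable (by norm_num)) p) (fun p _ q _ => by simpa using h p q)
  norm_num at this
  exact this

lemma exists_mollifier (n : ℕ) {γ a : ℝ} (hγ : 0 < γ) (hγ2 : γ ≤ 2) (ha : 0 < a) :
    ∃ M : Measure (Euc n), IsProbabilityMeasure M ∧ (∀ v, BC v → ContDiff ℝ 2 (cv M v)) ∧
      ∃ N, 0 < N ∧ ∀ v, BC v → (∀ x k, |d2 v x k| ≤ ‖k‖ ^ γ) →
        (∀ x, |v x - cv M v x| ≤ a ^ γ) ∧ ∀ x k, |d2 (cv M v) x k| ≤ N * ‖k‖ ^ 2 := by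
  let φ : ContDiffBump (0 : Euc n) := ⟨a / 2, a, by positivity, by linarith⟩
  set ψ : Euc n → ℝ := φ.normed volume with hψ
  have hψ0 : ∀ y, 0 ≤ ψ y := φ.nonneg_normed
  have hψc : ContDiff ℝ 2 ψ := φ.contDiff_normed
  have hψs : HasCompactSupport ψ := φ.hasCompactSupport_normed
  have hψneg : ∀ y, ψ (-y) = ψ y := φ.normed_neg
  have hψsupp : ∀ y, a ≤ ‖y‖ → ψ y = 0 := fun y hy => by
    by_contra h
    have : y ∈ Function.support ψ := h
    rw [hψ, φ.support_normed_eq] at this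
    simp [φ] at this
    linarith
  have hψi : Integrable ψ := φ.integrable_normed
  have hψ1 : ∫ y, ψ y = 1 := φ.integral_normed
  let M : Measure (Euc n) := volume.withDensity fun y => ENNReal.ofReal (ψ y)
  have hM : IsProbabilityMeasure M := ⟨by
    rw [withDensity_apply _ MeasurableSet.univ, Measure.restrict_univ,
      ← ofReal_integral_eq_lintegral_ofReal hψi (Filter.Eventually.of_forall hψ0), hψ1,
      ENNReal.ofReal_one]⟩
  have hcv : ∀ F x, cv M F x = ∫ y, F (x + y) * ψ y := fun F x => by
    rw [cv, integral_withDensity_eq_integral_toReal_smul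
      (hψc.continuous.measurable.ennreal_ofReal) (by simp)]
    refine integral_congr_ae (Filter.Eventually.of_forall fun y => ?_)
    simp [ENNReal.toReal_ofReal (hψ0 y), mul_comm]
  obtain ⟨L, hL, hLb⟩ := exists_d2_le_sq hψc hψs
  have hint : ∀ v, BC v → ∀ x, ∀ p : Euc n → ℝ, Continuous p → HasCompactSupport p →
      Integrable fun y => v (x + y) * p y := fun v hv x p hp hps => by
    refine Continuous.integrable_of_hasCompactSupport ?_ hps.mul_left
    exact (hv.cont.comp (continuous_const.add continuous_id)).mul hp
  have heven : ∀ v, BC v → ∀ x, ∀ p : Euc n → ℝ, Continuous p → HasCompactSupport p →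
      (∀ y, p (-y) = p y) →
      (∫ y, v (x + y) * p y) - v x * ∫ y, p y = 1 / 2 * ∫ y, d2 v x y * p y := by
    intro v hv x p hp hps hpe
    have e1 : ∫ y, v (x - y) * p y = ∫ y, v (x + y) * p y := by
      rw [← integral_neg_eq_self]
      simp [hpe, sub_eq_add_neg]
    have i1 := hint v hv x p hp hps
    have i2 : Integrable fun y => v (x - y) * p y := by
      have := i1.comp_neg
      simpa [hpe, sub_eq_add_neg] using this
    have i3 : Integrable p := hp.integrable_of_hasCompactSupport hps
    have i4 : Integrable fun y => v (x + y) * p y + v (x - y) * p y := i1.add i2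
    have e2 : (fun y => d2 v x y * p y) =
        fun y => (v (x + y) * p y + v (x - y) * p y) - 2 * v x * p y := by
      funext y; simp only [d2]; ring
    rw [e2, integral_sub i4 (i3.const_mul _), integral_add i1 i2, integral_const_mul, e1]
    ring
  refine ⟨M, hM, fun v hv => ?_, 1 + L * (a + 1) ^ γ *
    volume.real (closedBall (0 : Euc n) (a + 1)), by positivity, fun v hv hd => ⟨fun x => ?_, ?_⟩⟩
  · have h := hψs.contDiff_convolution_left (n := 2) (ContinuousLinearMap.lsmul ℝ ℝ) hψc
      (hv.cont.locallyIntegrable (μ := volume))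
    have e : cv M v = convolution ψ v (ContinuousLinearMap.lsmul ℝ ℝ) volume := by
      funext x
      rw [hcv, convolution_def, ← integral_neg_eq_self]
      simp [hψneg, mul_comm, sub_eq_add_neg]
    rw [e]; exact h
  · have h := heven v hv x ψ hψc.continuous hψs hψneg
    rw [hψ1, ← hcv] at h
    have h2 : |∫ y, d2 v x y * ψ y| ≤ ∫ y, a ^ γ * ψ y := by
      refine norm_integral_le_of_norm_le (f := fun y => d2 v x y * ψ y) (hψi.const_mul _)
        (Filter.Eventually.of_forall fun y => ?_)
      rw [Real.norm_eq_abs, abs_mul, abs_of_nonneg (hψ0 y)]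
      rcases le_or_gt a ‖y‖ with hy | hy
      · simp [hψsupp y hy]
      · exact mul_le_mul_of_nonneg_right ((hd x y).trans
          (Real.rpow_le_rpow (norm_nonneg _) hy.le hγ.le)) (hψ0 y)
    rw [integral_const_mul, hψ1] at h2
    have ha' : 0 ≤ a ^ γ := by positivity
    rw [abs_le] at *
    constructor <;> linarith
  · intro x k
    rcases le_or_gt ‖k‖ 1 with hk | hk
    · set p : Euc n → ℝ := fun y => d2 ψ y k with hp
      have hpc : Continuous p := by
        have := hψc.continuous
        simp only [hp, d2]; fun_prop
      have hp0 : ∀ y, a + 1 < ‖y‖ → p y = 0 := fun y hy => by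
        have n1 : a ≤ ‖y + k‖ := by have := norm_sub_le (y + k) k; simp at this; linarith
        have n2 : a ≤ ‖y - k‖ := by have := norm_add_le (y - k) k; simp at this; linarith
        simp [hp, d2, hψsupp _ n1, hψsupp _ n2, hψsupp y (by linarith)]
      have hps : HasCompactSupport p := HasCompactSupport.intro
        (isCompact_closedBall (0 : Euc n) (a + 1)) fun y hy => hp0 y (by simpa using hy)
      have hpe : ∀ y, p (-y) = p y := fun y => by
        simp only [hp, d2]
        rw [show -y + k = -(y - k) by abel, show -y - k = -(y + k) by abel, hψneg, hψneg, hψneg]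
        ring
      have t1 : ∀ w : Euc n, ∀ b : Euc n, ∫ y, v (w + y) * ψ (y + b) =
          ∫ y, v (w - b + y) * ψ y := fun w b => by
        rw [← integral_add_right_eq_self (μ := volume) (fun y => v (w - b + y) * ψ y) b]
        refine integral_congr_ae (Filter.Eventually.of_forall fun y => ?_)
        simp only
        congr 2; abel
      have i1 : Integrable ψ := hψi
      have ib : ∀ b : Euc n, Integrable fun y => ψ (y + b) := fun b => hψi.comp_add_right b
      have isupp : ∀ b : Euc n, HasCompactSupport fun y => ψ (y + b) := fun b =>
        hψs.comp_homeomorph (Homeomorph.addRight b)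
      have ivb : ∀ b : Euc n, Integrable fun y => v (x + y) * ψ (y + b) := fun b =>
        hint v hv x _ (hψc.continuous.comp (continuous_id.add continuous_const)) (isupp b)
      have ep : p = fun y => (ψ (y + k) + ψ (y + -k)) - 2 * ψ y := by
        funext y; simp [hp, d2, sub_eq_add_neg]
      have eint : ∫ y, p y = 0 := by
        have j : Integrable fun y => ψ (y + k) + ψ (y + -k) := (ib k).add (ib (-k))
        rw [ep, integral_sub j (hψi.const_mul 2), integral_add (ib k) (ib (-k)),
          integral_const_mul, integral_add_right_eq_self ψ, integral_add_right_eq_self ψ]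
        ring
      have ed : d2 (cv M v) x k = ∫ y, v (x + y) * p y := by
        have e2 : (fun y => v (x + y) * p y) = fun y =>
            (v (x + y) * ψ (y + k) + v (x + y) * ψ (y + -k)) - 2 * (v (x + y) * ψ y) := by
          rw [ep]; funext y; ring
        have j : Integrable fun y => v (x + y) * ψ (y + k) + v (x + y) * ψ (y + -k) :=
          (ivb k).add (ivb (-k))
        have j0 : Integrable fun y => v (x + y) * ψ y := by simpa using ivb 0
        rw [e2, integral_sub j (j0.const_mul 2), integral_add (ivb k) (ivb (-k)),
          integral_const_mul, t1, t1, d2, hcv, hcv, hcv, sub_neg_eq_add]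
        ring
      have h := heven v hv x p hpc hps hpe
      rw [eint, mul_zero, sub_zero, ← ed] at h
      have h2 : |∫ y, d2 v x y * p y| ≤ ∫ y in closedBall (0 : Euc n) (a + 1),
          (a + 1) ^ γ * (L * ‖k‖ ^ 2) := by
        rw [← setIntegral_eq_integral_of_forall_compl_eq_zero
          (s := closedBall (0 : Euc n) (a + 1)) (fun y hy => by
            rw [hp0 y (by simpa using hy), mul_zero])]
        refine norm_integral_le_of_norm_le (f := fun y => d2 v x y * p y) (by
          exact integrableOn_const measure_closedBall_lt_top.ne) ?_
        filter_upwards [ae_restrict_mem measurableSet_closedBall] with y hy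
        rw [Real.norm_eq_abs, abs_mul]
        have hy' : ‖y‖ ≤ a + 1 := by simpa using hy
        refine mul_le_mul ((hd x y).trans (Real.rpow_le_rpow (norm_nonneg _) hy' hγ.le)) (hLb y k)
          (abs_nonneg _) (by positivity)
      rw [setIntegral_const, smul_eq_mul] at h2
      rw [h, abs_mul, abs_of_pos (by norm_num)]
      have h3 : 0 ≤ volume.real (closedBall (0 : Euc n) (a + 1)) * ((a + 1) ^ γ * (L * ‖k‖ ^ 2)) := by
        positivity
      have h4 : 0 ≤ ‖k‖ ^ 2 := by positivity
      nlinarith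
    · have hb : ∀ z, |d2 v z k| ≤ ‖k‖ ^ γ := fun z => hd z k
      rw [d2_cv hv]
      refine (abs_cv_le hb x).trans ?_
      calc ‖k‖ ^ γ ≤ ‖k‖ ^ (2 : ℝ) := Real.rpow_le_rpow_of_exponent_le hk.le hγ2
        _ = ‖k‖ ^ 2 := by norm_num
        _ ≤ _ := le_mul_of_one_le_left (by positivity) (le_add_of_nonneg_right (by positivity))

lemma exists_rpow_le {p δ r : ℝ} (hp : 0 < p) (hδ : 0 < δ) (hr : 0 < r) :
    ∃ ε, 0 < ε ∧ ε ≤ r ∧ ε ^ p ≤ δ := by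
  refine ⟨min r (δ ^ p⁻¹), by positivity, min_le_left _ _, ?_⟩
  calc (min r (δ ^ p⁻¹)) ^ p ≤ (δ ^ p⁻¹) ^ p :=
        Real.rpow_le_rpow (by positivity) (min_le_right _ _) hp.le
    _ = δ := Real.rpow_inv_rpow hδ.le hp.ne'

lemma exists_two_pow_mul_rpow_le {q δ r ε : ℝ} (hq : q < 0) (hδ : 0 < δ) (hε : 0 < ε) :
    ∃ J : ℕ, r ≤ 2 ^ J * ε ∧ (2 ^ J * ε) ^ q ≤ δ := by
  obtain ⟨J, hJ⟩ := pow_unbounded_of_one_lt (max r (δ ^ q⁻¹) / ε) (one_lt_two (α := ℝ))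
  rw [div_lt_iff₀ hε] at hJ
  refine ⟨J, (le_max_left _ _).trans hJ.le, ?_⟩
  calc (2 ^ J * ε) ^ q ≤ (δ ^ q⁻¹) ^ q :=
        Real.rpow_le_rpow_of_nonpos (by positivity) ((le_max_right _ _).trans hJ.le) hq.le
    _ = δ := Real.rpow_inv_rpow hδ.le hq.ne

lemma KC.mono {s β η η' : ℝ} {μ ν : Measure (Euc n)} (h : KC s β η μ ν) (hη : η ≤ η') :
    KC s β η' μ ν := fun ρ hρ φ hφ h0 =>
  (h ρ hρ φ hφ h0).trans (mul_le_mul_of_nonneg_right hη (by positivity))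

lemma integrableOn_and_abs_le {K : Measure (Euc n)} {S : Set (Euc n)} (hS : MeasurableSet S)
    {φ g : Euc n → ℝ} {p B : ℝ} (hp : 0 ≤ p) (hB : 0 ≤ B)
    (hφ : AEStronglyMeasurable φ (K.restrict S))
    (h : ∀ y ∈ S, |φ y| ≤ p * g y) (hg : ∫⁻ y in S, ENNReal.ofReal (g y) ∂K ≤ ENNReal.ofReal B) :
    IntegrableOn φ S K ∧ |∫ y in S, φ y ∂K| ≤ p * B := by
  have key : ∫⁻ y in S, ENNReal.ofReal ‖φ y‖ ∂K ≤ ENNReal.ofReal (p * B) := by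
    calc _ ≤ ∫⁻ y in S, ENNReal.ofReal p * ENNReal.ofReal (g y) ∂K := by
          refine setLIntegral_mono' hS fun y hy => ?_
          rw [← ENNReal.ofReal_mul hp]
          exact ENNReal.ofReal_le_ofReal (h y hy)
      _ = ENNReal.ofReal p * ∫⁻ y in S, ENNReal.ofReal (g y) ∂K :=
          lintegral_const_mul' _ _ ENNReal.ofReal_ne_top
      _ ≤ ENNReal.ofReal p * ENNReal.ofReal B := by gcongr
      _ = _ := (ENNReal.ofReal_mul hp).symm
  refine ⟨⟨hφ, ?_⟩, ?_⟩
  · rw [hasFiniteIntegral_iff_norm]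
    exact key.trans_lt ENNReal.ofReal_lt_top
  · rw [← Real.norm_eq_abs]
    refine (norm_integral_le_lintegral_norm _).trans ?_
    exact ENNReal.toReal_le_of_le_ofReal (by positivity) key

lemma d2_zero (w : Euc n → ℝ) (x : Euc n) : d2 w x 0 = 0 := by
  simp only [d2, add_zero, sub_zero]; ring

lemma hasFDerivAt_d2 {w : Euc n → ℝ} (hw : ContDiff ℝ 1 w) (x z : Euc n) :
    HasFDerivAt (fun y => d2 w x y) (fderiv ℝ w (x + z) - fderiv ℝ w (x - z)) z := by
  have hd := hw.differentiable one_ne_zero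
  have a1 := (hd (x + z)).hasFDerivAt.comp z ((hasFDerivAt_id z).const_add x)
  have a2 := (hd (x - z)).hasFDerivAt.comp z ((hasFDerivAt_id z).const_sub x)
  have e : fderiv ℝ w (x + z) - fderiv ℝ w (x - z) =
      (fderiv ℝ w (x + z)).comp (ContinuousLinearMap.id ℝ (Euc n)) +
      (fderiv ℝ w (x - z)).comp (-ContinuousLinearMap.id ℝ (Euc n)) := by
    ext v; simp [sub_eq_add_neg]
  rw [e]
  exact (a1.add a2).sub_const (2 * w x)

/-- Second differences are, on balls, multiples of admissible test functions. -/
lemma exists_test_function (n : ℕ) {β γ N ρ : ℝ} (hβ : 0 < β) (hβγ : β ≤ 1 ∨ γ = β)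
    (hN : 0 < N) (hρ : 0 < ρ) :
    ∃ A > 0, ∀ w : Euc n → ℝ, ContDiff ℝ 1 w → (∀ x k, |d2 w x k| ≤ ‖k‖ ^ γ) →
      (∀ x k, |d2 w x k| ≤ N * ‖k‖ ^ 2) → ∀ x, ∃ ψ, HE β ψ ∧ ψ 0 = 0 ∧
        ∀ y ∈ ball (0 : Euc n) (2 * ρ), d2 w x y = A * ψ y := by
  rcases le_or_gt β 1 with hb | hb
  · set L : ℝ := N * (2 + 2 * (1 - 2 ^ (1 - (2 : ℝ)))⁻¹) * (4 * ρ) with hL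
    have hL0 : 0 < L := by rw [hL]; norm_num; positivity
    set B : ℝ := N * (2 * ρ) ^ 2 with hB
    have hB0 : 0 < B := by positivity
    refine ⟨L + 2 * B, by positivity, fun w hw _ hwN x => ?_⟩
    set A := L + 2 * B with hA
    have hA0 : 0 < A := by positivity
    have hd := hw.differentiable one_ne_zero
    have hlip : LipschitzOnWith L.toNNReal (fun y => d2 w x y) (ball (0 : Euc n) (2 * ρ)) := by
      refine LipschitzOnWith.of_dist_le_mul fun y hy z hz => ?_
      rw [dist_eq_norm, dist_eq_norm, Real.coe_toNNReal _ hL0.le]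
      refine (convex_ball (0 : Euc n) (2 * ρ)).norm_image_sub_le_of_norm_hasFDerivWithin_le
        (fun t _ => (hasFDerivAt_d2 hw x t).hasFDerivWithinAt) (fun t ht => ?_) hz hy
      have := fderiv_holder_of_d2 (γ := 2) (Φ := N) (S := univ) one_lt_two hN.le (hd (x - t))
        (hd (x + t)) (fun z _ k => by simpa using hwN z k) (subset_univ _)
      refine this.trans ?_
      rw [hL]
      have ht' : ‖t‖ < 2 * ρ := by simpa using ht
      have : ‖x + t - (x - t)‖ ≤ 4 * ρ := by
        rw [show x + t - (x - t) = t + t by abel]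
        exact (norm_add_le _ _).trans (by linarith)
      have e : ‖x + t - (x - t)‖ ^ ((2 : ℝ) - 1) = ‖x + t - (x - t)‖ := by norm_num
      rw [e]
      gcongr
    obtain ⟨g, hg, hgeq⟩ := hlip.extend_real
    have hglip : ∀ y z, |g y - g z| ≤ L * ‖y - z‖ := fun y z => by
      have := hg.dist_le_mul y z
      rwa [dist_eq_norm, dist_eq_norm, Real.coe_toNNReal _ hL0.le] at this
    have hd0 := d2_zero w x
    refine ⟨fun y => A⁻¹ * max (-B) (min B (g y)), Or.inl ⟨hb, fun y z => ?_⟩, ?_, fun y hy => ?_⟩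
    · rw [← mul_sub, abs_mul, abs_of_pos (inv_pos.2 hA0), inv_mul_le_iff₀ hA0]
      have h1 : |max (-B) (min B (g y)) - max (-B) (min B (g z))| ≤ L * ‖y - z‖ :=
        by
        rw [max_comm (-B), max_comm (-B)]
        refine (abs_max_sub_max_le_abs _ _ _).trans (le_trans ?_ (hglip y z))
        simpa using abs_min_sub_min_le_max B (g y) B (g z)
      have h2 : |max (-B) (min B (g y)) - max (-B) (min B (g z))| ≤ 2 * B := by
        rw [abs_le]
        have a1 := le_max_left (-B) (min B (g y))
        have a2 := le_max_left (-B) (min B (g z))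
        have a3 : max (-B) (min B (g y)) ≤ B := max_le (by linarith) (min_le_left _ _)
        have a4 : max (-B) (min B (g z)) ≤ B := max_le (by linarith) (min_le_left _ _)
        constructor <;> linarith
      rcases le_or_gt ‖y - z‖ 1 with h | h
      · calc _ ≤ L * ‖y - z‖ := h1
          _ ≤ A * ‖y - z‖ := by gcongr; linarith
          _ ≤ A * ‖y - z‖ ^ β := by
            gcongr
            exact Real.self_le_rpow_of_le_one (norm_nonneg _) h hb
      · calc _ ≤ 2 * B := h2
          _ ≤ A * 1 := by linarith
          _ ≤ A * ‖y - z‖ ^ β := by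
            gcongr
            exact Real.one_le_rpow h.le hβ.le
    · have : g 0 = 0 := (hgeq (by simpa using hρ)).symm.trans hd0
      simp [this, hB0.le]
    · have h1 := hgeq hy
      have h2 : |g y| ≤ B := by
        rw [← h1]
        refine (hwN x y).trans ?_
        have : ‖y‖ < 2 * ρ := by simpa using hy
        rw [hB]; gcongr
      rw [abs_le] at h2
      simp only
      rw [min_eq_right h2.2, max_eq_right h2.1, mul_inv_cancel_left₀ hA0.ne']
      exact h1
  · have hγ : γ = β := hβγ.resolve_left (by linarith)
    subst hγ
    set c : ℝ := 1 * (2 + 2 * (1 - 2 ^ (1 - γ))⁻¹) with hc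
    have hc0 : 0 < c := by
      have := Real.rpow_lt_one_of_one_lt_of_neg (x := 2) (z := 1 - γ) (by norm_num) (by linarith)
      have : 0 ≤ (1 - (2 : ℝ) ^ (1 - γ))⁻¹ := inv_nonneg.2 (by linarith)
      positivity
    refine ⟨2 * c, by positivity, fun w hw hwγ _ x => ?_⟩
    have hd := hw.differentiable one_ne_zero
    have hol : ∀ p q, ‖fderiv ℝ w q - fderiv ℝ w p‖ ≤ c * ‖q - p‖ ^ (γ - 1) := fun p q =>
      fderiv_holder_of_d2 hb zero_le_one (hd p) (hd q)
        (S := univ) (fun z _ k => by simpa using hwγ z k) (subset_univ _)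
    have hder : ∀ y, HasFDerivAt (fun y => (2 * c)⁻¹ * d2 w x y)
        ((2 * c)⁻¹ • (fderiv ℝ w (x + y) - fderiv ℝ w (x - y))) y := fun y =>
      (hasFDerivAt_d2 hw x y).const_mul _
    refine ⟨fun y => (2 * c)⁻¹ * d2 w x y, Or.inr ⟨hb, ?_, fun y z => ?_⟩, by simp [d2_zero],
      fun y _ => (mul_inv_cancel_left₀ (by positivity) _).symm⟩
    · simp only [d2]
      fun_prop
    · rw [(hder y).fderiv, (hder z).fderiv, ← smul_sub, norm_smul, Real.norm_of_nonneg
        (by positivity), inv_mul_le_iff₀ (by positivity)]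
      have h1 := hol (x + z) (x + y)
      have h2 := hol (x - z) (x - y)
      rw [add_sub_add_left_eq_sub] at h1
      rw [sub_sub_sub_cancel_left, norm_sub_rev z y] at h2
      calc _ = ‖(fderiv ℝ w (x + y) - fderiv ℝ w (x + z)) -
              (fderiv ℝ w (x - y) - fderiv ℝ w (x - z))‖ := by congr 1; abel
        _ ≤ _ := (norm_sub_le _ _).trans (by linarith)

lemma continuous_d2 {w : Euc n → ℝ} (hw : Continuous w) (x : Euc n) :
    Continuous fun y => d2 w x y := by
  unfold d2; fun_prop

/-- A far-field truncation of the operators with kernels `K` and `K₀` are close on functions with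
controlled second differences. -/
lemma exists_error_bound (n : ℕ) {s β γ lam Lam N κ r₁ r₂ : ℝ} (hs : s ∈ Ioo (0 : ℝ) 1)
    (hLam : 0 < Lam) (hβ : 0 < β) (hγ0 : 0 < γ) (hγ : γ < 2 * s) (hβγ : β ≤ 1 ∨ γ = β)
    (hN : 0 < N) (hκ : 0 < κ) (hr₁ : 0 < r₁) :
    ∃ ε R, 0 < ε ∧ ε ≤ r₁ ∧ r₂ ≤ R ∧ ∃ η > 0, ∀ K K₀ : Measure (Euc n), Adm s lam Lam K →
      Adm s lam Lam K₀ → KC s β η K K₀ → ∀ w : Euc n → ℝ, ContDiff ℝ 1 w →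
      (∀ x k, |d2 w x k| ≤ ‖k‖ ^ γ) → (∀ x k, |d2 w x k| ≤ N * ‖k‖ ^ 2) → ∀ x,
      Integrable (fun y => d2 w x y) K ∧
        |(∫ y, d2 w x y ∂K) - ∫ y in ball 0 R \ ball 0 ε, d2 w x y ∂K₀| ≤ κ := by
  obtain ⟨C2, hC2, h2⟩ := exists_lintegral_ball_le n (lam := lam) hs hLam
  obtain ⟨C0, hC0, h0⟩ := exists_lintegral_compl_ball_le n (lam := lam) hLam hγ0.le hγ
  obtain ⟨ε, hε, hεr, hεp⟩ := exists_rpow_le (p := 2 - 2 * s) (δ := κ / 3 / (N * C2)) (r := r₁)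
    (by linarith [hs.2]) (by positivity) hr₁
  obtain ⟨J, hJr, hJ⟩ := exists_two_pow_mul_rpow_le (q := γ - 2 * s) (δ := κ / 3 / C0) (r := r₂)
    (by linarith) (by positivity) hε
  have htest : ∀ j : ℕ, ∃ A > 0, ∀ w : Euc n → ℝ, ContDiff ℝ 1 w →
      (∀ x k, |d2 w x k| ≤ ‖k‖ ^ γ) → (∀ x k, |d2 w x k| ≤ N * ‖k‖ ^ 2) → ∀ x, ∃ ψ, HE β ψ ∧
        ψ 0 = 0 ∧ ∀ y ∈ ball (0 : Euc n) (2 * (2 ^ j * ε)), d2 w x y = A * ψ y := fun j =>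
    exists_test_function n hβ hβγ hN (by positivity)
  choose A hA htest using htest
  set B : ℕ → ℝ := fun j => A j * (2 ^ j * ε) ^ (β - 2 * s) with hB
  have hB0 : ∀ j, 0 < B j := fun j => mul_pos (hA j) (by positivity)
  have hS0 : 0 ≤ ∑ j ∈ Finset.range J, B j := Finset.sum_nonneg fun j _ => (hB0 j).le
  set η : ℝ := κ / 3 / (∑ j ∈ Finset.range J, B j + 1) with hη
  have hη0 : 0 < η := by positivity
  refine ⟨ε, 2 ^ J * ε, hε, hεr, hJr, η, hη0, fun K K₀ hK hK₀ hKC w hw hwγ hwN x => ?_⟩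
  have hcont := continuous_d2 hw.continuous x
  have hball := integrableOn_and_abs_le (K := K) (S := ball (0 : Euc n) ε) measurableSet_ball
    hN.le (by positivity) hcont.aestronglyMeasurable (fun y _ => hwN x y) (h2 K hK ε hε)
  have hcompl : ∀ μ, Adm s lam Lam μ → ∀ r, 0 < r →
      IntegrableOn (fun y => d2 w x y) (ball (0 : Euc n) r)ᶜ μ ∧
      |∫ y in (ball (0 : Euc n) r)ᶜ, d2 w x y ∂μ| ≤ 1 * (C0 * r ^ (γ - 2 * s)) := fun μ hμ r hr =>
    integrableOn_and_abs_le (K := μ) measurableSet_ball.compl zero_le_one (by positivity)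
      hcont.aestronglyMeasurable (fun y _ => by simpa using hwγ x y) (h0 μ hμ r hr)
  have hint : Integrable (fun y => d2 w x y) K := by
    rw [← integrableOn_univ, ← union_compl_self (ball (0 : Euc n) ε)]
    exact hball.1.union (hcompl K hK ε hε).1
  refine ⟨hint, ?_⟩
  have hsub : ∀ j : ℕ, ball (0 : Euc n) (2 ^ j * ε) ⊆ ball 0 (2 ^ (j + 1) * ε) := fun j =>
    ball_subset_ball (by rw [pow_succ]; nlinarith [show 0 < (2 : ℝ) ^ j * ε by positivity])
  have hεsub : ∀ j : ℕ, ball (0 : Euc n) ε ⊆ ball 0 (2 ^ j * ε) := fun j =>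
    ball_subset_ball (by nlinarith [one_le_pow₀ (M₀ := ℝ) one_le_two (n := j)])
  have hstep : ∀ μ, Adm s lam Lam μ → ∀ j : ℕ,
      ∫ y in ball 0 (2 ^ (j + 1) * ε) \ ball 0 ε, d2 w x y ∂μ =
      (∫ y in ball 0 (2 ^ j * ε) \ ball 0 ε, d2 w x y ∂μ) +
        ∫ y in ball 0 (2 * (2 ^ j * ε)) \ ball 0 (2 ^ j * ε), d2 w x y ∂μ := fun μ hμ j => by
    have hi := (hcompl μ hμ ε hε).1
    have e : ball (0 : Euc n) (2 ^ (j + 1) * ε) \ ball 0 ε =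
        (ball 0 (2 ^ j * ε) \ ball 0 ε) ∪ (ball 0 (2 * (2 ^ j * ε)) \ ball 0 (2 ^ j * ε)) := by
      rw [show 2 * ((2 : ℝ) ^ j * ε) = 2 ^ (j + 1) * ε by ring]
      ext y
      have a1 := @hsub j y
      have a2 := @hεsub j y
      simp only [mem_sdiff, mem_union]
      tauto
    rw [e, setIntegral_union]
    · exact disjoint_left.2 fun y h1 h2 => h2.2 h1.1
    · exact measurableSet_ball.diff measurableSet_ball
    · exact hi.mono_set fun y hy => hy.2
    · exact hi.mono_set fun y hy hy' => hy.2 (hεsub j hy')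
  have hann : ∀ j : ℕ, |(∫ y in ball 0 (2 ^ j * ε) \ ball 0 ε, d2 w x y ∂K) -
      ∫ y in ball 0 (2 ^ j * ε) \ ball 0 ε, d2 w x y ∂K₀| ≤
      ∑ i ∈ Finset.range j, η * B i := by
    intro j
    induction j with
    | zero => simp
    | succ j ih =>
      rw [hstep K hK, hstep K₀ hK₀, Finset.sum_range_succ]
      obtain ⟨ψ, hψ, hψ0, hψe⟩ := htest j w hw hwγ hwN x
      have e : ∀ μ : Measure (Euc n),
          ∫ y in ball 0 (2 * (2 ^ j * ε)) \ ball 0 (2 ^ j * ε), d2 w x y ∂μ =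
          A j * ∫ y in ball 0 (2 * (2 ^ j * ε)) \ ball 0 (2 ^ j * ε), ψ y ∂μ := fun μ => by
        rw [← integral_const_mul]
        exact setIntegral_congr_fun (measurableSet_ball.diff measurableSet_ball)
          fun y hy => hψe y hy.1
      have hk := hKC (2 ^ j * ε) (by positivity) ψ hψ hψ0
      rw [e K, e K₀]
      rw [abs_le] at ih hk ⊢
      have hk1 := mul_le_mul_of_nonneg_left hk.1 (hA j).le
      have hk2 := mul_le_mul_of_nonneg_left hk.2 (hA j).le
      simp only [hB]
      constructor <;> nlinarith
  have hannJ : |(∫ y in ball 0 (2 ^ J * ε) \ ball 0 ε, d2 w x y ∂K) -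
      ∫ y in ball 0 (2 ^ J * ε) \ ball 0 ε, d2 w x y ∂K₀| ≤ κ / 3 := by
    refine (hann J).trans ?_
    rw [← Finset.mul_sum, hη, div_mul_eq_mul_div]
    exact div_le_of_le_mul₀ (by positivity) (by positivity) (by nlinarith)
  have e1 : ∫ y, d2 w x y ∂K = (∫ y in ball 0 ε, d2 w x y ∂K) +
      ((∫ y in ball 0 (2 ^ J * ε) \ ball 0 ε, d2 w x y ∂K) +
      ∫ y in (ball 0 (2 ^ J * ε))ᶜ, d2 w x y ∂K) := by
    rw [← integral_add_compl (measurableSet_ball (x := (0 : Euc n)) (ε := ε)) hint]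
    congr 1
    have e : (ball (0 : Euc n) ε)ᶜ = (ball 0 (2 ^ J * ε) \ ball 0 ε) ∪ (ball 0 (2 ^ J * ε))ᶜ := by
      ext y
      have a2 := @hεsub J y
      simp only [mem_sdiff, mem_union, mem_compl_iff]
      tauto
    rw [e, setIntegral_union _ measurableSet_ball.compl hint.integrableOn hint.integrableOn]
    exact disjoint_left.2 fun y h1 h2 => h2 h1.1
  have b1 : |∫ y in ball 0 ε, d2 w x y ∂K| ≤ κ / 3 := by
    refine hball.2.trans ?_
    rw [le_div_iff₀ (by positivity)] at hεp
    linarith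
  have b2 : |∫ y in (ball 0 (2 ^ J * ε))ᶜ, d2 w x y ∂K| ≤ κ / 3 := by
    refine (hcompl K hK _ (by positivity)).2.trans ?_
    rw [le_div_iff₀ (by positivity)] at hJ
    linarith
  rw [e1]
  rw [abs_le] at *
  constructor <;> linarith [b1.1, b1.2, b2.1, b2.2, hannJ.1, hannJ.2]

lemma Adm.measure_compl_ball_lt_top {s lam Lam r : ℝ} {K : Measure (Euc n)}
    (hK : Adm s lam Lam K) (hs : s ∈ Ioo (0 : ℝ) 1) (hLam : 0 < Lam) (hr : 0 < r) :
    K (ball 0 r)ᶜ < ⊤ := by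
  obtain ⟨C, hC, h⟩ := exists_lintegral_compl_ball_le n (s := s) (lam := lam) (p := 0) hLam le_rfl
    (by linarith [hs.1])
  have := h K hK r hr
  simp only [Real.rpow_zero, ENNReal.ofReal_one, lintegral_one, Measure.restrict_apply,
    MeasurableSet.univ, univ_inter] at this
  exact this.trans_lt ENNReal.ofReal_lt_top

lemma Adm.isFiniteMeasure_restrict {s lam Lam ε R : ℝ} {K : Measure (Euc n)}
    (hK : Adm s lam Lam K) (hs : s ∈ Ioo (0 : ℝ) 1) (hLam : 0 < Lam) (hε : 0 < ε) :
    IsFiniteMeasure (K.restrict (ball 0 R \ ball 0 ε)) :=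
  ⟨by
    rw [Measure.restrict_apply_univ]
    exact (measure_mono fun y hy => hy.2).trans_lt (hK.measure_compl_ball_lt_top hs hLam hε)⟩

lemma integral_indicator_sq_le {ε R r Q : ℝ} {K : Measure (Euc n)} (hQ0 : 0 ≤ Q)
    (hQ : ∫⁻ y in ball 0 r, ENNReal.ofReal (‖y‖ ^ 2) ∂K ≤ ENNReal.ofReal Q) :
    ∫ y in ball 0 R \ ball 0 ε, (ball (0 : Euc n) r).indicator (fun y => ‖y‖ ^ 2) y ∂K ≤ Q := by
  rw [integral_eq_lintegral_of_nonneg_ae]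
  · refine ENNReal.toReal_le_of_le_ofReal hQ0 (le_trans ?_ hQ)
    refine (lintegral_mono' Measure.restrict_le_self le_rfl).trans ?_
    rw [← lintegral_indicator measurableSet_ball]
    refine lintegral_mono fun y => ?_
    by_cases hy : y ∈ ball (0 : Euc n) r <;> simp [hy]
  · exact Filter.Eventually.of_forall fun y => indicator_nonneg (fun _ _ => by positivity) y
  · exact ((continuous_norm.pow 2).measurable.indicator measurableSet_ball).aestronglyMeasurable

lemma le_integral_indicator_inner_sq {ε R r a b : ℝ} {K : Measure (Euc n)} {e : Euc n}
    [IsFiniteMeasure (K.restrict (ball 0 R \ ball 0 ε))] (hb0 : 0 ≤ b)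
    (hrR : r ≤ R) (he : ‖e‖ = 1)
    (ha : ENNReal.ofReal a ≤ ∫⁻ y in ball 0 r, ENNReal.ofReal (⟪e, y⟫ ^ 2) ∂K)
    (hb : ∫⁻ y in ball 0 ε, ENNReal.ofReal (‖y‖ ^ 2) ∂K ≤ ENNReal.ofReal b) :
    a - b ≤ ∫ y in ball 0 R \ ball 0 ε, (ball (0 : Euc n) r).indicator (fun y => ⟪e, y⟫) y ^ 2 ∂K := by
  have hg : Measurable ((ball (0 : Euc n) r).indicator fun y => ⟪e, y⟫) :=
    (by fun_prop : Measurable fun y : Euc n => ⟪e, y⟫).indicator measurableSet_ball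
  have hgb : ∀ y, |(ball (0 : Euc n) r).indicator (fun y => ⟪e, y⟫) y| ≤ |r| := fun y => by
    by_cases hy : y ∈ ball (0 : Euc n) r
    · rw [indicator_of_mem hy]
      refine (abs_real_inner_le_norm _ _).trans ?_
      rw [he, one_mul]
      exact ((by simpa using hy : ‖y‖ < r).le).trans (le_abs_self r)
    · simp [hy]
  have hint : Integrable (fun y => (ball (0 : Euc n) r).indicator (fun y => ⟪e, y⟫) y ^ 2)
      (K.restrict (ball 0 R \ ball 0 ε)) := by
    refine Integrable.of_bound (hg.pow_const 2).aestronglyMeasurable (|r| ^ 2)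
      (Filter.Eventually.of_forall fun y => ?_)
    rw [norm_pow]
    exact pow_le_pow_left₀ (norm_nonneg _) (hgb y) 2
  have h1 : ∫⁻ y in ball 0 r, ENNReal.ofReal (⟪e, y⟫ ^ 2) ∂K ≤
      (∫⁻ y in ball 0 ε, ENNReal.ofReal (‖y‖ ^ 2) ∂K) + ∫⁻ y in ball 0 R \ ball 0 ε,
        ENNReal.ofReal ((ball (0 : Euc n) r).indicator (fun y => ⟪e, y⟫) y ^ 2) ∂K := by
    refine (lintegral_mono_set (t := ball (0 : Euc n) ε ∪
      (ball 0 r ∩ (ball 0 R \ ball 0 ε))) fun y hy => ?_).trans ?_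
    · have := ball_subset_ball hrR hy
      simp only [mem_union, mem_inter_iff, mem_sdiff]
      tauto
    refine (lintegral_union_le _ _ _).trans (add_le_add ?_ ?_)
    · refine lintegral_mono fun y => ENNReal.ofReal_le_ofReal ?_
      rw [← sq_abs]
      refine pow_le_pow_left₀ (abs_nonneg _) ?_ 2
      simpa [he] using abs_real_inner_le_norm e y
    · rw [← Measure.restrict_restrict measurableSet_ball, ← lintegral_indicator measurableSet_ball]
      refine lintegral_mono fun y => ?_
      by_cases hy : y ∈ ball (0 : Euc n) r <;> simp [hy]
  rw [← ofReal_integral_eq_lintegral_ofReal hint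
    (Filter.Eventually.of_forall fun y => by positivity)] at h1
  have h2 := (ha.trans h1).trans (add_le_add_left hb _)
  rw [← ENNReal.ofReal_add hb0 (integral_nonneg fun y => by positivity)] at h2
  have h3 : 0 ≤ ∫ y in ball 0 R \ ball 0 ε,
    (ball (0 : Euc n) r).indicator (fun y => ⟪e, y⟫) y ^ 2 ∂K := integral_nonneg fun y => by positivity
  have := (ENNReal.ofReal_le_ofReal_iff (by linarith)).1 h2
  linarith

/-- Two applications of the resolvent of a truncated elliptic operator make the gradient small. -/
lemma exists_norm_fderiv_le (n : ℕ) {s lam Lam N σ : ℝ} (hs : s ∈ Ioo (0 : ℝ) 1)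
    (hlam : 0 < lam) (hLam : 0 < Lam) (hN : 0 < N) (hσ : 0 < σ) :
    ∃ θ r₁ r₂, 0 < θ ∧ 0 < r₁ ∧ ∀ K : Measure (Euc n), Adm s lam Lam K → ∀ ε R, 0 < ε → ε ≤ r₁ →
      r₂ ≤ R → ∀ ν, IsProbabilityMeasure ν → IsRes (K.restrict (ball 0 R \ ball 0 ε)) θ ν →
      ∀ E, BC E → (∀ x, |E x| ≤ 1) → Differentiable ℝ (cv ν (cv ν E)) →
      (∀ x k, |d2 (cv ν (cv ν E)) x k| ≤ N * ‖k‖ ^ 2) → ∀ x, ‖fderiv ℝ (cv ν (cv ν E)) x‖ ≤ σ := by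
  obtain ⟨C2, hC2, h2⟩ := exists_lintegral_ball_le n (lam := lam) hs hLam
  set r : ℝ := σ * lam / (8 * N * C2) with hr
  have hr0 : 0 < r := by positivity
  set q : ℝ := 2 - 2 * s with hq
  have hq0 : 0 < q := by linarith [hs.2]
  set Q : ℝ := C2 * r ^ q with hQ
  have hQ0 : 0 < Q := by positivity
  set t : ℝ := (1 + Q) / (2 * (σ * lam / 8 * r ^ q)) with ht
  have ht0 : 0 < t := by positivity
  obtain ⟨r₁, hr₁, -, hr₁q⟩ := exists_rpow_le (p := q) (δ := lam / 2 * r ^ q / C2) (r := 1)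
    hq0 (by positivity) one_pos
  refine ⟨t ^ 2, r₁, r, by positivity, hr₁, fun K hK ε R hε hεr hrR ν hν hres E hE hE1 hd hY x => ?_⟩
  have := hK.isFiniteMeasure_restrict (R := R) hs hLam hε
  set μ := K.restrict (ball 0 R \ ball 0 ε) with hμ
  set Y := cv ν (cv ν E) with hYdef
  have hYBC : BC Y := hE.cv.cv
  by_contra! hcon
  set D := fderiv ℝ Y x with hD
  set p := (InnerProductSpace.toDual ℝ (Euc n)).symm D with hp
  have hpn : ‖p‖ = ‖D‖ := LinearIsometryEquiv.norm_map _ _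
  have hp0 : 0 < ‖p‖ := by rw [hpn]; linarith
  set e := ‖p‖⁻¹ • p with he
  have hen : ‖e‖ = 1 := by rw [he, norm_smul, norm_inv, norm_norm, inv_mul_cancel₀ hp0.ne']
  have hDe : ∀ y, D y = ‖D‖ * ⟪e, y⟫ := fun y => by
    rw [he, real_inner_smul_left, ← hpn, mul_inv_cancel_left₀ hp0.ne', hp,
      InnerProductSpace.toDual_symm_apply]
  set g : Euc n → ℝ := (ball (0 : Euc n) r).indicator fun y => ⟪e, y⟫ with hg
  have hgm : Measurable g :=
    (by fun_prop : Measurable fun y : Euc n => ⟪e, y⟫).indicator measurableSet_ball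
  have hgn : ∀ y, |g y| ≤ r ∧ g y ^ 2 ≤ (ball (0 : Euc n) r).indicator (fun y => ‖y‖ ^ 2) y := by
    intro y
    by_cases hy : y ∈ ball (0 : Euc n) r
    · rw [hg, indicator_of_mem hy, indicator_of_mem hy]
      have h1 : |⟪e, y⟫| ≤ ‖y‖ := by simpa [hen] using abs_real_inner_le_norm e y
      refine ⟨h1.trans (by simpa using hy : ‖y‖ < r).le, ?_⟩
      rw [← sq_abs]
      exact pow_le_pow_left₀ (abs_nonneg _) h1 2
    · simp [hg, hy, hr0.le]
  set m : Euc n → ℝ := (ball (0 : Euc n) r).indicator fun y => ‖y‖ ^ 2 with hm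
  have hmm : Measurable m := (continuous_norm.pow 2).measurable.indicator measurableSet_ball
  have hmi : Integrable m μ := by
    refine Integrable.of_bound hmm.aestronglyMeasurable (r ^ 2) (Filter.Eventually.of_forall ?_)
    intro y
    by_cases hy : y ∈ ball (0 : Euc n) r
    · rw [hm, indicator_of_mem hy, norm_pow, norm_norm]
      exact pow_le_pow_left₀ (norm_nonneg _) (by simpa using hy : ‖y‖ < r).le 2
    · simp [hm, hy]; positivity
  have hgi : Integrable (fun y => g y ^ 2) μ :=
    hmi.mono' (hgm.pow_const 2).aestronglyMeasurable (Filter.Eventually.of_forall fun y => by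
      rw [Real.norm_of_nonneg (by positivity)]; exact (hgn y).2)
  have hmQ : ∫ y, m y ∂μ ≤ Q := integral_indicator_sq_le hQ0.le (h2 K hK r hr0)
  have hgQ : ∫ y, g y ^ 2 ∂μ ≤ Q := (integral_mono hgi hmi fun y => (hgn y).2).trans hmQ
  have hlow : lam * r ^ q - C2 * ε ^ q ≤ ∫ y, g y ^ 2 ∂μ :=
    le_integral_indicator_inner_sq (by positivity) hrR hen (hK.lower r hr0 e hen) (h2 K hK ε hε)
  have hεq : C2 * ε ^ q ≤ lam / 2 * r ^ q := by
    have : ε ^ q ≤ r₁ ^ q := Real.rpow_le_rpow hε.le hεr hq0.le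
    rw [le_div_iff₀ hC2] at hr₁q
    nlinarith
  have hup := abs_cv_sub_mul_le (by positivity) hres hE hE1 hgm (fun y => (hgn y).1) hgQ x
  rw [Real.sqrt_sq ht0.le] at hup
  have hpt : ∀ y, ‖D‖ * g y ^ 2 - 2 * N * r * m y ≤ (Y (x + y) - Y x) * g y := by
    intro y
    by_cases hy : y ∈ ball (0 : Euc n) r
    · have hT := taylor_of_d2 (γ := 2) (Φ := N) (x := x) (h := y) one_lt_two (hd x)
        (fun t _ _ => by simpa using hY (x + t • y) (t • y))
      have e1 : N * (1 - (2 : ℝ) ^ (1 - (2 : ℝ)))⁻¹ * ‖y‖ ^ (2 : ℝ) = 2 * N * ‖y‖ ^ 2 := by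
        have e0 : (1 - (2 : ℝ) ^ (1 - (2 : ℝ)))⁻¹ = 2 := by norm_num
        rw [e0, Real.rpow_two]; ring
      have e2 : m y = ‖y‖ ^ 2 := by rw [hm, indicator_of_mem hy]
      have e3 : D y = ‖D‖ * g y := by rw [hDe, hg, indicator_of_mem hy]
      rw [e1, ← hD, e3, ← e2] at hT
      have h3 : |(Y (x + y) - Y x - ‖D‖ * g y) * g y| ≤ 2 * N * m y * r := by
        rw [abs_mul]
        exact mul_le_mul hT (hgn y).1 (abs_nonneg _) ((abs_nonneg _).trans hT)
      rw [abs_le] at h3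
      nlinarith [h3.1]
    · simp [hg, hm, hy]
  have hI : Integrable (fun y => (Y (x + y) - Y x) * g y) μ := by
    have := (hYBC.sub (BC.const (Y x))).integrable_mul (μ := μ) hgm (fun y => (hgn y).1) x
    simpa using this
  have hmono := integral_mono ((hgi.const_mul ‖D‖).sub (hmi.const_mul (2 * N * r))) hI hpt
  rw [integral_sub' (hgi.const_mul ‖D‖) (hmi.const_mul (2 * N * r)), integral_const_mul,
    integral_const_mul] at hmono
  have hup' := (le_abs_self _).trans hup
  have e4 : (1 + Q) / (2 * t) = σ * lam / 8 * r ^ q := by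
    rw [ht]; field_simp
  have e5 : 2 * N * r * Q = σ * lam / 4 * r ^ q := by
    rw [hQ, hr]; field_simp; norm_num
  have h6 : 2 * N * r * ∫ y, m y ∂μ ≤ 2 * N * r * Q := by gcongr
  have h7 : σ * (lam / 2 * r ^ q) ≤ ‖D‖ * ∫ y, g y ^ 2 ∂μ := by
    refine mul_le_mul hcon.le (by linarith) (by positivity) (norm_nonneg _)
  have h8 : 0 < σ * lam * r ^ q := by positivity
  rw [e4] at hup'
  linarith

lemma abs_d2_le_of_lipschitz {G : Euc n → ℝ} {σ γ : ℝ} {h : Euc n} (hh : ‖h‖ = 1)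
    (hL : ∀ x y, |d2 G x h - d2 G y h| ≤ σ * ‖x - y‖) (hG : ∀ x k, |d2 G x k| ≤ ‖k‖ ^ γ)
    (m : ℕ) (x : Euc n) : |d2 G x h| ≤ 2 ^ ((γ - 2) * m) + 2 ^ m * σ := by
  have hσ : 0 ≤ σ := by
    have := (abs_nonneg _).trans (hL h 0)
    simpa [hh] using this
  have key : ∀ m : ℕ, ∀ x, |d2 G x ((2 : ℝ) ^ m • h) - 4 ^ m * d2 G x h| ≤ 8 ^ m * σ := by
    intro m
    induction m with
    | zero => intro x; simpa using hσ
    | succ m ih =>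
      intro x
      have e : d2 G x ((2 : ℝ) ^ (m + 1) • h) = d2 G (x + (2 : ℝ) ^ m • h) ((2 : ℝ) ^ m • h) +
          d2 G (x - (2 : ℝ) ^ m • h) ((2 : ℝ) ^ m • h) + 2 * d2 G x ((2 : ℝ) ^ m • h) := by
        have e1 : (2 : ℝ) ^ (m + 1) • h = (2 : ℝ) ^ m • h + (2 : ℝ) ^ m • h := by
          rw [← two_smul ℝ, smul_smul, pow_succ']
        simp only [d2, e1, ← add_assoc, add_sub_cancel_right, sub_add_cancel, ← sub_sub]
        ring
      have hn : ‖(2 : ℝ) ^ m • h‖ = 2 ^ m := by rw [norm_smul, hh]; simp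
      have a1 := ih (x + (2 : ℝ) ^ m • h)
      have a2 := ih (x - (2 : ℝ) ^ m • h)
      have a3 := ih x
      have b1 := hL (x + (2 : ℝ) ^ m • h) x
      have b2 := hL (x - (2 : ℝ) ^ m • h) x
      rw [add_sub_cancel_left, hn] at b1
      rw [sub_sub_cancel_left, norm_neg, hn] at b2
      have h4 : (0 : ℝ) ≤ 4 ^ m := by positivity
      have e8 : (8 : ℝ) ^ m = 4 ^ m * 2 ^ m := by rw [← mul_pow]; norm_num
      rw [e, pow_succ, pow_succ]
      rw [abs_le] at *
      have c1 := mul_le_mul_of_nonneg_left b1.1 h4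
      have c2 := mul_le_mul_of_nonneg_left b1.2 h4
      have c3 := mul_le_mul_of_nonneg_left b2.1 h4
      have c4 := mul_le_mul_of_nonneg_left b2.2 h4
      have c5 : 0 ≤ (8 : ℝ) ^ m * σ := by positivity
      have c6 : (4 : ℝ) ^ m * (2 ^ m * σ) = 8 ^ m * σ := by rw [e8]; ring
      have c7 : (4 : ℝ) ^ m * (σ * 2 ^ m) = 8 ^ m * σ := by rw [e8]; ring
      have c8 : (4 : ℝ) ^ m * -(σ * 2 ^ m) = -(8 ^ m * σ) := by rw [e8]; ring
      constructor <;> linarith [a1.1, a1.2, a2.1, a2.2, a3.1, a3.2]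
  have h1 := key m x
  have h2 := hG x ((2 : ℝ) ^ m • h)
  have hn : ‖(2 : ℝ) ^ m • h‖ = 2 ^ m := by rw [norm_smul, hh]; simp
  rw [hn] at h2
  have h4 : (0 : ℝ) < 4 ^ m := by positivity
  have e8 : (8 : ℝ) ^ m = 4 ^ m * 2 ^ m := by rw [← mul_pow]; norm_num
  have e9 : ((2 : ℝ) ^ m) ^ γ = 4 ^ m * 2 ^ ((γ - 2) * m) := by
    rw [show (4 : ℝ) ^ m = (2 : ℝ) ^ ((2 : ℝ) * m) by
      rw [Real.rpow_mul (by norm_num), Real.rpow_natCast]; norm_num, ← Real.rpow_add (by norm_num),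
      ← Real.rpow_natCast, ← Real.rpow_mul (by norm_num)]
    ring_nf
  refine le_of_mul_le_mul_left ?_ h4
  have h5 : |4 ^ m * d2 G x h| ≤ |d2 G x ((2 : ℝ) ^ m • h)| +
      |d2 G x ((2 : ℝ) ^ m • h) - 4 ^ m * d2 G x h| := by
    have := abs_sub (d2 G x ((2 : ℝ) ^ m • h)) (d2 G x ((2 : ℝ) ^ m • h) - 4 ^ m * d2 G x h)
    rwa [sub_sub_cancel] at this
  rw [abs_mul, abs_of_pos h4] at h5
  rw [e9] at h2
  rw [e8] at h1
  linarith

lemma abs_d2_cv_le {ν : Measure (Euc n)} [IsProbabilityMeasure ν] {F : Euc n → ℝ} (hF : BC F)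
    {k : Euc n} {M : ℝ} (h : ∀ x, |d2 F x k| ≤ M) (x : Euc n) : |d2 (cv ν F) x k| ≤ M := by
  rw [d2_cv hF]
  exact abs_cv_le h x

/-- Unit second differences become small after mollification and two resolvents. -/
lemma exists_smoothing (n : ℕ) {s γ lam Lam a δ : ℝ} (hs : s ∈ Ioo (0 : ℝ) 1)
    (hlam : 0 < lam) (hLam : 0 < Lam) (hγ0 : 0 < γ) (hγ2 : γ < 2) (ha : 0 < a) (hδ : 0 < δ) :
    ∃ (M : Measure (Euc n)) (N θ r₁ r₂ : ℝ), IsProbabilityMeasure M ∧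
      (∀ v, BC v → ContDiff ℝ 2 (cv M v)) ∧ 0 < N ∧ 0 < θ ∧ 0 < r₁ ∧
      (∀ v, BC v → (∀ x k, |d2 v x k| ≤ ‖k‖ ^ γ) →
        (∀ x, |v x - cv M v x| ≤ a ^ γ) ∧ ∀ x k, |d2 (cv M v) x k| ≤ N * ‖k‖ ^ 2) ∧
      ∀ K : Measure (Euc n), Adm s lam Lam K → ∀ ε R, 0 < ε → ε ≤ r₁ →
        r₂ ≤ R → ∀ ν, IsProbabilityMeasure ν → IsRes (K.restrict (ball 0 R \ ball 0 ε)) θ ν →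
        ∀ v, BC v → (∀ x k, |d2 v x k| ≤ ‖k‖ ^ γ) → ∀ h, ‖h‖ = 1 → ∀ x,
          |d2 (cv ν (cv ν (cv M v))) x h| ≤ δ := by
  obtain ⟨M, hM, hMc, N, hN, hMv⟩ := exists_mollifier n hγ0 hγ2.le ha
  obtain ⟨m, hm⟩ : ∃ m : ℕ, (2 : ℝ) ^ ((γ - 2) * m) ≤ δ / 2 := by
    have h1 : (2 : ℝ) ^ (γ - 2) < 1 := Real.rpow_lt_one_of_one_lt_of_neg one_lt_two (by linarith)
    obtain ⟨m, hm⟩ := exists_pow_lt_of_lt_one (half_pos hδ) h1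
    exact ⟨m, by rw [Real.rpow_mul (by norm_num), Real.rpow_natCast]; exact hm.le⟩
  obtain ⟨θ, r₁, r₂, hθ, hr₁, H⟩ := exists_norm_fderiv_le n (N := 4 * N)
    (σ := δ / 2 / 2 ^ m) hs hlam hLam (by positivity) (by positivity)
  refine ⟨M, N, θ, r₁, r₂, hM, hMc, hN, hθ, hr₁, hMv,
    fun K hK ε R hε hεr hR ν hν hres v hv hvγ h hh x => ?_⟩
  set F := cv M v with hF
  have hFBC : BC F := hv.cv
  have hFγ : ∀ x k, |d2 F x k| ≤ ‖k‖ ^ γ := fun x k => abs_d2_cv_le hv (fun x => hvγ x k) x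
  have hcomm : ∀ w, BC w → cv ν (cv M w) = cv M (cv ν w) := fun w hw => funext fun x => cv_comm hw x
  have hG : ContDiff ℝ 2 (cv ν (cv ν F)) := by
    rw [hF, hcomm v hv, hcomm _ hv.cv]
    exact hMc _ hv.cv.cv
  have hGN : ∀ x k, |d2 (cv ν (cv ν F)) x k| ≤ N * ‖k‖ ^ 2 := fun x k =>
    abs_d2_cv_le hFBC.cv (abs_d2_cv_le hFBC fun x => (hMv v hv hvγ).2 x k) x
  have hGγ : ∀ x k, |d2 (cv ν (cv ν F)) x k| ≤ ‖k‖ ^ γ := fun x k =>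
    abs_d2_cv_le hFBC.cv (abs_d2_cv_le hFBC fun x => hFγ x k) x
  have hE : BC (fun x => d2 F x h) := hFBC.d2 h
  have hY : cv ν (cv ν fun x => d2 F x h) = fun x => d2 (cv ν (cv ν F)) x h := by
    funext x
    rw [d2_cv hFBC.cv]
    congr 1
    funext z
    rw [d2_cv hFBC]
  have hYd : Differentiable ℝ fun x => d2 (cv ν (cv ν F)) x h := by
    have := hG.differentiable (by norm_num)
    unfold d2
    fun_prop
  have hgrad := H K hK ε R hε hεr hR ν hν hres _ hE
    (fun x => by simpa [hh] using hFγ x h) (by rw [hY]; exact hYd) (fun x k => by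
      rw [hY]
      have e : d2 (fun x => d2 (cv ν (cv ν F)) x h) x k = d2 (cv ν (cv ν F)) (x + h) k +
          d2 (cv ν (cv ν F)) (x - h) k - 2 * d2 (cv ν (cv ν F)) x k := by
        simp only [d2, add_right_comm x k h, sub_add_eq_add_sub x k h, add_sub_right_comm x k h,
          sub_right_comm x k h]
        ring
      rw [e]
      have a1 := hGN (x + h) k
      have a2 := hGN (x - h) k
      have a3 := hGN x k
      rw [abs_le] at *
      constructor <;> linarith [a1.1, a1.2, a2.1, a2.2, a3.1, a3.2])
  rw [hY] at hgrad
  have hL : ∀ x y, |d2 (cv ν (cv ν F)) x h - d2 (cv ν (cv ν F)) y h| ≤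
      δ / 2 / 2 ^ m * ‖x - y‖ := fun x y =>
    convex_univ.norm_image_sub_le_of_norm_fderiv_le (𝕜 := ℝ) (fun z _ => hYd z)
      (fun z _ => hgrad z) (mem_univ y) (mem_univ x)
  refine (abs_d2_le_of_lipschitz hh hL hGγ m x).trans ?_
  rw [mul_div_cancel₀ _ (by positivity)]
  linarith

lemma d2_min_one_sq_le (z k : Euc n) :
    d2 (fun z : Euc n => min 1 (‖z‖ ^ 2)) z k ≤ 2 * min 1 (‖k‖ ^ 2) := by
  have h0 : 0 ≤ min 1 (‖k‖ ^ 2) := by positivity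
  have a1 := min_le_left 1 (‖z + k‖ ^ 2)
  have a2 := min_le_right 1 (‖z + k‖ ^ 2)
  have a3 := min_le_left 1 (‖z - k‖ ^ 2)
  have a4 := min_le_right 1 (‖z - k‖ ^ 2)
  have a5 := parallelogram_law_with_norm ℝ z k
  simp only [d2]
  rcases le_total 1 (‖z‖ ^ 2) with h | h
  · rw [min_eq_left h]
    linarith
  · rw [min_eq_right h]
    rcases le_total 1 (‖k‖ ^ 2) with h' | h'
    · rw [min_eq_left h']
      nlinarith [sq_nonneg ‖z‖]
    · rw [min_eq_right h']
      nlinarith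

lemma d2_comp_smul_sub (ψ : Euc n → ℝ) (x₀ x k : Euc n) (c : ℝ) :
    d2 (fun x => ψ (c • (x - x₀))) x k = d2 ψ (c • (x - x₀)) (c • k) := by
  simp only [d2]
  rw [show x + k - x₀ = (x - x₀) + k by abel, show x - k - x₀ = (x - x₀) - k by abel, smul_add,
    smul_sub c (x - x₀) k]

lemma exists_integral_min_le (n : ℕ) {s lam Lam : ℝ} (hs : s ∈ Ioo (0 : ℝ) 1) (hLam : 0 < Lam) :
    ∃ C > 0, ∀ K : Measure (Euc n), Adm s lam Lam K → ∀ D : ℝ, 0 < D →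
      Integrable (fun y => min 1 (‖D⁻¹ • y‖ ^ 2)) K ∧
        ∫ y, min 1 (‖D⁻¹ • y‖ ^ 2) ∂K ≤ C * D ^ (-(2 * s)) := by
  obtain ⟨C2, hC2, h2⟩ := exists_lintegral_ball_le n (lam := lam) hs hLam
  obtain ⟨C0, hC0, h0⟩ := exists_lintegral_compl_ball_le n (s := s) (lam := lam) (p := 0) hLam le_rfl
    (by linarith [hs.1])
  refine ⟨C2 + C0, by positivity, fun K hK D hD => ?_⟩
  have hc : Continuous fun y : Euc n => min 1 (‖D⁻¹ • y‖ ^ 2) := by fun_prop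
  have e : ∀ y : Euc n, ‖D⁻¹ • y‖ ^ 2 = D⁻¹ ^ 2 * ‖y‖ ^ 2 := fun y => by
    rw [norm_smul, mul_pow, Real.norm_of_nonneg (by positivity)]
  have hb := integrableOn_and_abs_le (K := K) (S := ball (0 : Euc n) D) (p := D⁻¹ ^ 2)
    measurableSet_ball (by positivity) (by positivity) hc.aestronglyMeasurable (fun y _ => by
      rw [abs_of_nonneg (by positivity), ← e]; exact min_le_right _ _) (h2 K hK D hD)
  have ho := integrableOn_and_abs_le (K := K) (S := (ball (0 : Euc n) D)ᶜ) (p := 1)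
    measurableSet_ball.compl (by positivity) (by positivity) hc.aestronglyMeasurable (fun y _ => by
      rw [abs_of_nonneg (by positivity), Real.rpow_zero, mul_one]; exact min_le_left _ _)
      (h0 K hK D hD)
  have hi : Integrable (fun y : Euc n => min 1 (‖D⁻¹ • y‖ ^ 2)) K := by
    rw [← integrableOn_univ, ← union_compl_self (ball (0 : Euc n) D)]
    exact hb.1.union ho.1
  refine ⟨hi, ?_⟩
  rw [← integral_add_compl (measurableSet_ball (x := (0 : Euc n)) (ε := D)) hi]
  have e2 : D⁻¹ ^ 2 * (C2 * D ^ (2 - 2 * s)) = C2 * D ^ (-(2 * s)) := by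
    rw [Real.rpow_sub hD, Real.rpow_neg hD.le, Real.rpow_two]; field_simp
  rw [e2] at hb
  rw [zero_sub] at ho
  linarith [le_abs_self (∫ y in ball 0 D, min 1 (‖D⁻¹ • y‖ ^ 2) ∂K), hb.2,
    le_abs_self (∫ y in (ball 0 D)ᶜ, min 1 (‖D⁻¹ • y‖ ^ 2) ∂K), ho.2]

/-- One-sided comparison of a bounded solution with a resolvent. -/
lemma sub_le_of_equation {K : Euc n → Measure (Euc n)} {v w F : Euc n → ℝ}
    {M₀ b F₀ θ κ D P : ℝ} {x₀ : Euc n} (hθ : 0 < θ) (hD : 0 < D) (hb : 0 ≤ b) (hF₀ : 0 ≤ F₀)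
    (hκ : 0 ≤ κ) (hP : 0 ≤ P)
    (hmin : ∀ x, Integrable (fun y => min 1 (‖D⁻¹ • y‖ ^ 2)) (K x) ∧
        ∫ y, min 1 (‖D⁻¹ • y‖ ^ 2) ∂(K x) ≤ P)
    (hvc : Continuous v) (hwc : Continuous w) (hv : ∀ x, |v x| ≤ M₀) (hw : ∀ x, |w x| ≤ M₀)
    (hvF : ∀ x ∈ ball x₀ D, v x - F x ≤ b)
    (hveq : ∀ x ∈ ball x₀ D, Integrable (fun y => d2 v x y) (K x) ∧
      -F₀ ≤ ∫ y, d2 v x y ∂(K x))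
    (hweq : ∀ x, Integrable (fun y => d2 w x y) (K x) ∧
      ∫ y, d2 w x y ∂(K x) ≤ 2 * (w x - F x) / θ + κ) :
    v x₀ - w x₀ ≤ b + θ / 2 * (F₀ + κ + 4 * M₀ * P) := by
  have hM₀ : 0 ≤ M₀ := (abs_nonneg _).trans (hv 0)
  set B : Euc n → ℝ := fun x => min 1 (‖D⁻¹ • (x - x₀)‖ ^ 2) with hB
  have hBc : Continuous B := by rw [hB]; fun_prop
  set Ψ : Euc n → ℝ := fun x => v x - w x - 2 * M₀ * B x with hΨ
  have hΨc : Continuous Ψ := by rw [hΨ]; fun_prop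
  by_contra! hcon
  have hpos : 0 < v x₀ - w x₀ := lt_of_le_of_lt (by positivity) hcon
  have hΨ0 : Ψ x₀ = v x₀ - w x₀ := by simp [hΨ, hB]
  obtain ⟨z, hz, hmax⟩ := (isCompact_closedBall x₀ D).exists_isMaxOn
    (nonempty_closedBall.2 hD.le) hΨc.continuousOn
  have hzx : Ψ x₀ ≤ Ψ z := hmax (mem_closedBall_self hD.le)
  have hfar : ∀ x, D ≤ ‖x - x₀‖ → Ψ x ≤ 0 := fun x hx => by
    have e : B x = 1 := by
      refine min_eq_left (one_le_pow₀ ?_)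
      rw [norm_smul, Real.norm_of_nonneg (by positivity), ← div_eq_inv_mul, one_le_div hD]
      exact hx
    have h1 := abs_le.1 (hv x)
    have h2 := abs_le.1 (hw x)
    simp only [hΨ, e]
    linarith [h1.2, h2.1]
  have hglob : ∀ x, Ψ x ≤ Ψ z := fun x => by
    rcases le_or_gt ‖x - x₀‖ D with h | h
    · exact hmax (by simpa [dist_eq_norm] using h)
    · linarith [hfar x h.le]
  have hzb : z ∈ ball x₀ D := by
    rw [mem_ball, dist_eq_norm]
    by_contra! h
    linarith [hfar z h]
  have hd : ∀ y, d2 v z y ≤ d2 w z y + 4 * M₀ * min 1 (‖D⁻¹ • y‖ ^ 2) := fun y => by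
    have h1 := hglob (z + y)
    have h2 := hglob (z - y)
    have h3 : d2 B z y ≤ 2 * min 1 (‖D⁻¹ • y‖ ^ 2) := by
      rw [hB, d2_comp_smul_sub (fun z : Euc n => min 1 (‖z‖ ^ 2))]
      exact d2_min_one_sq_le _ _
    have h4 := mul_le_mul_of_nonneg_left h3 (by positivity : 0 ≤ 2 * M₀)
    simp only [hΨ] at h1 h2
    simp only [d2] at *
    nlinarith
  have hI := integral_mono (hveq z hzb).1 ((hweq z).1.add ((hmin z).1.const_mul (4 * M₀))) hd
  rw [integral_add' (hweq z).1 ((hmin z).1.const_mul (4 * M₀)), integral_const_mul] at hI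
  have h5 := mul_le_mul_of_nonneg_left (hmin z).2 (by positivity : 0 ≤ 4 * M₀)
  have h6 : -(F₀ + κ + 4 * M₀ * P) ≤ 2 * (w z - F z) / θ := by
    linarith [(hweq z).2, (hveq z hzb).2]
  rw [le_div_iff₀ hθ] at h6
  have h7 : 0 ≤ 2 * M₀ * B z := by positivity
  have h8 := hvF z hzb
  rw [hΨ0] at hzx
  simp only [hΨ] at hzx
  linarith

lemma d2_neg (v : Euc n → ℝ) (x y : Euc n) : d2 (fun x => -v x) x y = -d2 v x y := by
  simp only [d2]; ring

lemma abs_sub_le_of_equation {K : Euc n → Measure (Euc n)} {v w F : Euc n → ℝ}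
    {M₀ b F₀ θ κ D P : ℝ} {x₀ : Euc n} (hθ : 0 < θ) (hD : 0 < D) (hb : 0 ≤ b) (hF₀ : 0 ≤ F₀)
    (hκ : 0 ≤ κ) (hP : 0 ≤ P)
    (hmin : ∀ x, Integrable (fun y => min 1 (‖D⁻¹ • y‖ ^ 2)) (K x) ∧
        ∫ y, min 1 (‖D⁻¹ • y‖ ^ 2) ∂(K x) ≤ P)
    (hvc : Continuous v) (hwc : Continuous w) (hv : ∀ x, |v x| ≤ M₀) (hw : ∀ x, |w x| ≤ M₀)
    (hvF : ∀ x ∈ ball x₀ D, |v x - F x| ≤ b)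
    (hveq : ∀ x ∈ ball x₀ D, Integrable (fun y => d2 v x y) (K x) ∧
      |∫ y, d2 v x y ∂(K x)| ≤ F₀)
    (hweq : ∀ x, Integrable (fun y => d2 w x y) (K x) ∧
      |(∫ y, d2 w x y ∂(K x)) - 2 * (w x - F x) / θ| ≤ κ) :
    |v x₀ - w x₀| ≤ b + θ / 2 * (F₀ + κ + 4 * M₀ * P) := by
  rw [abs_le', neg_sub]
  refine ⟨sub_le_of_equation hθ hD hb hF₀ hκ hP hmin hvc hwc hv hw
    (fun x hx => (le_abs_self _).trans (hvF x hx))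
    (fun x hx => ⟨(hveq x hx).1, (abs_le.1 (hveq x hx).2).1⟩)
    (fun x => ⟨(hweq x).1, by linarith [(abs_le.1 (hweq x).2).2]⟩), ?_⟩
  have := sub_le_of_equation (v := fun x => -v x) (w := fun x => -w x) (F := fun x => -F x)
    (x₀ := x₀) hθ hD hb hF₀ hκ hP hmin hvc.neg hwc.neg (by simpa using hv) (by simpa using hw)
    (fun x hx => by linarith [(abs_le.1 (hvF x hx)).1])
    (fun x hx => by
      simp only [d2_neg, integral_neg]
      exact ⟨(hveq x hx).1.neg, by linarith [(abs_le.1 (hveq x hx).2).2]⟩)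
    (fun x => by
      simp only [d2_neg, integral_neg]
      refine ⟨(hweq x).1.neg, ?_⟩
      have e : 2 * (-w x - -F x) / θ = -(2 * (w x - F x) / θ) := by ring
      rw [e]
      linarith [(abs_le.1 (hweq x).2).1])
  linarith

lemma integral_d2_eq_of_isRes {s lam Lam θ ε R : ℝ} {K : Measure (Euc n)} {ν : Measure (Euc n)}
    (hK : Adm s lam Lam K) [IsFiniteMeasure (K.restrict (ball 0 R \ ball 0 ε))]
    [IsProbabilityMeasure ν] (hθ : 0 < θ)
    (hres : IsRes (K.restrict (ball 0 R \ ball 0 ε)) θ ν) {F : Euc n → ℝ} (hF : BC F) (x : Euc n) :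
    ∫ y in ball 0 R \ ball 0 ε, d2 (cv ν F) x y ∂K = 2 * (cv ν F x - F x) / θ := by
  set A : Set (Euc n) := ball 0 R \ ball 0 ε with hA
  have hAm : MeasurableSet A := measurableSet_ball.diff measurableSet_ball
  have hw : BC (cv ν F) := hF.cv
  have hneg : MeasurePreserving (fun y : Euc n => -y) K K := ⟨measurable_neg, hK.symm⟩
  have hsym : ∫ y in A, cv ν F (x - y) ∂K = ∫ y in A, cv ν F (x + y) ∂K := by
    have h1 := hneg.setIntegral_preimage_emb (MeasurableEquiv.neg (Euc n)).measurableEmbedding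
      (fun y => cv ν F (x + y)) A
    have h2 : (fun y : Euc n => -y) ⁻¹' A = A := by ext y; simp [hA]
    rw [h2] at h1
    simpa [sub_eq_add_neg] using h1
  have i1 : Integrable (fun y => cv ν F (x + y)) (K.restrict A) := hw.integrable x
  have i2 : Integrable (fun y => cv ν F (x - y)) (K.restrict A) := by
    obtain ⟨M, hM⟩ := hw.bdd
    exact Integrable.of_bound (hw.cont.comp (continuous_const.sub
      continuous_id)).aestronglyMeasurable M (Filter.Eventually.of_forall fun y => hM _)
  have i12 : Integrable (fun y => cv ν F (x + y) + cv ν F (x - y)) (K.restrict A) := i1.add i2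
  have hr := hres F hF x
  simp only [d2]
  rw [integral_sub i12 (integrable_const _), integral_add i1 i2, hsym, integral_const, smul_eq_mul,
    eq_div_iff hθ.ne']
  simp only [cv] at hr ⊢
  linear_combination (-2) * hr

/-- Small second differences at unit scale for bounded solutions with a global Zygmund bound. -/
lemma exists_unit_estimate (n : ℕ) {s β γ lam Lam κ : ℝ} (hs : s ∈ Ioo (0 : ℝ) 1)
    (hlam : 0 < lam) (hLam : 0 < Lam) (hβ : 0 < β) (hγ0 : 0 < γ) (hγ : γ < 2 * s)
    (hβγ : β ≤ 1 ∨ γ = β) (hκ : 0 < κ) :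
    ∃ η > 0, ∃ C > 0, ∀ K : Euc n → Measure (Euc n), (∀ x, Adm s lam Lam (K x)) →
      (∀ x x', KC s β η (K x) (K x')) → ∀ (v : Euc n → ℝ) (M₀ F₀ D : ℝ), Continuous v →
      (∀ x, |v x| ≤ M₀) → (∀ x k, |d2 v x k| ≤ ‖k‖ ^ γ) → 4 ≤ D → 0 ≤ F₀ →
      (∀ x ∈ ball 0 D, Integrable (fun y => d2 v x y) (K x) ∧ |∫ y, d2 v x y ∂(K x)| ≤ F₀) →
      ∀ h, ‖h‖ = 1 → |d2 v 0 h| ≤ κ + C * (F₀ + M₀ * D ^ (-(2 * s))) := by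
  obtain ⟨P, hP, hmin⟩ := exists_integral_min_le n (lam := lam) hs hLam
  set a : ℝ := (κ / 16) ^ γ⁻¹ with ha
  have haγ : a ^ γ = κ / 16 := Real.rpow_inv_rpow (by positivity) hγ0.ne'
  obtain ⟨M, N, θ, r₁, r₂, hM, hMc, hN, hθ, hr₁, hMv, hsm⟩ := exists_smoothing n (a := a)
    (δ := κ / 2) (γ := γ) hs hlam hLam hγ0 (by linarith [hs.2]) (by positivity) (by positivity)
  obtain ⟨ε, R, hε, hεr, hR, η, hη, herr⟩ := exists_error_bound n (κ := κ / (16 * θ)) (r₁ := r₁)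
    (r₂ := r₂) (lam := lam) hs hLam hβ hγ0 hγ hβγ hN (by positivity) hr₁
  set q : ℝ := 4 ^ (2 * s) with hq
  have hq0 : 0 < q := by positivity
  refine ⟨η, hη, 4 * θ * (1 + 4 * P * q), by positivity,
    fun K hK hKC v M₀ F₀ D hvc hv hvγ hD hF₀ hveq h hh => ?_⟩
  have hM₀ : 0 ≤ M₀ := (abs_nonneg _).trans (hv 0)
  have hfin := (hK 0).isFiniteMeasure_restrict (R := R) hs hLam hε
  obtain ⟨ν, hν, hres⟩ := exists_resolvent ((K 0).restrict (ball 0 R \ ball 0 ε)) hθ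
  have hvBC : BC v := ⟨hvc, M₀, hv⟩
  have hcomm : ∀ w, BC w → cv ν (cv M w) = cv M (cv ν w) := fun w hw => funext fun x => cv_comm hw x
  set F := cv M v with hF
  set w₁ := cv ν F with hw₁
  set w₂ := cv ν w₁ with hw₂
  have hFBC : BC F := hvBC.cv
  have hw₁BC : BC w₁ := hFBC.cv
  have hw₂BC : BC w₂ := hw₁BC.cv
  have hFb : ∀ x, |F x| ≤ M₀ := abs_cv_le hv
  have hw₁b : ∀ x, |w₁ x| ≤ M₀ := abs_cv_le hFb
  have hw₂b : ∀ x, |w₂ x| ≤ M₀ := abs_cv_le hw₁b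
  have hFγ : ∀ x k, |d2 F x k| ≤ ‖k‖ ^ γ := fun x k => abs_d2_cv_le hvBC (fun x => hvγ x k) x
  have hw₁γ : ∀ x k, |d2 w₁ x k| ≤ ‖k‖ ^ γ := fun x k => abs_d2_cv_le hFBC (fun x => hFγ x k) x
  have hw₂γ : ∀ x k, |d2 w₂ x k| ≤ ‖k‖ ^ γ := fun x k => abs_d2_cv_le hw₁BC (fun x => hw₁γ x k) x
  have hFN := (hMv v hvBC hvγ).2
  have hw₁N : ∀ x k, |d2 w₁ x k| ≤ N * ‖k‖ ^ 2 := fun x k =>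
    abs_d2_cv_le hFBC (fun x => hFN x k) x
  have hw₂N : ∀ x k, |d2 w₂ x k| ≤ N * ‖k‖ ^ 2 := fun x k =>
    abs_d2_cv_le hw₁BC (fun x => hw₁N x k) x
  have hw₁c : ContDiff ℝ 1 w₁ := by
    rw [hw₁, hF, hcomm v hvBC]
    exact (hMc _ hvBC.cv).of_le (by norm_num)
  have hw₂c : ContDiff ℝ 1 w₂ := by
    rw [hw₂, hw₁, hF, hcomm v hvBC, hcomm _ hvBC.cv]
    exact (hMc _ hvBC.cv.cv).of_le (by norm_num)
  have heq₁ : ∀ x, Integrable (fun y => d2 w₁ x y) (K x) ∧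
      |(∫ y, d2 w₁ x y ∂(K x)) - 2 * (w₁ x - F x) / θ| ≤ κ / (16 * θ) := fun x => by
    rw [← integral_d2_eq_of_isRes (hK 0) hθ hres hFBC]
    exact herr (K x) (K 0) (hK x) (hK 0) (hKC x 0) w₁ hw₁c hw₁γ hw₁N x
  have heq₂ : ∀ x, Integrable (fun y => d2 w₂ x y) (K x) ∧
      |(∫ y, d2 w₂ x y ∂(K x)) - 2 * (w₂ x - w₁ x) / θ| ≤ κ / (16 * θ) := fun x => by
    rw [← integral_d2_eq_of_isRes (hK 0) hθ hres hw₁BC]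
    exact herr (K x) (K 0) (hK x) (hK 0) (hKC x 0) w₂ hw₂c hw₂γ hw₂N x
  have hD4 : 0 < D / 4 := by linarith
  set p : ℝ := P * (D / 4) ^ (-(2 * s)) with hp
  have hp0 : 0 ≤ p := by positivity
  set c : ℝ := θ / 2 * (F₀ + κ / (16 * θ) + 4 * M₀ * p) with hc
  have hc0 : 0 ≤ c := by positivity
  have hb₁ : ∀ z ∈ ball (0 : Euc n) (D / 2), |v z - w₁ z| ≤ a ^ γ + c := fun z hz =>
    abs_sub_le_of_equation (D := D / 4) hθ hD4 (by positivity) hF₀ (by positivity) hp0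
      (fun x => hmin (K x) (hK x) _ hD4) hvc hw₁BC.cont hv hw₁b
      (fun x _ => (hMv v hvBC hvγ).1 x) (fun x hx => hveq x (by
        rw [mem_ball_zero_iff] at hz ⊢
        rw [mem_ball_iff_norm] at hx
        linarith [norm_le_norm_add_norm_sub' x z])) heq₁
  have hb₂ : ∀ z, ‖z‖ ≤ 1 → |v z - w₂ z| ≤ a ^ γ + c + c := fun z hz =>
    abs_sub_le_of_equation (D := D / 4) hθ hD4 (by positivity) hF₀ (by positivity) hp0
      (fun x => hmin (K x) (hK x) _ hD4) hvc hw₂BC.cont hv hw₂b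
      (fun x hx => hb₁ x (by
        rw [mem_ball_zero_iff]
        rw [mem_ball_iff_norm] at hx
        linarith [norm_le_norm_add_norm_sub' x z])) (fun x hx => hveq x (by
        rw [mem_ball_zero_iff]
        rw [mem_ball_iff_norm] at hx
        linarith [norm_le_norm_add_norm_sub' x z])) heq₂
  have h1 := hsm (K 0) (hK 0) ε R hε hεr hR ν hν hres v hvBC hvγ h hh 0
  have b1 := hb₂ (0 + h) (by simp [hh])
  have b2 := hb₂ (0 - h) (by simp [hh])
  have b3 := hb₂ 0 (by simp)
  have hfinal : |d2 v 0 h| ≤ κ / 2 + 4 * (a ^ γ + c + c) := by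
    change |d2 w₂ 0 h| ≤ _ at h1
    simp only [d2] at h1 ⊢
    rw [abs_le] at *
    constructor <;> linarith [b1.1, b1.2, b2.1, b2.2, b3.1, b3.2, h1.1, h1.2]
  have hpq : p = P * (q * D ^ (-(2 * s))) := by
    rw [hp, Real.div_rpow (by linarith) (by norm_num), Real.rpow_neg (by norm_num : (0 : ℝ) ≤ 4),
      div_inv_eq_mul, mul_comm (D ^ _)]
  have hE : 0 ≤ D ^ (-(2 * s)) := by positivity
  have hc' : c = θ / 2 * F₀ + κ / 32 + 2 * θ * (M₀ * (P * (q * D ^ (-(2 * s))))) := by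
    rw [hc, hpq]; field_simp; ring
  rw [haγ, hc'] at hfinal
  have hX : 0 ≤ M₀ * D ^ (-(2 * s)) := by positivity
  have hX' : 0 ≤ P * q * F₀ := by positivity
  have h10 : κ / 2 + 4 * (κ / 16 + (θ / 2 * F₀ + κ / 32 + 2 * θ * (M₀ * (P * (q * D ^ (-(2 * s)))))) +
      (θ / 2 * F₀ + κ / 32 + 2 * θ * (M₀ * (P * (q * D ^ (-(2 * s))))))) =
      κ + 4 * θ * F₀ + 16 * θ * P * q * (M₀ * D ^ (-(2 * s))) := by ring
  rw [h10] at hfinal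
  have h11 : 4 * θ * (1 + 4 * P * q) * (F₀ + M₀ * D ^ (-(2 * s))) = 4 * θ * F₀ +
      16 * θ * P * q * (M₀ * D ^ (-(2 * s))) + (16 * θ * (P * q * F₀) +
      4 * θ * (M₀ * D ^ (-(2 * s)))) := by ring
  rw [h11]
  have h12 : 0 ≤ 16 * θ * (P * q * F₀) + 4 * θ * (M₀ * D ^ (-(2 * s))) := by positivity
  linarith

/-- The kernel seen at scale `ρ`. -/
def sc (s ρ : ℝ) (K : Measure (Euc n)) : Measure (Euc n) :=
  ENNReal.ofReal (ρ ^ (2 * s)) • Measure.map (fun y => ρ⁻¹ • y) K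

section scaling

variable {s ρ : ℝ} {K : Measure (Euc n)}

lemma measurableEmbedding_inv_smul (hρ : 0 < ρ) :
    MeasurableEmbedding (fun y : Euc n => ρ⁻¹ • y) :=
  measurableEmbedding_const_smul₀ (inv_ne_zero hρ.ne')

lemma preimage_inv_smul_ball (hρ : 0 < ρ) (r : ℝ) :
    (fun y : Euc n => ρ⁻¹ • y) ⁻¹' ball 0 r = ball 0 (ρ * r) := by
  ext y
  simp only [mem_preimage, mem_ball_zero_iff, norm_smul, norm_inv, Real.norm_of_nonneg hρ.le]
  rw [inv_mul_lt_iff₀ hρ]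

lemma preimage_inv_smul_annulus (hρ : 0 < ρ) (r : ℝ) :
    (fun y : Euc n => ρ⁻¹ • y) ⁻¹' (ball 0 (2 * r) \ ball 0 r) =
      ball 0 (2 * (ρ * r)) \ ball 0 (ρ * r) := by
  rw [preimage_sdiff, preimage_inv_smul_ball hρ, preimage_inv_smul_ball hρ]
  ring_nf

lemma integral_sc (hρ : 0 < ρ) (φ : Euc n → ℝ) :
    ∫ y, φ y ∂(sc s ρ K) = ρ ^ (2 * s) * ∫ y, φ (ρ⁻¹ • y) ∂K := by
  rw [sc, integral_smul_measure, (measurableEmbedding_inv_smul hρ).integral_map,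
    ENNReal.toReal_ofReal (by positivity), smul_eq_mul]

lemma setIntegral_sc (hρ : 0 < ρ) (φ : Euc n → ℝ) (S : Set (Euc n)) :
    ∫ y in S, φ y ∂(sc s ρ K) =
      ρ ^ (2 * s) * ∫ y in (fun y : Euc n => ρ⁻¹ • y) ⁻¹' S, φ (ρ⁻¹ • y) ∂K := by
  rw [sc, Measure.restrict_smul, integral_smul_measure,
    (measurableEmbedding_inv_smul hρ).setIntegral_map,
    ENNReal.toReal_ofReal (by positivity), smul_eq_mul]

lemma integrable_sc (hρ : 0 < ρ) {φ : Euc n → ℝ} (h : Integrable (fun y => φ (ρ⁻¹ • y)) K) :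
    Integrable φ (sc s ρ K) := by
  refine Integrable.smul_measure ?_ ENNReal.ofReal_ne_top
  rwa [(measurableEmbedding_inv_smul hρ).integrable_map_iff]

lemma Adm.sc {lam Lam : ℝ} (hK : Adm s lam Lam K) (hρ : 0 < ρ) :
    Adm s lam Lam (sc s ρ K) := by
  have hem := measurableEmbedding_inv_smul (n := n) hρ
  refine ⟨?_, ?_, fun r hr => ?_, fun r hr e he => ?_⟩
  · rw [_root_.sc, Measure.smul_apply, hem.map_apply]
    have : (fun y : Euc n => ρ⁻¹ • y) ⁻¹' {0} = {0} := by ext y; simp [hρ.ne']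
    rw [this, hK.zero, smul_zero]
  · rw [_root_.sc, Measure.map_smul, Measure.map_map measurable_neg hem.measurable]
    conv_rhs => rw [← hK.symm, Measure.map_map hem.measurable measurable_neg]
    congr 2
    funext y
    simp
  · rw [_root_.sc, Measure.smul_apply, hem.map_apply, preimage_inv_smul_annulus hρ, smul_eq_mul]
    refine (mul_le_mul_right (hK.upper (ρ * r) (by positivity)) _).trans (le_of_eq ?_)
    rw [← ENNReal.ofReal_mul (by positivity), Real.mul_rpow hρ.le hr.le, Real.rpow_neg hρ.le]
    congr 1
    field_simp
  · rw [_root_.sc, Measure.restrict_smul, lintegral_smul_measure, Measure.restrict_map hem.measurable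
      measurableSet_ball, hem.lintegral_map, preimage_inv_smul_ball hρ, smul_eq_mul]
    have h1 : ∀ y : Euc n, ENNReal.ofReal (⟪e, ρ⁻¹ • y⟫ ^ 2) =
        ENNReal.ofReal (ρ⁻¹ ^ 2) * ENNReal.ofReal (⟪e, y⟫ ^ 2) := fun y => by
      rw [← ENNReal.ofReal_mul (by positivity), real_inner_smul_right, mul_pow]
    simp_rw [h1]
    rw [lintegral_const_mul' _ _ ENNReal.ofReal_ne_top, ← mul_assoc,
      ← ENNReal.ofReal_mul (by positivity)]
    refine le_trans (le_of_eq ?_) (mul_le_mul_right (hK.lower (ρ * r) (by positivity) e he) _)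
    rw [← ENNReal.ofReal_mul (by positivity), Real.mul_rpow hρ.le hr.le, Real.rpow_sub hρ,
      Real.rpow_two]
    congr 1
    field_simp

lemma HE.comp_inv_smul {β : ℝ} {φ : Euc n → ℝ} (hφ : HE β φ) (hρ : 0 < ρ) :
    HE β fun y => ρ ^ β * φ (ρ⁻¹ • y) := by
  have hn : ∀ y y' : Euc n, ‖ρ⁻¹ • y - ρ⁻¹ • y'‖ = ρ⁻¹ * ‖y - y'‖ := fun y y' => by
    rw [← smul_sub, norm_smul, norm_inv, Real.norm_of_nonneg hρ.le]
  rcases hφ with ⟨hb, h⟩ | ⟨hb, hc, h⟩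
  · refine Or.inl ⟨hb, fun y y' => ?_⟩
    rw [← mul_sub, abs_mul, abs_of_pos (by positivity)]
    calc _ ≤ ρ ^ β * ‖ρ⁻¹ • y - ρ⁻¹ • y'‖ ^ β := by gcongr; exact h _ _
      _ = _ := by
        rw [hn, Real.mul_rpow (by positivity) (norm_nonneg _), Real.inv_rpow hρ.le,
          mul_inv_cancel_left₀ (by positivity)]
  · refine Or.inr ⟨hb, by fun_prop, fun y y' => ?_⟩
    have hd : ∀ y, fderiv ℝ (fun y => ρ ^ β * φ (ρ⁻¹ • y)) y =
        (ρ ^ β * ρ⁻¹) • fderiv ℝ φ (ρ⁻¹ • y) := fun y => by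
      have h1 := (hc.differentiable one_ne_zero (ρ⁻¹ • y)).hasFDerivAt.comp y
        ((hasFDerivAt_id y).const_smul ρ⁻¹)
      refine (h1.const_mul (ρ ^ β)).fderiv.trans ?_
      ext z
      simp [mul_assoc]
    rw [hd, hd, ← smul_sub, norm_smul, Real.norm_of_nonneg (by positivity)]
    calc _ ≤ ρ ^ β * ρ⁻¹ * ‖ρ⁻¹ • y - ρ⁻¹ • y'‖ ^ (β - 1) := by gcongr; exact h _ _
      _ = _ := by
        rw [hn, Real.mul_rpow (by positivity) (norm_nonneg _), Real.inv_rpow hρ.le,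
          Real.rpow_sub_one hρ.ne']
        field_simp

lemma KC.sc {β η : ℝ} {μ ν : Measure (Euc n)} (h : KC s β η μ ν) (hρ : 0 < ρ) :
    KC s β η (sc s ρ μ) (sc s ρ ν) := by
  intro r hr φ hφ hφ0
  rw [setIntegral_sc hρ, setIntegral_sc hρ, preimage_inv_smul_annulus hρ]
  have h1 := h (ρ * r) (by positivity) _ (hφ.comp_inv_smul hρ) (by simp [hφ0])
  rw [integral_const_mul, integral_const_mul, ← mul_sub, abs_mul, abs_of_pos (by positivity)] at h1
  rw [← mul_sub, abs_mul, abs_of_pos (by positivity)]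
  have e : η * (ρ * r) ^ (β - 2 * s) = ρ ^ β * (η * r ^ (β - 2 * s) / ρ ^ (2 * s)) := by
    rw [Real.mul_rpow hρ.le hr.le, Real.rpow_sub hρ]
    ring
  rw [e] at h1
  have h2 := le_of_mul_le_mul_left h1 (by positivity)
  rwa [le_div_iff₀' (by positivity)] at h2

lemma d2_comp_add_smul (v : Euc n → ℝ) (x₀ y k : Euc n) :
    d2 (fun y => v (x₀ + ρ • y)) y k = d2 v (x₀ + ρ • y) (ρ • k) := by
  simp only [d2, smul_add, smul_sub, add_assoc, add_sub_assoc]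

lemma integral_d2_sc (hρ : 0 < ρ) {v : Euc n → ℝ} {x₀ y : Euc n}
    (h : Integrable (fun k => d2 v (x₀ + ρ • y) k) K) :
    Integrable (fun k => d2 (fun y => v (x₀ + ρ • y)) y k) (sc s ρ K) ∧
    ∫ k, d2 (fun y => v (x₀ + ρ • y)) y k ∂(sc s ρ K) =
      ρ ^ (2 * s) * ∫ k, d2 v (x₀ + ρ • y) k ∂K := by
  have e : (fun k => d2 (fun y => v (x₀ + ρ • y)) y (ρ⁻¹ • k)) =
      fun k => d2 v (x₀ + ρ • y) k := by
    funext k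
    rw [d2_comp_add_smul, smul_inv_smul₀ hρ.ne']
  refine ⟨integrable_sc hρ (by rwa [e]), ?_⟩
  rw [integral_sc hρ, e]

end scaling

lemma d2_const_mul (c : ℝ) (v : Euc n → ℝ) (x k : Euc n) :
    d2 (fun x => c * v x) x k = c * d2 v x k := by
  simp only [d2]; ring

lemma exists_scaled_estimate (n : ℕ) {s β γ lam Lam κ : ℝ} (hs : s ∈ Ioo (0 : ℝ) 1)
    (hlam : 0 < lam) (hLam : 0 < Lam) (hβ : 0 < β) (hγ0 : 0 < γ) (hγ : γ < 2 * s)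
    (hβγ : β ≤ 1 ∨ γ = β) (hκ : 0 < κ) :
    ∃ η > 0, ∃ C > 0, ∀ K : Euc n → Measure (Euc n), (∀ x, Adm s lam Lam (K x)) →
      (∀ x x', KC s β η (K x) (K x')) → ∀ (v : Euc n → ℝ) (M₀ F₀ N r : ℝ) (x₀ : Euc n),
      Continuous v → (∀ x, |v x| ≤ M₀) → 0 < N → (∀ x k, |d2 v x k| ≤ N * ‖k‖ ^ γ) → 0 ≤ F₀ →
      (∀ x ∈ ball x₀ r, Integrable (fun y => d2 v x y) (K x) ∧ |∫ y, d2 v x y ∂(K x)| ≤ F₀) →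
      ∀ h, h ≠ 0 → 4 * ‖h‖ ≤ r →
        |d2 v x₀ h| ≤ κ * N * ‖h‖ ^ γ + C * (F₀ + M₀ * r ^ (-(2 * s))) * ‖h‖ ^ (2 * s) := by
  obtain ⟨η, hη, C, hC, H⟩ := exists_unit_estimate n hs hlam hLam hβ hγ0 hγ hβγ hκ
  refine ⟨η, hη, C, hC, fun K hK hKC v M₀ F₀ N r x₀ hvc hv hN hvγ hF₀ hveq h hh0 hhr => ?_⟩
  set ρ := ‖h‖ with hρ
  have hρ0 : 0 < ρ := norm_pos_iff.2 hh0
  have hr : 0 < r := by linarith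
  set c : ℝ := (N * ρ ^ γ)⁻¹ with hc
  have hc0 : 0 < c := by positivity
  have hNc : N * ρ ^ γ * c = 1 := mul_inv_cancel₀ (by positivity)
  have := H (fun y => sc s ρ (K (x₀ + ρ • y))) (fun y => (hK _).sc hρ0)
    (fun y y' => (hKC _ _).sc hρ0) (fun y => c * v (x₀ + ρ • y)) (c * M₀) (c * (ρ ^ (2 * s) * F₀))
    (r / ρ) (by fun_prop) (fun y => by
      rw [abs_mul, abs_of_pos hc0]; gcongr; exact hv _) (fun y k => by
      rw [d2_const_mul, d2_comp_add_smul, abs_mul, abs_of_pos hc0]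
      refine (mul_le_mul_of_nonneg_left (hvγ _ _) hc0.le).trans (le_of_eq ?_)
      rw [norm_smul, Real.norm_of_nonneg hρ0.le, Real.mul_rpow hρ0.le (norm_nonneg _)]
      linear_combination ‖k‖ ^ γ * hNc) (by rw [le_div_iff₀ hρ0]; exact hhr) (by positivity)
    (fun y hy => by
      have hy' : x₀ + ρ • y ∈ ball x₀ r := by
        rw [mem_ball_zero_iff, lt_div_iff₀ hρ0] at hy
        rw [mem_ball_iff_norm, add_sub_cancel_left, norm_smul, Real.norm_of_nonneg hρ0.le]
        linarith
      obtain ⟨h1, h2⟩ := hveq _ hy'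
      obtain ⟨h3, h4⟩ := integral_d2_sc (s := s) hρ0 h1
      simp only [d2_const_mul, integral_const_mul]
      refine ⟨h3.const_mul c, ?_⟩
      rw [h4, abs_mul, abs_mul, abs_of_pos hc0, abs_of_pos (by positivity)]
      gcongr) (ρ⁻¹ • h) (by rw [norm_smul, norm_inv, norm_norm, inv_mul_cancel₀ hρ0.ne'])
  rw [d2_const_mul, d2_comp_add_smul, smul_zero, add_zero, smul_inv_smul₀ hρ0.ne', abs_mul,
    abs_of_pos hc0, Real.div_rpow hr.le hρ0.le, Real.rpow_neg hρ0.le, div_inv_eq_mul] at this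
  have h5 := mul_le_mul_of_nonneg_left this (by positivity : 0 ≤ N * ρ ^ γ)
  rw [← mul_assoc, hNc, one_mul] at h5
  refine h5.trans (le_of_eq ?_)
  linear_combination C * (ρ ^ (2 * s) * F₀ + M₀ * (r ^ (-(2 * s)) * ρ ^ (2 * s))) * hNc

/-- Modifying a function away from the base point changes the operator by a bounded amount. -/
lemma exists_integral_d2_sub_le (n : ℕ) {s lam Lam p δ : ℝ}
    (hLam : 0 < Lam) (hp : 0 ≤ p) (hps : p < 2 * s) (hδ : 0 < δ) :
    ∃ C > 0, ∀ K : Measure (Euc n), Adm s lam Lam K → ∀ (u v : Euc n → ℝ) (x : Euc n) (A : ℝ),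
      0 ≤ A → Continuous v → Integrable (fun y => d2 u x y) K →
      (∀ y, ‖y‖ < δ → d2 v x y = d2 u x y) →
      (∀ y, δ ≤ ‖y‖ → |d2 v x y - d2 u x y| ≤ A * (1 + ‖y‖ ^ p)) →
      Integrable (fun y => d2 v x y) K ∧ |(∫ y, d2 v x y ∂K) - ∫ y, d2 u x y ∂K| ≤ C * A := by
  obtain ⟨C0, hC0, h0⟩ := exists_lintegral_compl_ball_le n (s := s) (lam := lam) (p := 0) hLam le_rfl
    (by linarith)
  obtain ⟨C1, hC1, h1⟩ := exists_lintegral_compl_ball_le n (s := s) (lam := lam) (p := p) hLam hp hps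
  set B : ℝ := C0 * δ ^ (0 - 2 * s) + C1 * δ ^ (p - 2 * s) with hB
  have hB0 : 0 < B := by positivity
  refine ⟨B, hB0, fun K hK u v x A hA hv hu hnear hfar => ?_⟩
  have hm : AEStronglyMeasurable (fun y => d2 v x y - d2 u x y) K :=
    (continuous_d2 hv x).aestronglyMeasurable.sub hu.aestronglyMeasurable
  have hlin : ∫⁻ y in (ball (0 : Euc n) δ)ᶜ, ENNReal.ofReal (1 + ‖y‖ ^ p) ∂K ≤
      ENNReal.ofReal B := by
    have e : ∀ y : Euc n, ENNReal.ofReal (1 + ‖y‖ ^ p) =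
        ENNReal.ofReal (‖y‖ ^ (0 : ℝ)) + ENNReal.ofReal (‖y‖ ^ p) := fun y => by
      rw [Real.rpow_zero, ENNReal.ofReal_add zero_le_one (by positivity)]
    simp_rw [e]
    rw [lintegral_add_left (by fun_prop), hB, ENNReal.ofReal_add (by positivity) (by positivity)]
    exact add_le_add (h0 K hK δ hδ) (h1 K hK δ hδ)
  obtain ⟨hi, hb⟩ := integrableOn_and_abs_le (K := K) (φ := fun y => d2 v x y - d2 u x y)
    (g := fun y => 1 + ‖y‖ ^ p) measurableSet_ball.compl hA hB0.le
    hm.restrict (fun y hy => hfar y (by simpa using hy)) hlin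
  have hz : ∀ y, y ∉ (ball (0 : Euc n) δ)ᶜ → d2 v x y - d2 u x y = 0 := fun y hy => by
    rw [hnear y (by simpa using hy), sub_self]
  have hi' : Integrable (fun y => d2 v x y - d2 u x y) K :=
    (integrableOn_iff_integrable_of_support_subset fun y hy => by
      by_contra hc; exact hy (hz y hc)).1 hi
  rw [setIntegral_eq_integral_of_forall_compl_eq_zero hz] at hb
  have hv' : Integrable (fun y => d2 v x y) K := by
    have : Integrable (fun y => (d2 v x y - d2 u x y) + d2 u x y) K := hi'.add hu
    simpa using this
  refine ⟨hv', ?_⟩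
  rw [← integral_sub hv' hu, mul_comm]
  exact hb

lemma abs_sub_le_of_d2 {f : Euc n → ℝ} {x : Euc n} {ρ α Φ M : ℝ} (hρ : 0 < ρ)
    (hα0 : 0 < α) (hα1 : α < 1) (hM : ∀ y, |f y| ≤ M) (hΦ : 0 ≤ Φ)
    (H : ∀ k, ‖k‖ ≤ ρ / 2 → |d2 f (x + k) k| ≤ Φ * ‖k‖ ^ α) :
    ∀ h, ‖h‖ ≤ ρ → |f (x + h) - f x| ≤ (Φ / (2 - 2 ^ α) + 2 * M / (ρ / 2) ^ α) * ‖h‖ ^ α := by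
  have hM0 : 0 ≤ M := (abs_nonneg _).trans (hM 0)
  have h2 : 0 < 2 - (2 : ℝ) ^ α := by
    have := Real.rpow_lt_rpow_of_exponent_lt (x := 2) one_lt_two hα1
    rw [Real.rpow_one] at this
    linarith
  have hρα : 0 < (ρ / 2) ^ α := by positivity
  set A : ℝ := Φ / (2 - 2 ^ α) + 2 * M / (ρ / 2) ^ α with hA
  have hA1 : Φ ≤ A * (2 - 2 ^ α) := by
    rw [← div_le_iff₀ h2]
    exact le_add_of_nonneg_right (by positivity)
  have hA2 : 2 * M ≤ A * (ρ / 2) ^ α := by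
    rw [← div_le_iff₀ hρα]
    exact le_add_of_nonneg_left (by positivity)
  have hA0 : 0 ≤ A := by positivity
  have key : ∀ m : ℕ, ∀ h : Euc n, ρ / 2 < 2 ^ m * ‖h‖ → ‖h‖ ≤ ρ →
      |f (x + h) - f x| ≤ A * ‖h‖ ^ α := by
    intro m
    induction m with
    | zero =>
      intro h h1 _
      rw [pow_zero, one_mul] at h1
      calc _ ≤ |f (x + h)| + |f x| := abs_sub _ _
        _ ≤ 2 * M := by linarith [hM (x + h), hM x]
        _ ≤ A * (ρ / 2) ^ α := hA2
        _ ≤ _ := by gcongr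
    | succ m ih =>
      intro h h1 h3
      rcases lt_or_ge (ρ / 2) ‖h‖ with h4 | h4
      · calc _ ≤ |f (x + h)| + |f x| := abs_sub _ _
          _ ≤ 2 * M := by linarith [hM (x + h), hM x]
          _ ≤ A * (ρ / 2) ^ α := hA2
          _ ≤ _ := by gcongr
      · have hn : ‖h + h‖ = 2 * ‖h‖ := by rw [← two_smul ℝ, norm_smul]; simp
        have a1 := ih (h + h) (by rw [hn]; rw [pow_succ] at h1; linarith) (by rw [hn]; linarith)
        have a2 := H h h4
        rw [hn, Real.mul_rpow (by norm_num) (norm_nonneg _)] at a1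
        have e : d2 f (x + h) h = f (x + (h + h)) - f x - 2 * (f (x + h) - f x) := by
          simp only [d2, add_sub_cancel_right, add_assoc]; ring
        rw [e] at a2
        have a3 := mul_le_mul_of_nonneg_right hA1 (Real.rpow_nonneg (norm_nonneg h) α)
        rw [abs_le] at *
        constructor <;> nlinarith [a1.1, a1.2, a2.1, a2.2]
  intro h hh
  rcases eq_or_ne h 0 with rfl | h0
  · simp [Real.zero_rpow hα0.ne']
  have hn : 0 < ‖h‖ := norm_pos_iff.2 h0
  obtain ⟨m, hm⟩ := pow_unbounded_of_one_lt (ρ / 2 / ‖h‖) (one_lt_two (α := ℝ))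
  rw [div_lt_iff₀ hn] at hm
  exact key m h hm hh

lemma exists_cutoff (n : ℕ) {r R : ℝ} (hr : 0 < r) (hrR : r < R) :
    ∃ ζ : Euc n → ℝ, Continuous ζ ∧ (∀ x, 0 ≤ ζ x) ∧ (∀ x, ζ x ≤ 1) ∧
      (∀ x, ‖x‖ ≤ r → ζ x = 1) ∧ (∀ x, R ≤ ‖x‖ → ζ x = 0) ∧
      ∃ L > 0, (∀ x y, |ζ x - ζ y| ≤ L * ‖x - y‖) ∧ ∀ x k, |d2 ζ x k| ≤ L * ‖k‖ ^ 2 := by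
  obtain ⟨B, hBin, hBout⟩ : ∃ B : ContDiffBump (0 : Euc n), B.rIn = r ∧ B.rOut = R :=
    ⟨⟨r, R, hr, hrR⟩, rfl, rfl⟩
  obtain ⟨L, hL, hLk⟩ := exists_d2_le_sq (B.contDiff (n := 2)) B.hasCompactSupport
  obtain ⟨L', hL'⟩ := (B.contDiff (n := 1)).lipschitzWith_of_hasCompactSupport
    B.hasCompactSupport (by norm_num)
  refine ⟨B, B.continuous, fun x => B.nonneg, fun x => B.le_one, fun x hx => ?_, fun x hx => ?_,
    L + L', by positivity, fun x y => ?_, fun x k => ?_⟩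
  · exact B.one_of_mem_closedBall (by rw [hBin]; simpa using hx)
  · exact B.zero_of_le_dist (by rw [hBout]; simpa using hx)
  · have := hL'.dist_le_mul x y
    rw [Real.dist_eq, dist_eq_norm] at this
    refine this.trans ?_
    gcongr
    linarith
  · refine (hLk x k).trans ?_
    gcongr
    exact le_add_of_nonneg_right L'.2

lemma exists_mul_cutoff (n : ℕ) {γ : ℝ} (hγ0 : 0 < γ) (hγ2 : γ < 2) :
    ∃ ζ : Euc n → ℝ, Continuous ζ ∧ (∀ x, 0 ≤ ζ x) ∧ (∀ x, ζ x ≤ 1) ∧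
      (∀ x, ‖x‖ ≤ 1 / 2 → ζ x = 1) ∧ ∃ A > 0, ∀ (v : Euc n → ℝ) (M Φ : ℝ), (∀ x, |v x| ≤ M) →
      0 ≤ Φ →
      (∀ x k, x + k ∈ ball 0 1 → x - k ∈ ball 0 1 → |d2 v x k| ≤ Φ * ‖k‖ ^ γ) →
      ∀ x k, |d2 (fun x => ζ x * v x) x k| ≤ A * (Φ + M) * ‖k‖ ^ γ := by
  obtain ⟨ζ, hc, h0, h1, hin, hout, L, hL, hLip, hd2⟩ := exists_cutoff n (r := 1 / 2) (R := 3 / 4)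
    (by norm_num) (by norm_num)
  obtain ⟨c, hc0, hFD⟩ : ∃ c > 0, ∀ (v : Euc n → ℝ) (M Φ : ℝ), (∀ x, |v x| ≤ M) → 0 ≤ Φ →
      (∀ x k, x + k ∈ ball 0 1 → x - k ∈ ball 0 1 → |d2 v x k| ≤ Φ * ‖k‖ ^ γ) →
      ∀ x k, ‖x‖ < 13 / 16 → ‖k‖ ≤ 1 / 32 →
        |v (x + k) - v (x - k)| * ‖k‖ ≤ c * (Φ + M) * ‖k‖ ^ γ := by
    rcases le_or_gt γ 1 with hγ | hγ
    · refine ⟨2, two_pos, fun v M Φ hv hΦ _ x k _ hk => ?_⟩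
      have hM := (abs_nonneg _).trans (hv 0)
      have a1 : |v (x + k) - v (x - k)| ≤ 2 * (Φ + M) :=
        (abs_sub _ _).trans (by linarith [hv (x + k), hv (x - k)])
      gcongr
      exact Real.self_le_rpow_of_le_one (norm_nonneg _) (by linarith) hγ
    · have h2 : 0 < 2 - (2 : ℝ) ^ (γ - 1) := by
        have := Real.rpow_lt_rpow_of_exponent_lt (x := 2) (y := γ - 1) (z := 1) one_lt_two
          (by linarith)
        rw [Real.rpow_one] at this
        linarith
      set a : ℝ := 1 / (2 - 2 ^ (γ - 1)) with ha
      set b : ℝ := 2 / ((1 / 16 : ℝ) / 2) ^ (γ - 1) with hb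
      refine ⟨(a + b) * 2 ^ (γ - 1), by positivity, fun v M Φ hv hΦ hz x k hx hk => ?_⟩
      have hM := (abs_nonneg _).trans (hv 0)
      have a1 := abs_sub_le_of_d2 (f := v) (x := x - k) (ρ := 1 / 16) (α := γ - 1) (Φ := Φ) (M := M)
        (by norm_num) (by linarith) (by linarith) hv hΦ (fun k' hk' => by
          have hb' : ‖x - k‖ ≤ 13 / 16 + 1 / 32 := (norm_sub_le _ _).trans (by linarith)
          refine (hz _ _ ?_ ?_).trans ?_
          · rw [mem_ball_zero_iff, add_assoc]
            have := norm_add_le (x - k) (k' + k')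
            linarith [norm_add_le k' k']
          · rw [mem_ball_zero_iff, add_sub_cancel_right]
            linarith
          · refine mul_le_mul_of_nonneg_left ?_ hΦ
            rcases eq_or_ne k' 0 with rfl | hk0
            · rw [norm_zero, Real.zero_rpow (by linarith), Real.zero_rpow (by linarith)]
            · exact Real.rpow_le_rpow_of_exponent_ge (norm_pos_iff.2 hk0) (by linarith)
                (by linarith)) (k + k) ((norm_add_le _ _).trans (by linarith))
      rw [show x - k + (k + k) = x + k by abel, ← two_smul ℝ k, norm_smul, Real.norm_two,
        Real.mul_rpow two_pos.le (norm_nonneg _)] at a1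
      rcases eq_or_ne k 0 with rfl | hk0
      · simp [Real.zero_rpow hγ0.ne']
      have hk0' := norm_pos_iff.2 hk0
      have e : ‖k‖ ^ γ = ‖k‖ ^ (γ - 1) * ‖k‖ := by
        rw [Real.rpow_sub_one hk0'.ne', div_mul_cancel₀ _ hk0'.ne']
      rw [e, ← mul_assoc]
      refine mul_le_mul_of_nonneg_right (a1.trans ?_) (norm_nonneg _)
      have e2 : Φ / (2 - 2 ^ (γ - 1)) = a * Φ := by rw [ha]; ring
      have e3 : 2 * M / ((1 / 16 : ℝ) / 2) ^ (γ - 1) = b * M := by rw [hb]; ring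
      rw [e2, e3]
      have a0 : 0 < a := by positivity
      have b0 : 0 < b := by positivity
      have : a * Φ + b * M ≤ (a + b) * (Φ + M) := by nlinarith [mul_nonneg a0.le hM, mul_nonneg b0.le hΦ]
      calc _ ≤ (a + b) * (Φ + M) * (2 ^ (γ - 1) * ‖k‖ ^ (γ - 1)) := by gcongr
        _ = _ := by ring
  refine ⟨ζ, hc, h0, h1, hin, 4 * 32 ^ γ + 1 + c * L + L, by positivity,
    fun v M Φ hv hΦ hz x k => ?_⟩
  have hM := (abs_nonneg _).trans (hv 0)
  have hk0 : 0 ≤ ‖k‖ ^ γ := by positivity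
  rcases lt_or_ge (1 / 32) ‖k‖ with hk | hk
  · have hb : ∀ x, |ζ x * v x| ≤ M := fun x => by
      rw [abs_mul, abs_of_nonneg (h0 x)]
      exact (mul_le_of_le_one_left (abs_nonneg _) (h1 x)).trans (hv x)
    have h3 : |d2 (fun x => ζ x * v x) x k| ≤ 4 * M := by
      have b1 := hb (x + k)
      have b2 := hb (x - k)
      have b3 := hb x
      simp only [d2]
      rw [abs_le] at *
      constructor <;> linarith [b1.1, b1.2, b2.1, b2.2, b3.1, b3.2]
    have h4 : 1 ≤ 32 ^ γ * ‖k‖ ^ γ := by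
      rw [← Real.mul_rpow (by norm_num) (norm_nonneg _)]
      exact Real.one_le_rpow (by linarith) hγ0.le
    calc _ ≤ 4 * M := h3
      _ ≤ 4 * (Φ + M) * (32 ^ γ * ‖k‖ ^ γ) := by nlinarith
      _ = (4 * 32 ^ γ) * (Φ + M) * ‖k‖ ^ γ := by ring
      _ ≤ _ := by gcongr; nlinarith [mul_pos hc0 hL]
  rcases lt_or_ge ‖x‖ (13 / 16) with hx | hx
  · have hsq : ‖k‖ ^ 2 ≤ ‖k‖ ^ γ := by
      rw [← Real.rpow_two]
      exact Real.rpow_le_rpow_of_exponent_ge' (norm_nonneg _) (by linarith) hγ0.le hγ2.le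
    have e : d2 (fun x => ζ x * v x) x k = ζ x * d2 v x k +
        (v (x + k) - v (x - k)) * (ζ (x + k) - ζ x) + v (x - k) * d2 ζ x k := by
      simp only [d2]; ring
    have t1 : |ζ x * d2 v x k| ≤ Φ * ‖k‖ ^ γ := by
      rw [abs_mul, abs_of_nonneg (h0 x)]
      refine (mul_le_of_le_one_left (abs_nonneg _) (h1 x)).trans (hz x k ?_ ?_)
      · rw [mem_ball_zero_iff]; linarith [norm_add_le x k]
      · rw [mem_ball_zero_iff]; linarith [norm_sub_le x k]
    have t2 : |(v (x + k) - v (x - k)) * (ζ (x + k) - ζ x)| ≤ L * (c * (Φ + M) * ‖k‖ ^ γ) := by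
      rw [abs_mul]
      have := hLip (x + k) x
      rw [add_sub_cancel_left] at this
      calc _ ≤ |v (x + k) - v (x - k)| * (L * ‖k‖) := by gcongr
        _ = L * (|v (x + k) - v (x - k)| * ‖k‖) := by ring
        _ ≤ _ := mul_le_mul_of_nonneg_left (hFD v M Φ hv hΦ hz x k hx hk) hL.le
    have t3 : |v (x - k) * d2 ζ x k| ≤ M * (L * ‖k‖ ^ γ) := by
      rw [abs_mul]
      exact mul_le_mul (hv _) ((hd2 x k).trans (by gcongr)) (abs_nonneg _) hM
    rw [e]
    refine (abs_add_three _ _ _).trans ?_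
    have h32 : (0 : ℝ) < 32 ^ γ := by positivity
    have p1 : 0 ≤ 4 * 32 ^ γ * (Φ + M) * ‖k‖ ^ γ := by positivity
    have p2 : 0 ≤ M * ‖k‖ ^ γ := by positivity
    have p3 : 0 ≤ L * Φ * ‖k‖ ^ γ := by positivity
    linarith
  · have e : d2 (fun x => ζ x * v x) x k = 0 := by
      have z1 : ζ (x + k) = 0 := hout _ (by
        have := norm_sub_le (x + k) k
        rw [add_sub_cancel_right] at this
        linarith)
      have z2 : ζ (x - k) = 0 := hout _ (by
        have := norm_add_le (x - k) k
        rw [sub_add_cancel] at this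
        linarith)
      have z3 : ζ x = 0 := hout _ (by linarith)
      simp [d2, z1, z2, z3]
    rw [e, abs_zero]
    positivity

lemma abs_d2_le {f : Euc n → ℝ} {M : ℝ} (hf : ∀ x, |f x| ≤ M) (x k : Euc n) :
    |d2 f x k| ≤ 4 * M := by
  have h1 := abs_le.1 (hf (x + k))
  have h2 := abs_le.1 (hf (x - k))
  have h3 := abs_le.1 (hf x)
  unfold d2
  exact abs_le.2 ⟨by linarith [h1.1, h2.1, h3.2], by linarith [h1.2, h2.2, h3.1]⟩

lemma exists_ball_estimate (n : ℕ) {s β γ lam Lam κ : ℝ} (hs : s ∈ Ioo (0 : ℝ) 1)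
    (hlam : 0 < lam) (hLam : 0 < Lam) (hβ : 0 < β) (hγ0 : 0 < γ) (hγ : γ < 2 * s)
    (hβγ : β ≤ 1 ∨ γ = β) (hκ : 0 < κ) :
    ∃ η > 0, ∃ C > 0, ∀ K : Euc n → Measure (Euc n), (∀ x, Adm s lam Lam (K x)) →
      (∀ x x', KC s β η (K x) (K x')) → ∀ (v : Euc n → ℝ) (M Φ : ℝ),
      Continuous v → 0 < M → (∀ x, |v x| ≤ M) → 0 ≤ Φ →
      (∀ x k, x + k ∈ ball 0 1 → x - k ∈ ball 0 1 → |d2 v x k| ≤ Φ * ‖k‖ ^ γ) →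
      (∀ x ∈ ball (0 : Euc n) 1,
        Integrable (fun y => d2 v x y) (K x) ∧ |∫ y, d2 v x y ∂(K x)| ≤ M) →
      ∀ h, ‖h‖ ≤ 1 / 16 → |d2 v 0 h| ≤ (κ * Φ + C * M) * ‖h‖ ^ γ := by
  obtain ⟨ζ, hζc, hζ0, hζ1, hζin, A, hA, hζd⟩ :=
    exists_mul_cutoff n hγ0 (hγ.trans (by linarith [hs.2]))
  obtain ⟨η, hη, C, hC, H⟩ := exists_scaled_estimate n (lam := lam) hs hlam hLam hβ hγ0 hγ hβγ
    (div_pos hκ hA)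
  obtain ⟨C', hC', H'⟩ := exists_integral_d2_sub_le n (s := s) (lam := lam) (δ := 1 / 4) hLam le_rfl
    (by linarith [hs.1]) (by norm_num)
  refine ⟨η, hη, κ + C * (1 + C' * 4 + (1 / 4 : ℝ) ^ (-(2 * s))), by positivity,
    fun K hK hKC v M Φ hvc hM hv hΦ hz heq h hh => ?_⟩
  set w : Euc n → ℝ := fun x => ζ x * v x with hw
  have hwM : ∀ x, |w x| ≤ M := fun x => by
    rw [hw]; simp only
    rw [abs_mul, abs_of_nonneg (hζ0 x)]
    exact (mul_le_of_le_one_left (abs_nonneg _) (hζ1 x)).trans (hv x)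
  have hwv : ∀ x k : Euc n, ‖x‖ < 1 / 4 → ‖k‖ < 1 / 4 → d2 w x k = d2 v x k := by
    intro x k hx hk
    have e1 := hζin (x + k) (by linarith [norm_add_le x k])
    have e2 := hζin (x - k) (by linarith [norm_sub_le x k])
    have e3 := hζin x (by linarith)
    simp only [d2, hw, e1, e2, e3, one_mul]
  rcases eq_or_ne h 0 with rfl | h0
  · rw [d2_zero, abs_zero]; positivity
  have := H K hK hKC w M (M + C' * (4 * M)) (A * (Φ + M)) (1 / 4) 0 (hζc.mul hvc) hwM
    (by positivity) (hζd v M Φ hv hΦ hz) (by positivity) (fun x hx => by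
      have hx' : ‖x‖ < 1 / 4 := by simpa using hx
      obtain ⟨hi, hb⟩ := heq x (by rw [mem_ball_zero_iff]; linarith)
      obtain ⟨hi', hb'⟩ := H' (K x) (hK x) v w x (4 * M) (by positivity) (hζc.mul hvc) hi
        (fun y hy => hwv x y hx' hy) (fun y _ => by
          have h1 := abs_le.1 (abs_d2_le hwM x y)
          have h2 := abs_le.1 (abs_d2_le hv x y)
          rw [Real.rpow_zero]
          exact abs_le.2 ⟨by linarith [h1.1, h2.2], by linarith [h1.2, h2.1]⟩)
      refine ⟨hi', ?_⟩
      have := abs_sub_abs_le_abs_sub (∫ y, d2 w x y ∂(K x)) (∫ y, d2 v x y ∂(K x))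
      linarith) h h0 (by linarith)
  rw [hwv 0 h (by simp) (by linarith)] at this
  refine this.trans ?_
  have hpow : ‖h‖ ^ (2 * s) ≤ ‖h‖ ^ γ :=
    Real.rpow_le_rpow_of_exponent_ge (norm_pos_iff.2 h0) (by linarith) hγ.le
  have e1 : κ / A * (A * (Φ + M)) = κ * (Φ + M) := by field_simp
  rw [e1]
  calc _ ≤ κ * (Φ + M) * ‖h‖ ^ γ +
        C * (M + C' * (4 * M) + M * (1 / 4 : ℝ) ^ (-(2 * s))) * ‖h‖ ^ γ := by gcongr
    _ = _ := by ring

lemma exists_centered_estimate (n : ℕ) {s β γ lam Lam κ : ℝ} (hs : s ∈ Ioo (0 : ℝ) 1)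
    (hlam : 0 < lam) (hLam : 0 < Lam) (hβ : 0 < β) (hγ0 : 0 < γ) (hγ : γ < 2 * s)
    (hβγ : β ≤ 1 ∨ γ = β) (hκ : 0 < κ) :
    ∃ η > 0, ∃ C > 0, ∀ K : Euc n → Measure (Euc n), (∀ x, Adm s lam Lam (K x)) →
      (∀ x x', KC s β η (K x) (K x')) → ∀ (v : Euc n → ℝ) (M Φ d : ℝ) (x₀ : Euc n),
      Continuous v → 0 < M → (∀ x, |v x| ≤ M) → 0 ≤ Φ → 0 < d → d ≤ 1 →
      (∀ x k, x + k ∈ ball x₀ d → x - k ∈ ball x₀ d → |d2 v x k| ≤ Φ * ‖k‖ ^ γ) →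
      (∀ x ∈ ball x₀ d,
        Integrable (fun y => d2 v x y) (K x) ∧ |∫ y, d2 v x y ∂(K x)| ≤ M) →
      ∀ h, ‖h‖ ≤ d / 16 → |d2 v x₀ h| ≤ (κ * Φ + C * M * d ^ (-γ)) * ‖h‖ ^ γ := by
  obtain ⟨η, hη, C, hC, H⟩ := exists_ball_estimate n (lam := lam) hs hlam hLam hβ hγ0 hγ hβγ hκ
  refine ⟨η, hη, C, hC, fun K hK hKC v M Φ d x₀ hvc hM hv hΦ hd hd1 hz heq h hh => ?_⟩
  have hmem : ∀ y : Euc n, y ∈ ball 0 1 → x₀ + d • y ∈ ball x₀ d := by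
    intro y hy
    rw [mem_ball_zero_iff] at hy
    rw [mem_ball_iff_norm, add_sub_cancel_left, norm_smul, Real.norm_of_nonneg hd.le]
    exact mul_lt_of_lt_one_right hd hy
  have hnk : ∀ k : Euc n, ‖d • k‖ ^ γ = d ^ γ * ‖k‖ ^ γ := fun k => by
    rw [norm_smul, Real.norm_of_nonneg hd.le, Real.mul_rpow hd.le (norm_nonneg _)]
  have := H (fun y => sc s d (K (x₀ + d • y))) (fun y => (hK _).sc hd)
    (fun y y' => (hKC _ _).sc hd) (fun y => v (x₀ + d • y)) M (d ^ γ * Φ)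
    (by fun_prop) hM (fun y => hv _) (by positivity)
    (fun x k h1 h2 => by
      rw [d2_comp_add_smul]
      refine (hz _ _ ?_ ?_).trans_eq (by rw [hnk]; ring)
      · have := hmem _ h1; rwa [smul_add, ← add_assoc] at this
      · have := hmem _ h2; rwa [smul_sub, ← add_sub_assoc] at this)
    (fun x hx => by
      obtain ⟨hi, hb⟩ := heq _ (hmem x hx)
      obtain ⟨hi', e⟩ := integral_d2_sc (s := s) hd hi
      refine ⟨hi', ?_⟩
      rw [e, abs_mul, abs_of_nonneg (by positivity)]
      have : d ^ (2 * s) ≤ 1 := Real.rpow_le_one hd.le hd1 (by linarith [hs.1])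
      exact (mul_le_of_le_one_left (abs_nonneg _) this).trans hb)
    (d⁻¹ • h) (by
      rw [norm_smul, norm_inv, Real.norm_of_nonneg hd.le, inv_mul_le_iff₀ hd]; linarith)
  rw [d2_comp_add_smul, smul_zero, add_zero, smul_inv_smul₀ hd.ne'] at this
  refine this.trans_eq ?_
  have e := hnk (d⁻¹ • h)
  rw [smul_inv_smul₀ hd.ne'] at e
  rw [e, Real.rpow_neg hd.le]
  have : d ^ γ ≠ 0 := by positivity
  field_simp

lemma rpow_mul_abs_d2_le_of_le {f : Euc n → ℝ} {M γ c d : ℝ} {h : Euc n} (hf : ∀ x, |f x| ≤ M)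
    (hγ0 : 0 < γ) (hγ2 : γ < 2) (hc : 1 ≤ c) (hd : 0 ≤ d) (hdh : d ≤ c * ‖h‖) (x : Euc n) :
    d ^ γ * |d2 f x h| ≤ 4 * M * c ^ 2 * ‖h‖ ^ γ := by
  have hM : 0 ≤ M := (abs_nonneg _).trans (hf 0)
  have h1 : d ^ γ ≤ c ^ 2 * ‖h‖ ^ γ := by
    refine (Real.rpow_le_rpow hd hdh hγ0.le).trans ?_
    rw [Real.mul_rpow (by linarith) (norm_nonneg _)]
    have : c ^ γ ≤ c ^ (2 : ℝ) := Real.rpow_le_rpow_of_exponent_le hc hγ2.le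
    rw [Real.rpow_two] at this
    gcongr
  calc _ ≤ c ^ 2 * ‖h‖ ^ γ * (4 * M) :=
        mul_le_mul h1 (abs_d2_le hf x h) (abs_nonneg _) (by positivity)
    _ = _ := by ring

lemma mem_of_add_mem_of_sub_mem {S : Set (Euc n)} (hS : Convex ℝ S) {x k : Euc n}
    (h1 : x + k ∈ S) (h2 : x - k ∈ S) : x ∈ S := by
  have := hS h1 h2 (a := 1 / 2) (b := 1 / 2) (by norm_num) (by norm_num) (by norm_num)
  convert this using 1
  rw [← smul_add, add_add_sub_cancel, ← two_smul ℝ, smul_smul]; norm_num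

lemma exists_interior_estimate (n : ℕ) {s β γ lam Lam : ℝ} (hs : s ∈ Ioo (0 : ℝ) 1)
    (hlam : 0 < lam) (hLam : 0 < Lam) (hβ : 0 < β) (hγ0 : 0 < γ) (hγ : γ < 2 * s)
    (hβγ : β ≤ 1 ∨ γ = β) :
    ∃ η > 0, ∃ C > 0, ∀ K : Euc n → Measure (Euc n), (∀ x, Adm s lam Lam (K x)) →
      (∀ x x', KC s β η (K x) (K x')) → ∀ (v : Euc n → ℝ) (M Φ : ℝ),
      Continuous v → 0 < M → (∀ x, |v x| ≤ M) → 0 ≤ Φ →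
      (∀ x k, x + k ∈ ball 0 (5 / 8) → x - k ∈ ball 0 (5 / 8) → |d2 v x k| ≤ Φ * ‖k‖ ^ γ) →
      (∀ x ∈ ball (0 : Euc n) (5 / 8),
        Integrable (fun y => d2 v x y) (K x) ∧ |∫ y, d2 v x y ∂(K x)| ≤ M) →
      ∀ x ∈ ball (0 : Euc n) (9 / 16), ∀ h, |d2 v x h| ≤ C * M * ‖h‖ ^ γ := by
  have hγ2 : γ < 2 := hγ.trans (by linarith [hs.2])
  obtain ⟨η, hη, C, hC, H⟩ := exists_centered_estimate n (lam := lam) (κ := 1 / 8) hs hlam hLam hβ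
    hγ0 hγ hβγ (by norm_num)
  set C1 : ℝ := 4 * C + 4608 with hC1
  refine ⟨η, hη, 256 * (2 * C1 + 1) + 4 * 256 ^ 2 * 256, by positivity,
    fun K hK hKC v M Φ hvc hM hv hΦ hz heq => ?_⟩
  set T : Set ℝ := {t | 0 ≤ t ∧ ∀ x ∈ ball (0 : Euc n) (5 / 8), ∀ h : Euc n,
    (5 / 8 - ‖x‖) ^ γ * |d2 v x h| ≤ t * ‖h‖ ^ γ} with hT
  have hTne : Φ + 4 * M * 16 ^ 2 ∈ T := by
    refine ⟨by positivity, fun x hx h => ?_⟩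
    rw [mem_ball_zero_iff] at hx
    rcases le_or_gt (‖h‖ * 16) (5 / 8 - ‖x‖) with hh | hh
    · have h1 := hz x h (by rw [mem_ball_zero_iff]; linarith [norm_add_le x h, norm_nonneg h])
        (by rw [mem_ball_zero_iff]; linarith [norm_sub_le x h, norm_nonneg h])
      have h2 : (5 / 8 - ‖x‖) ^ γ ≤ 1 :=
        Real.rpow_le_one (by linarith) (by linarith [norm_nonneg x]) hγ0.le
      refine ((mul_le_of_le_one_left (abs_nonneg _) h2).trans h1).trans ?_
      gcongr
      exact le_add_of_nonneg_right (by positivity)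
    · refine (rpow_mul_abs_d2_le_of_le hv hγ0 hγ2 (c := 16) (by norm_num) (by linarith)
        (by linarith) x).trans ?_
      gcongr
      exact le_add_of_nonneg_left hΦ
  have hstep : ∀ t ∈ T, t / 2 + C1 * M ∈ T := by
    rintro t ⟨ht0, ht⟩
    refine ⟨by positivity, fun x hx h => ?_⟩
    rw [mem_ball_zero_iff] at hx
    set d := 5 / 8 - ‖x‖ with hd
    have hd0 : 0 < d := by linarith
    have hdy : ∀ y ∈ ball x (d / 2), d / 2 ≤ 5 / 8 - ‖y‖ := by
      intro y hy
      rw [mem_ball_iff_norm] at hy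
      linarith [norm_le_norm_add_norm_sub' y x]
    rcases le_or_gt (32 * ‖h‖) d with hh | hh
    · have := H K hK hKC v M ((4 * t + 4 * M * 32 ^ 2) * d ^ (-γ)) (d / 2) x hvc hM hv
        (by positivity) (by positivity) (by linarith [norm_nonneg x])
        (fun y k h1 h2 => by
          have hy := mem_of_add_mem_of_sub_mem (convex_ball x (d / 2)) h1 h2
          have hdy' := hdy y hy
          have hyb : y ∈ ball (0 : Euc n) (5 / 8) := by rw [mem_ball_zero_iff]; linarith
          have h3 := ht y hyb k
          have h4 : d ^ γ ≤ 4 * (5 / 8 - ‖y‖) ^ γ := by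
            calc d ^ γ ≤ (2 * (5 / 8 - ‖y‖)) ^ γ :=
                  Real.rpow_le_rpow hd0.le (by linarith) hγ0.le
              _ = 2 ^ γ * (5 / 8 - ‖y‖) ^ γ := Real.mul_rpow (by norm_num) (by linarith)
              _ ≤ _ := by
                  have : (2 : ℝ) ^ γ ≤ 2 ^ (2 : ℝ) :=
                    Real.rpow_le_rpow_of_exponent_le (by norm_num) hγ2.le
                  have e : (2 : ℝ) ^ (2 : ℝ) = 4 := by norm_num
                  rw [e] at this
                  have : 0 ≤ (5 / 8 - ‖y‖) ^ γ := Real.rpow_nonneg (by linarith) _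
                  gcongr
          have h5 : d ^ γ * |d2 v y k| ≤ (4 * t + 4 * M * 32 ^ 2) * ‖k‖ ^ γ := by
            calc d ^ γ * |d2 v y k| ≤ 4 * (5 / 8 - ‖y‖) ^ γ * |d2 v y k| := by gcongr
              _ = 4 * ((5 / 8 - ‖y‖) ^ γ * |d2 v y k|) := by ring
              _ ≤ 4 * (t * ‖k‖ ^ γ) := by gcongr
              _ = 4 * t * ‖k‖ ^ γ := by ring
              _ ≤ _ := by gcongr; exact le_add_of_nonneg_right (by positivity)
          rw [Real.rpow_neg hd0.le, mul_right_comm, ← div_eq_mul_inv, le_div_iff₀ (by positivity)]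
          linarith)
        (fun y hy => heq y (by
          rw [mem_ball_zero_iff]; linarith [hdy y hy]))
        h (by linarith)
      have h6 : (d / 2) ^ (-γ) ≤ 4 * d ^ (-γ) := by
        rw [Real.div_rpow hd0.le (by norm_num), Real.rpow_neg (by norm_num : (0 : ℝ) ≤ 2),
          div_inv_eq_mul, mul_comm]
        have : (2 : ℝ) ^ γ ≤ 2 ^ (2 : ℝ) :=
          Real.rpow_le_rpow_of_exponent_le (by norm_num) hγ2.le
        have e : (2 : ℝ) ^ (2 : ℝ) = 4 := by norm_num
        rw [e] at this
        gcongr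
      have hdd : d ^ γ * d ^ (-γ) = 1 := by
        rw [← Real.rpow_add hd0, add_neg_cancel, Real.rpow_zero]
      calc d ^ γ * |d2 v x h| ≤ d ^ γ * ((1 / 8 * ((4 * t + 4 * M * 32 ^ 2) * d ^ (-γ)) +
            C * M * (4 * d ^ (-γ))) * ‖h‖ ^ γ) := by
            refine mul_le_mul_of_nonneg_left (this.trans ?_) (by positivity)
            gcongr
        _ = d ^ γ * d ^ (-γ) * ((t / 2 + (4 * C + 512) * M) * ‖h‖ ^ γ) := by ring
        _ = (t / 2 + (4 * C + 512) * M) * ‖h‖ ^ γ := by rw [hdd, one_mul]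
        _ ≤ _ := by rw [hC1]; gcongr; norm_num
    · refine (rpow_mul_abs_d2_le_of_le hv hγ0 hγ2 (c := 32) (by norm_num) hd0.le
        hh.le x).trans ?_
      have : 0 ≤ ‖h‖ ^ γ := by positivity
      gcongr
      rw [hC1]
      nlinarith
  have hbdd : BddBelow T := ⟨0, fun t ht => ht.1⟩
  have h0 : ∀ t ∈ T, 2 * (sInf T - C1 * M) ≤ t := fun t ht => by
    linarith [csInf_le hbdd (hstep t ht)]
  have h1 := le_csInf ⟨_, hTne⟩ h0
  obtain ⟨t, ⟨ht0, ht⟩, htlt⟩ := exists_lt_of_csInf_lt ⟨_, hTne⟩ (lt_add_of_pos_right (sInf T) hM)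
  have htM : t ≤ (2 * C1 + 1) * M := by linarith
  intro x hx h
  rw [mem_ball_zero_iff] at hx
  have h2 := ht x (by rw [mem_ball_zero_iff]; linarith) h
  have h3 : 1 ≤ 256 * (5 / 8 - ‖x‖) ^ γ := by
    have h4 : (1 / 16 : ℝ) ^ γ ≤ (5 / 8 - ‖x‖) ^ γ :=
      Real.rpow_le_rpow (by norm_num) (by linarith) hγ0.le
    have h5 : (1 / 16 : ℝ) ^ (2 : ℝ) ≤ (1 / 16 : ℝ) ^ γ :=
      Real.rpow_le_rpow_of_exponent_ge (by norm_num) (by norm_num) hγ2.le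
    have e : (1 / 16 : ℝ) ^ (2 : ℝ) = 1 / 256 := by norm_num
    rw [e] at h5
    linarith
  calc |d2 v x h| ≤ 256 * (5 / 8 - ‖x‖) ^ γ * |d2 v x h| :=
        le_mul_of_one_le_left (abs_nonneg _) h3
    _ = 256 * ((5 / 8 - ‖x‖) ^ γ * |d2 v x h|) := by ring
    _ ≤ 256 * ((2 * C1 + 1) * M * ‖h‖ ^ γ) := by
        refine mul_le_mul_of_nonneg_left (h2.trans ?_) (by norm_num)
        gcongr
    _ = 256 * (2 * C1 + 1) * M * ‖h‖ ^ γ := by ring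
    _ ≤ _ := by gcongr; norm_num

/-- Ellipticity forces a definite amount of mass in a large annulus. -/
lemma exists_le_measure_annulus {s lam Lam r : ℝ} (hs : s ∈ Ioo (0 : ℝ) 1) (hlam : 0 < lam)
    (hLam : 0 < Lam) (hr : 0 < r) {e : Euc n} (he : ‖e‖ = 1) :
    ∃ R : ℝ, ∃ c > 0, ∀ K : Measure (Euc n), Adm s lam Lam K →
      ENNReal.ofReal c ≤ K (ball 0 R \ ball 0 r) := by
  obtain ⟨C, hC, h⟩ := exists_lintegral_ball_le n (s := s) (lam := lam) hs hLam
  have ht := (tendsto_rpow_atTop (y := 2 - 2 * s) (by linarith [hs.2])).const_mul_atTop hlam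
  obtain ⟨R, hR1, hR2⟩ := ((ht.eventually_ge_atTop (C * r ^ (2 - 2 * s) + 1)).and
    (Filter.eventually_gt_atTop r)).exists
  have hR : 0 < R := hr.trans hR2
  refine ⟨R, (R ^ 2)⁻¹, by positivity, fun K hK => ?_⟩
  have hle : ∀ y : Euc n, ENNReal.ofReal (⟪e, y⟫ ^ 2) ≤ ENNReal.ofReal (‖y‖ ^ 2) := fun y => by
    apply ENNReal.ofReal_le_ofReal
    have := abs_real_inner_le_norm e y
    rw [he, one_mul] at this
    exact sq_le_sq' (by linarith [neg_abs_le ⟪e, y⟫]) ((le_abs_self _).trans this)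
  have h1 : ENNReal.ofReal (C * r ^ (2 - 2 * s)) + ENNReal.ofReal 1 ≤
      ENNReal.ofReal (C * r ^ (2 - 2 * s)) +
        ENNReal.ofReal (R ^ 2) * K (ball 0 R \ ball 0 r) := by
    calc _ = ENNReal.ofReal (C * r ^ (2 - 2 * s) + 1) :=
          (ENNReal.ofReal_add (by positivity) zero_le_one).symm
      _ ≤ ENNReal.ofReal (lam * R ^ (2 - 2 * s)) := ENNReal.ofReal_le_ofReal hR1
      _ ≤ ∫⁻ y in ball 0 R, ENNReal.ofReal (⟪e, y⟫ ^ 2) ∂K := hK.lower R hR e he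
      _ ≤ ∫⁻ y in ball 0 R, ENNReal.ofReal (‖y‖ ^ 2) ∂K := lintegral_mono fun y => hle y
      _ = ∫⁻ y in ball 0 r ∪ ball 0 R \ ball 0 r, ENNReal.ofReal (‖y‖ ^ 2) ∂K := by
          rw [union_sdiff_cancel (ball_subset_ball hR2.le)]
      _ ≤ (∫⁻ y in ball 0 r, ENNReal.ofReal (‖y‖ ^ 2) ∂K) +
          ∫⁻ y in ball 0 R \ ball 0 r, ENNReal.ofReal (‖y‖ ^ 2) ∂K := lintegral_union_le _ _ _
      _ ≤ _ := by
          gcongr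
          · exact h K hK r hr
          · refine (setLIntegral_mono (g := fun _ => ENNReal.ofReal (R ^ 2)) measurable_const
              fun y hy => ?_).trans_eq (setLIntegral_const _ _)
            have := hy.1
            rw [mem_ball_zero_iff] at this
            gcongr
  have h2 := (ENNReal.add_le_add_iff_left ENNReal.ofReal_ne_top).1 h1
  rw [ENNReal.ofReal_inv_of_pos (by positivity)]
  rw [ENNReal.ofReal_one, mul_comm] at h2
  exact (ENNReal.inv_le_iff_le_mul (fun _ => (ENNReal.ofReal_pos.2 (by positivity)).ne')
    (fun h => absurd h ENNReal.ofReal_ne_top)).2 (by rwa [mul_comm])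

lemma le_of_superharmonic {s lam Lam c R b F : ℝ} (hs : s ∈ Ioo (0 : ℝ) 1) (hLam : 0 < Lam)
    (hc : 0 < c) {K : Measure (Euc n)} (hK : Adm s lam Lam K)
    (hKc : ENNReal.ofReal c ≤ K (ball 0 R \ ball 0 (1 / 2))) {u : Euc n → ℝ} {x : Euc n}
    (hx : ‖x‖ ≤ 1 / 4) (hin : ∀ y, ‖y‖ ≤ 1 / 4 → u y ≤ u x) (hout : ∀ y, 1 / 4 ≤ ‖y‖ → u y ≤ b)
    (hu : Integrable (fun y => d2 u x y) K) (hF : -F ≤ ∫ y, d2 u x y ∂K) (hF0 : 0 ≤ F) :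
    u x ≤ b + F / c := by
  by_contra! hlt
  have hb : b < u x := lt_of_le_of_lt (le_add_of_nonneg_right (by positivity)) hlt
  have hall : ∀ y, u y ≤ u x := fun y => by
    rcases le_total ‖y‖ (1 / 4) with h | h
    · exact hin y h
    · exact (hout y h).trans hb.le
  set A : Set (Euc n) := ball 0 R \ ball 0 (1 / 2) with hA
  have hAm : MeasurableSet A := measurableSet_ball.diff measurableSet_ball
  have hAf : K A < ⊤ := (measure_mono fun y hy => hy.2).trans_lt
    (hK.measure_compl_ball_lt_top hs hLam (r := 1 / 2) (by norm_num))
  have hle : ∀ y, d2 u x y ≤ A.indicator (fun _ => 2 * (b - u x)) y := by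
    intro y
    by_cases hy : y ∈ A
    · rw [indicator_of_mem hy]
      have hy2 : 1 / 2 ≤ ‖y‖ := by simpa using hy.2
      have h1 := hout (x + y) (by
        have := norm_sub_norm_le y (-x); rw [sub_neg_eq_add, norm_neg, add_comm y] at this
        linarith)
      have h2 := hout (x - y) (by
        have := norm_sub_norm_le y x; rw [norm_sub_rev] at this; linarith)
      simp only [d2]; linarith
    · rw [indicator_of_notMem hy]
      simp only [d2]; linarith [hall (x + y), hall (x - y)]
  have hg : Integrable (A.indicator fun _ => 2 * (b - u x)) K :=
    (integrable_indicator_iff hAm).2 (integrableOn_const hAf.ne)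
  have h3 := integral_mono hu hg hle
  rw [integral_indicator hAm, setIntegral_const, smul_eq_mul] at h3
  have h4 : c ≤ K.real A := by
    rw [Measure.real]; exact (ENNReal.ofReal_le_iff_le_toReal hAf.ne).1 hKc
  have h5 : F < c * (u x - b) := by
    have : F / c < u x - b := by linarith
    rwa [div_lt_iff₀ hc, mul_comm] at this
  nlinarith

lemma exists_sup_bound (n : ℕ) {s lam Lam τ : ℝ} (hs : s ∈ Ioo (0 : ℝ) 1) (hlam : 0 < lam)
    (hLam : 0 < Lam) :
    ∃ C > 0, ∀ K : Euc n → Measure (Euc n), (∀ x, Adm s lam Lam (K x)) →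
      ∀ (u : Euc n → ℝ) (S : ℝ), 0 ≤ S → ContinuousOn u (ball 0 1) →
      (∀ x, |u x| ≤ S * (1 + ‖x‖ ^ τ)) →
      (∀ x ∈ ball (0 : Euc n) 1,
        Integrable (fun y => d2 u x y) (K x) ∧ |∫ y, d2 u x y ∂(K x)| ≤ 2 * S) →
      ∀ x, |u x| ≤ C * S * (1 + ‖x‖ ^ (max τ 0)) := by
  rcases le_or_gt 0 τ with hτ | hτ
  · refine ⟨1, one_pos, fun K _ u S _ _ hu _ x => ?_⟩
    rw [max_eq_left hτ, one_mul]; exact hu x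
  rcases subsingleton_or_nontrivial (Euc n) with hsub | hnt
  · refine ⟨1, one_pos, fun K _ u S _ _ hu _ x => (hu x).trans ?_⟩
    rw [Subsingleton.elim x 0, norm_zero, Real.zero_rpow hτ.ne, max_eq_right hτ.le, Real.rpow_zero]
    linarith
  obtain ⟨e, he⟩ := exists_norm_eq (Euc n) zero_le_one
  obtain ⟨R, c, hc, hK'⟩ := exists_le_measure_annulus (r := 1 / 2) (lam := lam) (Lam := Lam) hs hlam
    hLam (by norm_num) he
  refine ⟨1 + (1 / 4) ^ τ + 2 / c, by positivity, fun K hK u S hS hcont hu heq x => ?_⟩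
  have hout : ∀ y : Euc n, 1 / 4 ≤ ‖y‖ → |u y| ≤ S * (1 + (1 / 4) ^ τ) := fun y hy => by
    refine (hu y).trans ?_
    have : ‖y‖ ^ τ ≤ (1 / 4) ^ τ := Real.rpow_le_rpow_of_nonpos (by norm_num) hy hτ.le
    gcongr
  have key : ∀ w : Euc n → ℝ, ContinuousOn w (ball 0 1) →
      (∀ y : Euc n, 1 / 4 ≤ ‖y‖ → w y ≤ S * (1 + (1 / 4) ^ τ)) →
      (∀ x ∈ ball (0 : Euc n) 1,
        Integrable (fun y => d2 w x y) (K x) ∧ -(2 * S) ≤ ∫ y, d2 w x y ∂(K x)) →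
      ∀ y : Euc n, w y ≤ S * (1 + (1 / 4) ^ τ) + 2 * S / c := by
    intro w hw hwo hweq y
    obtain ⟨x0, hx0, hmax⟩ := (isCompact_closedBall (0 : Euc n) (1 / 4)).exists_isMaxOn
      ⟨0, mem_closedBall_self (by norm_num)⟩
      (hw.mono (closedBall_subset_ball (by norm_num)))
    have hx0' : ‖x0‖ ≤ 1 / 4 := by simpa using hx0
    obtain ⟨hi, hI⟩ := hweq x0 (by rw [mem_ball_zero_iff]; linarith)
    rcases le_total ‖y‖ (1 / 4) with h | h
    · have hin : ∀ y : Euc n, ‖y‖ ≤ 1 / 4 → w y ≤ w x0 :=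
        fun y hy => hmax (by simpa using hy)
      exact (hin y h).trans (le_of_superharmonic hs hLam hc (hK x0) (hK' _ (hK x0)) hx0' hin hwo hi
        hI (by positivity))
    · exact (hwo y h).trans (le_add_of_nonneg_right (by positivity))
  have k1 := key u hcont (fun y hy => (le_abs_self _).trans (hout y hy))
    (fun x hx => ⟨(heq x hx).1, (abs_le.1 (heq x hx).2).1⟩) x
  have k2 := key (fun y => -u y) hcont.neg (fun y hy => (neg_le_abs _).trans (hout y hy))
    (fun x hx => by
      have e : (fun y => d2 (fun y => -u y) x y) = fun y => -d2 u x y := by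
        funext y; simp only [d2]; ring
      refine ⟨by rw [e]; exact (heq x hx).1.neg, ?_⟩
      rw [e, integral_neg]
      linarith [(abs_le.1 (heq x hx).2).2]) x
  rw [max_eq_right hτ.le, Real.rpow_zero]
  have hfin : S * (1 + (1 / 4) ^ τ) + 2 * S / c ≤ (1 + (1 / 4) ^ τ + 2 / c) * S * (1 + 1) := by
    have : 0 ≤ (1 + (1 / 4) ^ τ + 2 / c) * S := by positivity
    have e : S * (1 + (1 / 4) ^ τ) + 2 * S / c = (1 + (1 / 4) ^ τ + 2 / c) * S := by ring
    linarith
  exact abs_le.2 ⟨by linarith, by linarith⟩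

lemma continuous_mul_of_eq_zero {χ u : Euc n → ℝ} (hχ : Continuous χ)
    (hout : ∀ x, 15 / 16 ≤ ‖x‖ → χ x = 0) (hu : ContinuousOn u (ball 0 1)) :
    Continuous fun x => χ x * u x := by
  rw [continuous_iff_continuousAt]
  intro x
  rcases lt_or_ge ‖x‖ 1 with h | h
  · exact hχ.continuousAt.mul (hu.continuousAt (isOpen_ball.mem_nhds (by simpa using h)))
  · have hev : ∀ᶠ y in 𝓝 x, χ y * u y = 0 := by
      filter_upwards [continuous_norm.continuousAt.eventually
        (lt_mem_nhds (show (15 / 16 : ℝ) < ‖x‖ by linarith))] with y hy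
      rw [hout y hy.le, zero_mul]
    exact continuousAt_const.congr (hev.mono fun y hy => hy.symm)

lemma exists_zygmund_estimate (n : ℕ) {s β γ τ lam Lam : ℝ} (hs : s ∈ Ioo (0 : ℝ) 1)
    (hlam : 0 < lam) (hLam : 0 < Lam) (hβ : 0 < β) (hγ0 : 0 < γ) (hγ : γ < 2 * s)
    (hβγ : β ≤ 1 ∨ γ = β) (hτ : τ < 2 * s) :
    ∃ η > 0, ∃ C > 0, ∀ K : Euc n → Measure (Euc n), (∀ x, Adm s lam Lam (K x)) →
      (∀ x x', KC s β η (K x) (K x')) → ∀ (u : Euc n → ℝ) (S Φ : ℝ), 0 < S →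
      ContinuousOn u (ball 0 1) → (∀ x, |u x| ≤ S * (1 + ‖x‖ ^ τ)) →
      (∀ x ∈ ball (0 : Euc n) 1,
        Integrable (fun y => d2 u x y) (K x) ∧ |∫ y, d2 u x y ∂(K x)| ≤ 2 * S) → 0 ≤ Φ →
      (∀ x k, x + k ∈ ball 0 (5 / 8) → x - k ∈ ball 0 (5 / 8) → |d2 u x k| ≤ Φ * ‖k‖ ^ γ) →
      ∃ v : Euc n → ℝ, Continuous v ∧ (∀ x, ‖x‖ ≤ 7 / 8 → v x = u x) ∧ (∀ x, |v x| ≤ C * S) ∧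
        ∀ x ∈ ball (0 : Euc n) (9 / 16), ∀ h, |d2 v x h| ≤ C * S * ‖h‖ ^ γ := by
  obtain ⟨η, hη, C, hC, H⟩ := exists_interior_estimate n (lam := lam) hs hlam hLam hβ hγ0 hγ hβγ
  obtain ⟨C1, hC1, H1⟩ := exists_sup_bound n (lam := lam) (τ := τ) hs hlam hLam
  obtain ⟨χ, hχc, hχ0, hχ1, hχin, hχout, -⟩ :=
    exists_cutoff n (r := 7 / 8) (R := 15 / 16) (by norm_num) (by norm_num)
  set p := max τ 0 with hp
  have hp0 : 0 ≤ p := le_max_right _ _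
  have hps : p < 2 * s := max_lt hτ (by linarith [hs.1])
  obtain ⟨C2, hC2, H2⟩ := exists_integral_d2_sub_le n (lam := lam) (p := p) (δ := 1 / 4) hLam hp0
    hps (by norm_num)
  set D : ℝ := 2 * C1 + 2 + C2 * (50 * C1) with hD
  refine ⟨η, hη, D + C * D, by positivity,
    fun K hK hKC u S Φ hS hcont hu heq hΦ hz => ?_⟩
  have hu' := H1 K hK u S hS.le hcont hu heq
  set v : Euc n → ℝ := fun x => χ x * u x with hv
  have hvc : Continuous v := continuous_mul_of_eq_zero hχc hχout hcont
  have hvu : ∀ x, ‖x‖ ≤ 7 / 8 → v x = u x := fun x hx => by simp only [hv, hχin x hx, one_mul]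
  have hvS : ∀ x, |v x| ≤ 2 * C1 * S := fun x => by
    rcases le_total (15 / 16) ‖x‖ with hx | hx
    · simp only [hv, hχout x hx, zero_mul, abs_zero]; positivity
    · have h1 : ‖x‖ ^ p ≤ 1 := Real.rpow_le_one (norm_nonneg _) (by linarith) hp0
      calc |v x| = χ x * |u x| := by simp only [hv]; rw [abs_mul, abs_of_nonneg (hχ0 x)]
        _ ≤ |u x| := mul_le_of_le_one_left (abs_nonneg _) (hχ1 x)
        _ ≤ C1 * S * (1 + 1) := (hu' x).trans (by gcongr)
        _ = _ := by ring
  have hvM : ∀ x, |v x| ≤ D * S := fun x => (hvS x).trans (by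
    have : 0 ≤ (2 + C2 * (50 * C1)) * S := by positivity
    rw [hD]; linarith)
  have hdiff : ∀ z : Euc n, |v z - u z| ≤ C1 * S * (1 + ‖z‖ ^ p) := fun z => by
    have e : v z - u z = -((1 - χ z) * u z) := by simp only [hv]; ring
    rw [e, abs_neg, abs_mul, abs_of_nonneg (by linarith [hχ1 z])]
    exact (mul_le_of_le_one_left (abs_nonneg _) (by linarith [hχ0 z])).trans (hu' z)
  have hlarge : ∀ x y z : Euc n, ‖x‖ < 5 / 8 → 1 / 4 ≤ ‖y‖ → ‖z‖ ≤ ‖x‖ + ‖y‖ →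
      |v z - u z| ≤ 25 * C1 * S * (1 + ‖y‖ ^ p) := fun x y z hx hy hz' => by
    refine (hdiff z).trans ?_
    have h1 : ‖z‖ ^ p ≤ 25 * ‖y‖ ^ p := by
      calc ‖z‖ ^ p ≤ (5 * ‖y‖) ^ p := Real.rpow_le_rpow (norm_nonneg _) (by linarith) hp0
        _ = 5 ^ p * ‖y‖ ^ p := Real.mul_rpow (by norm_num) (norm_nonneg _)
        _ ≤ 5 ^ (2 : ℝ) * ‖y‖ ^ p := by
            gcongr
            · norm_num
            · linarith [hs.2]
        _ = _ := by norm_num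
    calc _ ≤ C1 * S * (25 * (1 + ‖y‖ ^ p)) := by gcongr; linarith
      _ = _ := by ring
  have := H K hK hKC v (D * S) Φ hvc (by positivity) hvM hΦ
    (fun x k h1 h2 => by
      have h3 := mem_of_add_mem_of_sub_mem (convex_ball _ _) h1 h2
      have e : d2 v x k = d2 u x k := by
        rw [mem_ball_zero_iff] at h1 h2 h3
        simp only [d2]
        rw [hvu _ (by linarith), hvu _ (by linarith), hvu _ (by linarith)]
      rw [e]; exact hz x k h1 h2)
    (fun x hx => by
      have hx' : ‖x‖ < 5 / 8 := by simpa using hx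
      obtain ⟨hi, hI⟩ := heq x (by rw [mem_ball_zero_iff]; linarith)
      obtain ⟨hi', hI'⟩ := H2 (K x) (hK x) u v x (50 * C1 * S) (by positivity) hvc hi
        (fun y hy => by
          simp only [d2]
          rw [hvu _ (by linarith [norm_add_le x y]), hvu _ (by linarith [norm_sub_le x y]),
            hvu _ (by linarith)])
        (fun y hy => by
          have e : d2 v x y - d2 u x y = (v (x + y) - u (x + y)) + (v (x - y) - u (x - y)) := by
            simp only [d2]; rw [hvu x (by linarith)]; ring
          rw [e]
          have h1 := hlarge x y _ hx' hy (norm_add_le x y)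
          have h2 := hlarge x y _ hx' hy (norm_sub_le x y)
          refine (abs_add_le _ _).trans ((add_le_add h1 h2).trans_eq ?_)
          ring)
      refine ⟨hi', ?_⟩
      have h1 := abs_sub_abs_le_abs_sub (∫ y, d2 v x y ∂(K x)) (∫ y, d2 u x y ∂(K x))
      have h2 : 0 ≤ C1 * S := by positivity
      rw [hD]; linarith)
  refine ⟨v, hvc, hvu, fun x => (hvM x).trans ?_, fun x hx h => (this x hx h).trans ?_⟩
  · have : 0 ≤ C * D * S := by positivity
    linarith
  · have : 0 ≤ D * S * ‖h‖ ^ γ := by positivity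
    linarith

lemma exists_le_of_hSemiOn_ne_top {σ : ℝ} {Ω A : Set (Euc n)} {u : Euc n → ℝ}
    (h : hSemiOn σ Ω A u ≠ ⊤) :
    ∃ L, 0 ≤ L ∧ ∀ x ∈ A, ∀ y ∈ A, x ≠ y →
      ‖iteratedFDerivWithin ℝ (hDeg σ) u Ω x - iteratedFDerivWithin ℝ (hDeg σ) u Ω y‖ ≤
        L * ‖x - y‖ ^ (σ - (hDeg σ : ℝ)) := by
  refine ⟨(hSemiOn σ Ω A u).toReal, ENNReal.toReal_nonneg, fun x hx y hy hxy => ?_⟩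
  have h1 := (ENNReal.ofReal_le_iff_le_toReal h).1
    (le_iSup_of_le (⟨x, hx⟩ : A) (le_iSup_of_le (⟨y, hy⟩ : A) le_rfl))
  rwa [div_le_iff₀ (Real.rpow_pos_of_pos (norm_pos_iff.2 (sub_ne_zero.2 hxy)) _)] at h1

lemma norm_add_le_of_mem_ball {x k : Euc n} (h1 : x + k ∈ ball 0 (5 / 8))
    (h2 : x - k ∈ ball 0 (5 / 8)) : ‖x‖ + ‖k‖ ≤ 9 / 10 ∧ ‖k‖ ≤ 1 := by
  rw [mem_ball_zero_iff] at h1 h2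
  have h3 := parallelogram_law_with_norm ℝ x k
  have h4 : ‖x + k‖ * ‖x + k‖ ≤ 5 / 8 * (5 / 8) := by gcongr
  have h5 : ‖x - k‖ * ‖x - k‖ ≤ 5 / 8 * (5 / 8) := by gcongr
  have h6 := norm_nonneg x
  have h7 := norm_nonneg k
  constructor <;> nlinarith [sq_nonneg (‖x‖ - ‖k‖)]

lemma exists_zygmund_of_fderiv {γ α L : ℝ} {u : Euc n → ℝ} (hα : 0 ≤ α) (hα1 : α ≤ 1)
    (hγα : γ ≤ 1 + α) (hL : 0 ≤ L)
    (hu : ∀ x ∈ closedBall (0 : Euc n) (9 / 10), DifferentiableAt ℝ u x)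
    (hD : ∀ p ∈ closedBall (0 : Euc n) (9 / 10), ∀ q ∈ closedBall (0 : Euc n) (9 / 10),
      ‖fderiv ℝ u p - fderiv ℝ u q‖ ≤ L * ‖p - q‖ ^ α) (x k : Euc n)
    (h1 : x + k ∈ ball 0 (5 / 8)) (h2 : x - k ∈ ball 0 (5 / 8)) :
    |d2 u x k| ≤ 2 * L * ‖k‖ ^ γ := by
  obtain ⟨h3, h4⟩ := norm_add_le_of_mem_ball h1 h2
  rcases eq_or_ne k 0 with rfl | hk
  · rw [d2_zero, abs_zero]; positivity
  have hsub : closedBall x ‖k‖ ⊆ closedBall (0 : Euc n) (9 / 10) := fun z hz => by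
    rw [mem_closedBall_iff_norm] at hz
    rw [mem_closedBall_zero_iff]
    linarith [norm_le_norm_add_norm_sub' z x]
  refine (abs_d2_le_of_fderiv hL hα hα1 (fun p hp => hu p (hsub hp))
    (fun p hp q hq => hD p (hsub hp) q (hsub hq))).trans ?_
  have := Real.rpow_le_rpow_of_exponent_ge (norm_pos_iff.2 hk) h4 hγα
  gcongr

lemma exists_zygmund_of_holderMemLoc {γ σ : ℝ} {u : Euc n → ℝ} (hγσ : γ ≤ σ)
    (hγ2 : γ ≤ 2) (hu : HolderMemLoc σ (ball 0 1) u) :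
    ∃ Φ, 0 ≤ Φ ∧ ∀ x k : Euc n, x + k ∈ ball 0 (5 / 8) → x - k ∈ ball 0 (5 / 8) →
      |d2 u x k| ≤ Φ * ‖k‖ ^ γ := by
  set A : Set (Euc n) := closedBall 0 (9 / 10) with hA
  have hAs : A ⊆ ball 0 1 := closedBall_subset_ball (by norm_num)
  have hAc : IsCompact A := isCompact_closedBall _ _
  have htop : hSemiOn σ (ball 0 1) A u ≠ ⊤ :=
    ne_top_of_le_ne_top (hu.2 A hAc hAs) le_add_self
  obtain ⟨L, hL, hLb⟩ := exists_le_of_hSemiOn_ne_top htop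
  have hit : ∀ m : ℕ, ∀ x ∈ A, iteratedFDerivWithin ℝ m u (ball 0 1) x = iteratedFDeriv ℝ m u x :=
    fun m x hx => iteratedFDerivWithin_of_isOpen m isOpen_ball (hAs hx)
  have hbA : ∀ x ∈ ball (0 : Euc n) (5 / 8), x ∈ A := fun x hx =>
    ball_subset_closedBall (ball_subset_ball (by norm_num) hx)
  have hdiff : 1 ≤ hDeg σ → ∀ x ∈ A, DifferentiableAt ℝ u x := fun h x hx =>
    (hu.1.contDiffAt (isOpen_ball.mem_nhds (hAs hx))).differentiableAt
      (by exact_mod_cast (Nat.one_le_iff_ne_zero.1 h))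
  rcases le_or_gt σ 1 with h1 | h1
  · have hm := hDeg_of_le_one h1
    refine ⟨2 * L, by positivity, fun x k hx1 hx2 => ?_⟩
    obtain ⟨-, hk1⟩ := norm_add_le_of_mem_ball hx1 hx2
    have hx := mem_of_add_mem_of_sub_mem (convex_ball _ _) hx1 hx2
    rcases eq_or_ne k 0 with rfl | hk
    · rw [d2_zero, abs_zero]; positivity
    have hb : ∀ y ∈ A, ∀ z ∈ A, y ≠ z → |u y - u z| ≤ L * ‖y - z‖ ^ σ := fun y hy z hz hyz => by
      have := hLb y hy z hz hyz
      rw [hm, hit 0 y hy, hit 0 z hz, norm_iteratedFDeriv_zero_sub] at this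
      simpa using this
    have b1 := hb _ (hbA _ hx1) _ (hbA _ hx) (by simpa using hk)
    have b2 := hb _ (hbA _ hx2) _ (hbA _ hx) (by simpa using hk)
    rw [add_sub_cancel_left] at b1
    rw [sub_sub_cancel_left, norm_neg] at b2
    have e : d2 u x k = (u (x + k) - u x) + (u (x - k) - u x) := by simp only [d2]; ring
    have hp := Real.rpow_le_rpow_of_exponent_ge (norm_pos_iff.2 hk) hk1 hγσ
    rw [e]
    calc _ ≤ L * ‖k‖ ^ σ + L * ‖k‖ ^ σ := (abs_add_le _ _).trans (add_le_add b1 b2)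
      _ = 2 * L * ‖k‖ ^ σ := by ring
      _ ≤ _ := by gcongr
  rcases le_or_gt σ 2 with h2 | h2
  · have hm := hDeg_of_lt_two h1 h2
    refine ⟨2 * L, by positivity, exists_zygmund_of_fderiv (α := σ - 1) (by linarith) (by linarith)
      (by linarith) hL (hdiff hm.ge) fun p hp q hq => ?_⟩
    rcases eq_or_ne p q with rfl | hpq
    · simp only [sub_self, norm_zero]; positivity
    have := hLb p hp q hq hpq
    rw [hm, hit 1 p hp, hit 1 q hq, norm_iteratedFDeriv_one_sub] at this
    simpa using this
  · have hm : 2 ≤ hDeg σ := by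
      have : 2 < ⌈σ⌉₊ := Nat.lt_ceil.2 (by simpa using h2)
      unfold hDeg; omega
    have hC1 : ContDiffOn ℝ 1 (fderiv ℝ u) (ball 0 1) :=
      hu.1.fderiv_of_isOpen isOpen_ball (by norm_num; exact_mod_cast hm)
    have hloc : LocallyLipschitzOn A (fderiv ℝ u) := fun x hx => by
      obtain ⟨c, t, ht, h⟩ :=
        (hC1.contDiffAt (isOpen_ball.mem_nhds (hAs hx))).exists_lipschitzOnWith
      exact ⟨c, t, mem_nhdsWithin_of_mem_nhds ht, h⟩
    obtain ⟨c, hc⟩ := hloc.exists_lipschitzOnWith_of_compact hAc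
    refine ⟨2 * c, by positivity, exists_zygmund_of_fderiv (α := 1) zero_le_one le_rfl
      (by linarith) c.2 (hdiff (by omega)) fun p hp q hq => ?_⟩
    rw [Real.rpow_one]
    have := hc.dist_le_mul p hp q hq
    rwa [dist_eq_norm, dist_eq_norm] at this

lemma hNorm_congr {σ : ℝ} {Ω : Set (Euc n)} {u v : Euc n → ℝ} (h : EqOn u v Ω) :
    hNorm σ Ω u = hNorm σ Ω v := by
  have e : ∀ (j : ℕ) (x : Ω), iteratedFDerivWithin ℝ j u Ω ↑x = iteratedFDerivWithin ℝ j v Ω ↑x :=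
    fun j x => iteratedFDerivWithin_congr h x.2 j
  simp only [hNorm, hNormOn, hSemiOn, e]

lemma hNorm_le_of_le_one {β P Q : ℝ} {Ω : Set (Euc n)} {v : Euc n → ℝ} (hΩ : IsOpen Ω)
    (hβ : β ≤ 1) (hP : 0 ≤ P) (hQ : 0 ≤ Q) (hv : ∀ x ∈ Ω, |v x| ≤ P)
    (hd : ∀ x ∈ Ω, ∀ y ∈ Ω, |v x - v y| ≤ Q * ‖x - y‖ ^ β) :
    hNorm β Ω v ≤ ENNReal.ofReal (P + Q) := by
  have hm := hDeg_of_le_one hβ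
  rw [hNorm, hNormOn, hm, zero_add, Finset.sum_range_one, ENNReal.ofReal_add hP hQ]
  refine add_le_add (iSup_le fun x => ENNReal.ofReal_le_ofReal ?_) (hSemiOn_le hQ ?_)
  · rw [norm_iteratedFDerivWithin_zero]; exact hv x x.2
  · intro x hx y hy _
    rw [hm, iteratedFDerivWithin_of_isOpen 0 hΩ hx, iteratedFDerivWithin_of_isOpen 0 hΩ hy,
      norm_iteratedFDeriv_zero_sub]
    simpa using hd x hx y hy

lemma hNorm_le_of_one_lt {β P G Q : ℝ} {Ω : Set (Euc n)} {v : Euc n → ℝ} (hΩ : IsOpen Ω)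
    (hβ : 1 < β) (hβ2 : β ≤ 2) (hP : 0 ≤ P) (hG : 0 ≤ G) (hQ : 0 ≤ Q) (hv : ∀ x ∈ Ω, |v x| ≤ P)
    (hg : ∀ x ∈ Ω, ‖fderiv ℝ v x‖ ≤ G)
    (hd : ∀ x ∈ Ω, ∀ y ∈ Ω, ‖fderiv ℝ v x - fderiv ℝ v y‖ ≤ Q * ‖x - y‖ ^ (β - 1)) :
    hNorm β Ω v ≤ ENNReal.ofReal (P + G + Q) := by
  have hm := hDeg_of_lt_two hβ hβ2
  rw [hNorm, hNormOn, hm, Finset.sum_range_succ, Finset.sum_range_one,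
    ENNReal.ofReal_add (by positivity) hQ, ENNReal.ofReal_add hP hG]
  refine add_le_add (add_le_add (iSup_le fun x => ENNReal.ofReal_le_ofReal ?_)
    (iSup_le fun x => ENNReal.ofReal_le_ofReal ?_)) (hSemiOn_le hQ ?_)
  · rw [norm_iteratedFDerivWithin_zero]; exact hv x x.2
  · rw [iteratedFDerivWithin_of_isOpen 1 hΩ x.2, norm_iteratedFDeriv_one]; exact hg x x.2
  · intro x hx y hy _
    rw [hm, iteratedFDerivWithin_of_isOpen 1 hΩ hx, iteratedFDerivWithin_of_isOpen 1 hΩ hy,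
      norm_iteratedFDeriv_one_sub]
    simpa using hd x hx y hy

lemma exists_holder_of_zygmund (n : ℕ) {β : ℝ} (hβ0 : 0 < β) (hβ1 : β < 1) :
    ∃ c > 0, ∀ (v : Euc n → ℝ) (N : ℝ), (∀ x, |v x| ≤ N) →
      (∀ x ∈ ball (0 : Euc n) (9 / 16), ∀ h, |d2 v x h| ≤ N * ‖h‖ ^ β) →
      ∀ x ∈ ball (0 : Euc n) (1 / 2), ∀ y, |v y - v x| ≤ c * N * ‖y - x‖ ^ β := by
  have h2 : 0 < 2 - (2 : ℝ) ^ β := by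
    have := Real.rpow_lt_rpow_of_exponent_lt (x := 2) one_lt_two hβ1
    rw [Real.rpow_one] at this
    linarith
  refine ⟨(1 / (2 - 2 ^ β) + 2 / (1 / 32 / 2) ^ β) + 2 / (1 / 32) ^ β, by positivity,
    fun v N hv hd x hx y => ?_⟩
  have hN : 0 ≤ N := (abs_nonneg _).trans (hv 0)
  rw [mem_ball_zero_iff] at hx
  rcases le_or_gt ‖y - x‖ (1 / 32) with h | h
  · have := abs_sub_le_of_d2 (f := v) (x := x) (ρ := 1 / 32) (by norm_num) hβ0 hβ1 hv hN
      (fun k hk => hd _ (by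
        rw [mem_ball_zero_iff]; linarith [norm_add_le x k]) k) (y - x) h
    rw [add_sub_cancel] at this
    refine this.trans ?_
    have h3 : 0 ≤ 2 / (1 / 32) ^ β * N * ‖y - x‖ ^ β := by positivity
    have e : N / (2 - 2 ^ β) + 2 * N / (1 / 32 / 2) ^ β =
      (1 / (2 - 2 ^ β) + 2 / (1 / 32 / 2) ^ β) * N := by ring
    rw [e]; linarith
  · have h3 : |v y - v x| ≤ 2 * N := by
      have h4 := abs_le.1 (hv y)
      have h5 := abs_le.1 (hv x)
      exact abs_le.2 ⟨by linarith [h4.1, h5.2], by linarith [h4.2, h5.1]⟩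
    have h6 : (1 / 32 : ℝ) ^ β ≤ ‖y - x‖ ^ β := Real.rpow_le_rpow (by norm_num) h.le hβ0.le
    have h7 : 0 ≤ (1 / (2 - 2 ^ β) + 2 / (1 / 32 / 2) ^ β) * N * ‖y - x‖ ^ β := by positivity
    have h8 : 2 * N ≤ 2 / (1 / 32) ^ β * N * ‖y - x‖ ^ β := by
      calc 2 * N = 2 / (1 / 32) ^ β * N * (1 / 32) ^ β := by field_simp
        _ ≤ _ := by gcongr
    linarith

lemma exists_fderiv_of_zygmund (n : ℕ) {γ : ℝ} (hγ1 : 1 < γ) (hγ2 : γ < 2) :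
    ∃ c > 0, ∀ (v : Euc n → ℝ) (N : ℝ), (∀ x, |v x| ≤ N) →
      (∀ x ∈ ball (0 : Euc n) (9 / 16), DifferentiableAt ℝ v x) →
      (∀ x ∈ ball (0 : Euc n) (9 / 16), ∀ h, |d2 v x h| ≤ N * ‖h‖ ^ γ) →
      (∀ x ∈ ball (0 : Euc n) (1 / 2), ‖fderiv ℝ v x‖ ≤ c * N) ∧
      ∀ x ∈ ball (0 : Euc n) (1 / 2), ∀ y ∈ ball (0 : Euc n) (1 / 2),
        ‖fderiv ℝ v x - fderiv ℝ v y‖ ≤ c * N * ‖x - y‖ ^ (γ - 1) := by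
  have hr : (2 : ℝ) ^ (1 - γ) < 1 :=
    Real.rpow_lt_one_of_one_lt_of_neg (by norm_num) (by linarith)
  set c0 : ℝ := (1 - 2 ^ (1 - γ))⁻¹ with hc0
  have hc0' : 0 < c0 := inv_pos.2 (by linarith)
  refine ⟨2 + 2 * c0 + 64 * (16 * (2 + c0)), by positivity, fun v N hv hdiff hd => ?_⟩
  have hN : 0 ≤ N := (abs_nonneg _).trans (hv 0)
  have hbig : ∀ x ∈ ball (0 : Euc n) (1 / 2), x ∈ ball (0 : Euc n) (9 / 16) := fun x hx =>
    ball_subset_ball (by norm_num) hx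
  have hg : ∀ x ∈ ball (0 : Euc n) (1 / 2), ‖fderiv ℝ v x‖ ≤ 16 * (2 + c0) * N := by
    intro x hx
    refine ContinuousLinearMap.opNorm_le_of_unit_norm (by positivity) fun e he => ?_
    have hh : ‖(1 / 16 : ℝ) • e‖ = 1 / 16 := by
      rw [norm_smul, he]; norm_num
    have ht := taylor_of_d2 (Φ := N) hγ1 (h := (1 / 16 : ℝ) • e) (hdiff x (hbig x hx))
      fun t ht0 ht1 => hd _ (by
        rw [mem_ball_zero_iff] at hx ⊢
        have h1 : ‖t • ((1 / 16 : ℝ) • e)‖ ≤ 1 / 16 := by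
          rw [norm_smul, hh, Real.norm_of_nonneg ht0.le]; linarith
        linarith [norm_add_le x (t • ((1 / 16 : ℝ) • e))]) _
    rw [hh, ← hc0] at ht
    have h1 : (1 / 16 : ℝ) ^ γ ≤ 1 := Real.rpow_le_one (by norm_num) (by norm_num) (by linarith)
    have h2 : N * c0 * (1 / 16 : ℝ) ^ γ ≤ N * c0 := mul_le_of_le_one_right (by positivity) h1
    have h3 := abs_le.1 (ht.trans h2)
    have h4 := abs_le.1 (hv (x + (1 / 16 : ℝ) • e))
    have h5 := abs_le.1 (hv x)
    rw [map_smul, smul_eq_mul] at h3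
    rw [Real.norm_eq_abs]
    exact abs_le.2 ⟨by linarith [h3.1, h3.2, h4.1, h5.2, h4.2, h5.1],
      by linarith [h3.1, h3.2, h4.1, h5.2, h4.2, h5.1]⟩
  refine ⟨fun x hx => (hg x hx).trans ?_, fun x hx y hy => ?_⟩
  · gcongr; linarith
  rcases le_or_gt ‖x - y‖ (1 / 32) with h | h
  · have := fderiv_holder_of_d2 hγ1 hN (hdiff y (hbig y hy)) (hdiff x (hbig x hx)) hd
      (fun z hz => by
        rw [mem_closedBall_iff_norm] at hz
        rw [mem_ball_zero_iff] at hy ⊢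
        linarith [norm_le_norm_add_norm_sub' z y])
    rw [← hc0] at this
    refine this.trans ?_
    have h3 : 0 ≤ 64 * (16 * (2 + c0)) * N * ‖x - y‖ ^ (γ - 1) := by positivity
    linarith
  · have h1 : ‖fderiv ℝ v x - fderiv ℝ v y‖ ≤ 2 * (16 * (2 + c0) * N) :=
      (norm_sub_le _ _).trans (by linarith [hg x hx, hg y hy])
    have h2 : 1 ≤ 32 * ‖x - y‖ ^ (γ - 1) := by
      calc 1 ≤ (32 * ‖x - y‖) ^ (γ - 1) := Real.one_le_rpow (by linarith) (by linarith)
        _ = 32 ^ (γ - 1) * ‖x - y‖ ^ (γ - 1) := Real.mul_rpow (by norm_num) (norm_nonneg _)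
        _ ≤ 32 ^ (1 : ℝ) * ‖x - y‖ ^ (γ - 1) := by
            gcongr
            · norm_num
            · linarith
        _ = _ := by rw [Real.rpow_one]
    have h3 : 2 * (16 * (2 + c0) * N) ≤ 2 * (16 * (2 + c0) * N) * (32 * ‖x - y‖ ^ (γ - 1)) :=
      le_mul_of_one_le_right (by positivity) h2
    have h4 : 0 ≤ (2 + 2 * c0) * N * ‖x - y‖ ^ (γ - 1) := by positivity
    linarith

lemma exists_hNorm_le (n : ℕ) {β γ : ℝ} (hβ0 : 0 < β) (hγ2 : γ < 2)
    (hβγ : γ = β ∧ β ≠ 1 ∨ β = 1 ∧ 1 < γ) :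
    ∃ c > 0, ∀ (v : Euc n → ℝ) (N : ℝ), (∀ x, |v x| ≤ N) →
      (1 < γ → ∀ x ∈ ball (0 : Euc n) (9 / 16), DifferentiableAt ℝ v x) →
      (∀ x ∈ ball (0 : Euc n) (9 / 16), ∀ h, |d2 v x h| ≤ N * ‖h‖ ^ γ) →
      hNorm β (ball 0 (1 / 2)) v ≤ ENNReal.ofReal (c * N) := by
  rcases lt_or_ge 1 γ with hγ1 | hγ1
  · obtain ⟨c, hc, H⟩ := exists_fderiv_of_zygmund n hγ1 hγ2
    refine ⟨1 + c + c, by positivity, fun v N hv hdiff hd => ?_⟩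
    have hN : 0 ≤ N := (abs_nonneg _).trans (hv 0)
    obtain ⟨hg, hh⟩ := H v N hv (hdiff hγ1) hd
    rcases hβγ with ⟨rfl, -⟩ | ⟨rfl, -⟩
    · refine (hNorm_le_of_one_lt isOpen_ball hγ1 hγ2.le hN (by positivity) (by positivity)
        (fun x _ => hv x) hg hh).trans_eq ?_
      congr 1; ring
    · refine (hNorm_le_of_le_one (Q := c * N) isOpen_ball le_rfl hN (by positivity)
        (fun x _ => hv x) fun x hx y hy => ?_).trans (ENNReal.ofReal_le_ofReal ?_)
      · rw [Real.rpow_one]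
        exact (convex_ball (0 : Euc n) (1 / 2)).norm_image_sub_le_of_norm_fderiv_le
          (fun z hz => hdiff hγ1 z (ball_subset_ball (by norm_num) hz)) hg hy hx
      · have : 0 ≤ c * N := by positivity
        linarith
  · rcases hβγ with ⟨rfl, h1⟩ | ⟨-, h1⟩
    · have hγ1' := lt_of_le_of_ne hγ1 h1
      obtain ⟨c, hc, H⟩ := exists_holder_of_zygmund n hβ0 hγ1'
      refine ⟨1 + c, by positivity, fun v N hv _ hd => ?_⟩
      have hN : 0 ≤ N := (abs_nonneg _).trans (hv 0)
      refine (hNorm_le_of_le_one isOpen_ball hγ1 hN (by positivity) (fun x _ => hv x)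
        fun x _ y hy => H v N hv hd y hy x).trans_eq ?_
      congr 1; ring
    · exact absurd h1 (not_lt.2 hγ1)

/-- **Cordes–Nirenberg estimate in non-divergence form** (Theorem A).
Let `s ∈ (0,1)`, `β ∈ (0,2s)`, `ε > 0`, `0 < λ ≤ Λ`. There exist `η₀ > 0` and `C > 0`,
depending only on `n, s, β, ε, λ, Λ`, such that: if `(K_x)` is a family of symmetric Lévy
measures, uniformly elliptic of order `2s`, whose "coefficients" have oscillation at most
`η ≤ η₀` in the Kantorovich-type sense, and `u` is a solution of `L(u,x) = f` in `B₁` which is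
`C^{2s+}` on compact subsets of `B₁` and has finite `L^∞_{2s-ε}` norm, with `f ∈ L^∞(B₁)`,
then `‖u‖_{C^β(B_{1/2})} ≤ C (‖u‖_{L^∞_{2s-ε}(ℝⁿ)} + ‖f‖_{L^∞(B₁)})`. -/
theorem stmt0 (n : ℕ) (s β ε lam Lam : ℝ)
    (hs : s ∈ Set.Ioo (0 : ℝ) 1) (hβ : β ∈ Set.Ioo 0 (2 * s)) (hε : 0 < ε)
    (hlam : 0 < lam) (hlamLam : lam ≤ Lam) :
    ∃ η₀ > (0 : ℝ), ∃ C > (0 : ℝ),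
      ∀ (K : Euc n → Measure (Euc n)) (η : ℝ),
        (∀ x, IsLevyMeasure (K x)) →
        (∀ x, UnifElliptic s lam Lam (K x)) →
        0 < η → η ≤ η₀ →
        (∀ x x' : Euc n, KantCond s β (K x) (K x') η) →
        ∀ u f : Euc n → ℝ,
          supNorm (ball 0 1) f ≠ ⊤ →
          (∃ ε' > (0 : ℝ), HolderMemLoc (2 * s + ε') (ball 0 1) u) →
          supNormW (2 * s - ε) u ≠ ⊤ →
          SolvesPtwise K u f (ball 0 1) →
          hNorm β (ball 0 (1 / 2)) u ≤
            ENNReal.ofReal C * (supNormW (2 * s - ε) u + supNorm (ball 0 1) f) := by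
  have hLam : 0 < Lam := hlam.trans_le hlamLam
  obtain ⟨γ, hγ0, hγ, hβγ, hβγ'⟩ : ∃ γ : ℝ, 0 < γ ∧ γ < 2 * s ∧ (β ≤ 1 ∨ γ = β) ∧
      (γ = β ∧ β ≠ 1 ∨ β = 1 ∧ 1 < γ) := by
    rcases eq_or_ne β 1 with h | h
    · have h1 := hβ.2
      refine ⟨(1 + 2 * s) / 2, ?_, ?_, Or.inl h.le, Or.inr ⟨h, ?_⟩⟩ <;> linarith
    · exact ⟨β, hβ.1, hβ.2, Or.inr rfl, Or.inl ⟨rfl, h⟩⟩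
  have hγ2 : γ < 2 := hγ.trans (by linarith [hs.2])
  obtain ⟨η₀, hη₀, C, hC, H⟩ := exists_zygmund_estimate n (τ := 2 * s - ε) hs hlam hLam hβ.1 hγ0 hγ
    hβγ (by linarith)
  obtain ⟨c, hc, H'⟩ := exists_hNorm_le n hβ.1 hγ2 hβγ'
  refine ⟨η₀, hη₀, c * C, by positivity, fun K η hLevy hUE hη hηle hKant u f hf hu huW hsol => ?_⟩
  obtain ⟨ε', hε', hu⟩ := hu
  have hs0 := hs.1
  obtain ⟨Φ, hΦ, hz⟩ := exists_zygmund_of_holderMemLoc (γ := γ) (by linarith) hγ2.le hu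
  set Tot := supNormW (2 * s - ε) u + supNorm (ball 0 1) f with hTot
  have hTtop : Tot ≠ ⊤ := ENNReal.add_ne_top.2 ⟨huW, hf⟩
  have huT : ∀ x, |u x| ≤ Tot.toReal * (1 + ‖x‖ ^ (2 * s - ε)) := fun x => by
    have h1 : ENNReal.ofReal (|u x| / (1 + ‖x‖ ^ (2 * s - ε))) ≤ Tot :=
      (le_iSup (fun x => ENNReal.ofReal (|u x| / (1 + ‖x‖ ^ (2 * s - ε)))) x).trans le_self_add
    have h2 := (ENNReal.ofReal_le_iff_le_toReal hTtop).1 h1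
    rwa [div_le_iff₀ (by positivity)] at h2
  have hfT : ∀ x ∈ ball (0 : Euc n) 1, |f x| ≤ Tot.toReal := fun x hx => by
    have h1 : ENNReal.ofReal |f x| ≤ Tot :=
      (le_iSup (fun x : ball (0 : Euc n) 1 => ENNReal.ofReal |f x|) ⟨x, hx⟩).trans le_add_self
    exact (ENNReal.ofReal_le_iff_le_toReal hTtop).1 h1
  have heq : ∀ x ∈ ball (0 : Euc n) 1, Integrable (fun y => d2 u x y) (K x) ∧
      |∫ y, d2 u x y ∂(K x)| ≤ 2 * Tot.toReal := fun x hx => by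
    obtain ⟨hi, hL⟩ := hsol x hx
    have e : (fun y => d2 u x y) = fun y => -(2 * u x - u (x + y) - u (x - y)) := by
      funext y; simp only [d2]; ring
    rw [e]
    refine ⟨hi.neg, ?_⟩
    rw [integral_neg, abs_neg]
    have h2 : ∫ y, (2 * u x - u (x + y) - u (x - y)) ∂(K x) = 2 * f x := by
      rw [Lop] at hL; linarith
    rw [h2, abs_mul, abs_two]
    linarith [hfT x hx]
  have key : ∀ S, Tot.toReal ≤ S → 0 < S →
      hNorm β (ball 0 (1 / 2)) u ≤ ENNReal.ofReal (c * (C * S)) := by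
    intro S hTS hS
    obtain ⟨v, -, hvu, hvS, hvd⟩ := H K (fun x => .of_unifElliptic (hLevy x) (hUE x))
      (fun x x' => ((hKant x x').kc hβ.1 (by linarith [hβ.2, hs.2])).mono hηle) u S Φ hS
      hu.1.continuousOn
      (fun x => (huT x).trans (mul_le_mul_of_nonneg_right hTS (by positivity)))
      (fun x hx => ⟨(heq x hx).1, (heq x hx).2.trans (by linarith)⟩) hΦ hz
    rw [hNorm_congr (v := v) fun x hx => (hvu x (by
      have := mem_ball_zero_iff.1 hx; linarith)).symm]
    refine H' v (C * S) hvS (fun hγ1 x hx => ?_) hvd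
    have hx' := mem_ball_zero_iff.1 hx
    have hdeg : hDeg (2 * s + ε') ≠ 0 := by
      have : 1 < ⌈2 * s + ε'⌉₊ := Nat.lt_ceil.2 (by push_cast; linarith)
      unfold hDeg; omega
    have hdu : DifferentiableAt ℝ u x :=
      (hu.1.contDiffAt (isOpen_ball.mem_nhds (by
        rw [mem_ball_zero_iff]; linarith))).differentiableAt (by exact_mod_cast hdeg)
    refine hdu.congr_of_eventuallyEq ?_
    filter_upwards [isOpen_ball.mem_nhds hx] with y hy
    exact hvu y (by have := mem_ball_zero_iff.1 hy; linarith)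
  refine ENNReal.le_of_forall_pos_le_add fun δ hδ _ => ?_
  have hδ' : (0 : ℝ) < δ := hδ
  refine (key (Tot.toReal + δ / (c * C)) (le_add_of_nonneg_right (by positivity))
    (by positivity)).trans_eq ?_
  have e : c * (C * (Tot.toReal + δ / (c * C))) = c * C * Tot.toReal + δ := by
    field_simp
  rw [e, ENNReal.ofReal_add (by positivity) hδ'.le, ENNReal.ofReal_mul (by positivity),
    ENNReal.ofReal_toReal hTtop, ENNReal.ofReal_coe_nnreal]

end
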